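/- arXiv:1109.4472 — 3 statements merged into one kernel-verified Lean document; each statement's English description precedes it below -/
import Mathlib

section
/- Let r and s be integers with 2 ≤ s ≤ r, and let ℓ be the smallest positive integer such that ⌈r·2^{-ℓ}⌉ < s (equivalently, the smallest ℓ with 2^ℓ·(s−1) ≥ r). Then for every α > 0, every β > 0, and every integer n ≥ 1, there exist an integer N ≥ n and a simple graph G on N vertices such that: (1) G contains no clique K_{r+s}; (2) G has at least (2^{-ℓ-2} − α)·N² edges; and (3) α_r(G) < βN, i.e., every set of at least βN vertices of G induces a subgraph containing K_r. In particular RT_r(n, K_{r+s}, o(n)) ≥ 2^{-ℓ-2} n². -/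
namespace RT

open Finset

/-- cyclic absolute value on `ZMod M` -/
def cyc {M : ℕ} (a : ZMod M) : ℕ := a.valMinAbs.natAbs

lemma cyc_zero {M : ℕ} : cyc (0 : ZMod M) = 0 := by simp [cyc]

lemma cyc_neg {M : ℕ} (a : ZMod M) : cyc (-a) = cyc a := ZMod.natAbs_valMinAbs_neg a

lemma cyc_sub_comm {M : ℕ} (a b : ZMod M) : cyc (a - b) = cyc (b - a) := by
  rw [← cyc_neg, neg_sub]

lemma cyc_add_le {M : ℕ} (a b : ZMod M) : cyc (a + b) ≤ cyc a + cyc b :=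
  (ZMod.natAbs_valMinAbs_add_le a b).trans (Int.natAbs_add_le _ _)

lemma cyc_intCast_le {M : ℕ} [NeZero M] (z : ℤ) : cyc (z : ZMod M) ≤ z.natAbs := by
  unfold cyc
  apply ZMod.natAbs_min_of_le_div_two M
  · simp
  · exact ZMod.natAbs_valMinAbs_le _

lemma cyc_one_le {M : ℕ} [NeZero M] : cyc (1 : ZMod M) ≤ 1 := by
  simpa using cyc_intCast_le (M := M) 1

lemma le_cyc_of_ne {M : ℕ} [NeZero M] (f : ℕ) (hf : f ∣ M) (z : ℤ)
    (hz : ((z * (M / f : ℕ) : ℤ) : ZMod M) ≠ 0) :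
    M / f ≤ cyc ((z * (M / f : ℕ) : ℤ) : ZMod M) := by
  set a := ((z * (M / f : ℕ) : ℤ) : ZMod M) with ha
  have h1 : ((a.valMinAbs : ℤ) : ZMod M) = ((z * (M / f : ℕ) : ℤ) : ZMod M) := by
    rw [ZMod.coe_valMinAbs]
  rw [ZMod.intCast_eq_intCast_iff_dvd_sub] at h1
  have h2 : ((M / f : ℕ) : ℤ) ∣ a.valMinAbs := by
    have h3 : ((M / f : ℕ) : ℤ) ∣ (M : ℤ) := by
      exact_mod_cast Nat.div_dvd_of_dvd hf
    have h4 := h3.trans h1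
    exact (dvd_sub_right (Dvd.intro_left z rfl)).1 h4
  have h5 : a.valMinAbs ≠ 0 := by
    rwa [Ne, ZMod.valMinAbs_eq_zero]
  have h6 := Int.natAbs_dvd_natAbs.2 h2
  simp only [Int.natAbs_natCast] at h6
  exact Nat.le_of_dvd (Int.natAbs_pos.2 h5) h6

/-- unnormalised variance -/
def dv {X : Type*} [Fintype X] (g : X → ℝ) : ℝ :=
  (Fintype.card X : ℝ) * ∑ x, g x ^ 2 - (∑ x, g x) ^ 2

lemma two_dv {X : Type*} [Fintype X] (g : X → ℝ) :
    2 * dv g = ∑ x, ∑ y, (g x - g y) ^ 2 := by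
  unfold dv
  have : ∀ x y, (g x - g y) ^ 2 = g x ^ 2 + g y ^ 2 - 2 * (g x * g y) := by intros; ring
  simp only [this, Finset.sum_sub_distrib, Finset.sum_add_distrib, ← Finset.mul_sum,
    ← Finset.sum_mul, Finset.sum_const, Finset.card_univ, nsmul_eq_mul]
  ring

lemma dv_prod_aux {X Y : Type*} [Fintype X] [Fintype Y] (g : X → Y → ℝ) (P : Y → ℝ) (Q : X → ℝ)
    (G a b : ℝ) (hP : ∀ y, ∑ x, g x y = P y) (hQ : ∀ x, ∑ y, g x y = Q x)
    (hGP : ∑ y, P y = G) (hGQ : ∑ x, Q x = G) (ha : (Fintype.card X : ℝ) = a)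
    (hb : (Fintype.card Y : ℝ) = b) (ha0 : 0 < a) (hb0 : 0 < b) :
    0 ≤ a * b * (∑ x, ∑ y, g x y ^ 2) - b * ∑ y, P y ^ 2 - a * ∑ x, Q x ^ 2 + G ^ 2 := by
  have key : 0 ≤ ∑ x, ∑ y, (a * b * g x y - b * P y - a * Q x + G) ^ 2 :=
    Finset.sum_nonneg fun x _ => Finset.sum_nonneg fun y _ => sq_nonneg _
  have e : ∀ x y, (a * b * g x y - b * P y - a * Q x + G) ^ 2 =
      (a * b) ^ 2 * g x y ^ 2 + b ^ 2 * P y ^ 2 + a ^ 2 * Q x ^ 2 + G ^ 2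
       - (2 * a * b * b) * (g x y * P y) - (2 * a * b * a) * (Q x * g x y)
       + (2 * a * b * G) * g x y
       + (2 * a * b) * (Q x * P y) - (2 * b * G) * P y - (2 * a * G) * Q x := by intros; ring
  have s1 : ∑ x, ∑ y, g x y * P y = ∑ y, P y ^ 2 := by
    rw [Finset.sum_comm]
    refine Finset.sum_congr rfl fun y _ => ?_
    rw [← Finset.sum_mul, sq, hP]
  have s2 : ∑ x, Q x * Q x = ∑ x, Q x ^ 2 := by
    refine Finset.sum_congr rfl fun y _ => ?_
    rw [sq]
  simp only [e, Finset.sum_sub_distrib, Finset.sum_add_distrib, ← Finset.mul_sum, s1,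
    Finset.sum_const, Finset.card_univ, nsmul_eq_mul, hGP, hQ, ha, hb, hGQ, s2,
    ← Finset.sum_mul] at key
  have : 0 ≤ (a * b) * (a * b * (∑ x, ∑ y, g x y ^ 2) - b * ∑ y, P y ^ 2 - a * ∑ x, Q x ^ 2
      + G ^ 2) := by
    refine key.trans (le_of_eq ?_)
    ring
  exact nonneg_of_mul_nonneg_right this (mul_pos ha0 hb0)

lemma dv_prod {X Y : Type*} [Fintype X] [Fintype Y] (g : X × Y → ℝ) :
    dv g ≤ (Fintype.card Y : ℝ) * ∑ y, dv (fun x => g (x, y))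
      + (Fintype.card X : ℝ) * ∑ x, dv (fun y => g (x, y)) := by
  rcases isEmpty_or_nonempty X with hX | hX
  · simp [dv]
  rcases isEmpty_or_nonempty Y with hY | hY
  · simp [dv]
  have hx : (0 : ℝ) < Fintype.card X := by exact_mod_cast Fintype.card_pos
  have hy : (0 : ℝ) < Fintype.card Y := by exact_mod_cast Fintype.card_pos
  unfold dv
  rw [Fintype.card_prod]
  simp only [Fintype.sum_prod_type, Finset.sum_sub_distrib, ← Finset.mul_sum]
  rw [Finset.sum_comm (f := fun y x => g (x, y) ^ 2)]
  push_cast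
  have key := dv_prod_aux (fun x y => g (x, y)) (fun y => ∑ x, g (x, y)) (fun x => ∑ y, g (x, y))
    (∑ x, ∑ y, g (x, y)) _ _ (fun _ => rfl) (fun _ => rfl) Finset.sum_comm rfl rfl rfl hx hy
  linarith

lemma dv_cyclic {M : ℕ} [NeZero M] (g : ZMod M → ℝ) :
    dv g ≤ (M : ℝ) ^ 3 * ∑ a, (g (a + 1) - g a) ^ 2 := by
  set E := ∑ a, (g (a + 1) - g a) ^ 2 with hE
  have hE0 : 0 ≤ E := Finset.sum_nonneg fun _ _ => sq_nonneg _
  have hb : ∀ b : ℕ, ∑ a : ZMod M, (g (a + b) - g a) ^ 2 ≤ (b : ℝ) ^ 2 * E := by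
    intro b
    have h1 : ∀ a : ZMod M, (g (a + b) - g a) ^ 2 ≤
        b * ∑ j ∈ range b, (g (a + j + 1) - g (a + j)) ^ 2 := by
      intro a
      have : g (a + b) - g a = ∑ j ∈ range b, (g (a + j + 1) - g (a + j)) := by
        have := Finset.sum_range_sub (fun j : ℕ => g (a + j)) b
        simp only [Nat.cast_zero, add_zero] at this
        rw [← this]
        refine Finset.sum_congr rfl fun j _ => ?_
        push_cast
        rw [add_assoc]
      rw [this]
      have := sq_sum_le_card_mul_sum_sq (s := range b)
        (f := fun j : ℕ => g (a + j + 1) - g (a + j))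
      simpa using this
    calc _ ≤ ∑ a : ZMod M, b * ∑ j ∈ range b, (g (a + j + 1) - g (a + j)) ^ 2 :=
          Finset.sum_le_sum fun a _ => h1 a
      _ = b * ∑ j ∈ range b, E := by
          rw [← Finset.mul_sum, Finset.sum_comm]
          congr 1
          refine Finset.sum_congr rfl fun j _ => ?_
          exact Equiv.sum_comp (Equiv.addRight (j : ZMod M)) (fun a => (g (a + 1) - g a) ^ 2)
      _ = _ := by simp; ring
  have h2 : 2 * dv g ≤ (M : ℝ) ^ 3 * E := by
    rw [two_dv, Finset.sum_comm]
    calc ∑ y, ∑ x, (g x - g y) ^ 2 = ∑ y : ZMod M, ∑ x, (g (x + y) - g x) ^ 2 := by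
          rw [Finset.sum_comm, Finset.sum_comm (f := fun y x => (g (x + y) - g x) ^ 2)]
          have : ∀ x, ∑ y, (g (x + y) - g x) ^ 2 = ∑ y, (g y - g x) ^ 2 := fun x =>
            Equiv.sum_comp (Equiv.addLeft x) (fun y => (g y - g x) ^ 2)
          simp only [this]
          rw [Finset.sum_comm]
      _ ≤ ∑ y : ZMod M, (M : ℝ) ^ 2 * E := by
          refine Finset.sum_le_sum fun y _ => ?_
          have h := hb y.val
          rw [ZMod.natCast_zmod_val] at h
          refine h.trans ?_
          have : (y.val : ℝ) ≤ M := by exact_mod_cast (ZMod.val_lt y).le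
          gcongr
      _ = _ := by simp [ZMod.card]; ring
  have : 0 ≤ (M : ℝ) ^ 3 * E := by positivity
  linarith

lemma dv_congr {X Y : Type*} [Fintype X] [Fintype Y] (e : X ≃ Y) (g : Y → ℝ) :
    dv g = dv (g ∘ e) := by
  unfold dv
  rw [Fintype.card_congr e]
  simp only [Function.comp]
  rw [e.sum_comp (fun y => g y ^ 2), e.sum_comp (fun y => g y)]

lemma dv_torus {M : ℕ} [NeZero M] (D : ℕ) (g : (Fin D → ZMod M) → ℝ) :
    dv g ≤ (M : ℝ) ^ 2 * (M : ℝ) ^ D * ∑ k, ∑ x, (g (x + Pi.single k 1) - g x) ^ 2 := by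
  induction D with
  | zero => simp [dv]
  | succ D ih =>
    let e : ZMod M × (Fin D → ZMod M) ≃ (Fin (D + 1) → ZMod M) :=
      Fin.consEquiv (fun _ => ZMod M)
    have he : ∀ a x, e (a, x) = Fin.cons a x := fun a x => rfl
    rw [dv_congr e]
    refine (dv_prod _).trans ?_
    have h1 : ∀ y, dv (fun x => (g ∘ e) (x, y)) ≤ (M : ℝ) ^ 3 *
        ∑ a, (g (e (a, y) + Pi.single 0 1) - g (e (a, y))) ^ 2 := by
      intro y
      refine (dv_cyclic _).trans (le_of_eq ?_)
      congr 1
      refine Finset.sum_congr rfl fun a _ => ?_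
      have : e (a, y) + Pi.single 0 1 = e (a + 1, y) := by
        rw [he, he]
        ext k
        refine Fin.cases ?_ (fun k => ?_) k <;> simp
      rw [this]; rfl
    have h2 : ∀ x, dv (fun y => (g ∘ e) (x, y)) ≤ (M : ℝ) ^ 2 * (M : ℝ) ^ D *
        ∑ k : Fin D, ∑ y, (g (e (x, y) + Pi.single k.succ 1) - g (e (x, y))) ^ 2 := by
      intro x
      refine (ih _).trans (le_of_eq ?_)
      congr 1
      refine Finset.sum_congr rfl fun k _ => Finset.sum_congr rfl fun y _ => ?_
      have : e (x, y) + Pi.single k.succ 1 = e (x, y + Pi.single k 1) := by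
        rw [he, he]
        ext j
        refine Fin.cases ?_ (fun j => ?_) j
        · simp
        · simp [Pi.single_apply]
      rw [this]; rfl
    have hS : ∀ k : Fin (D + 1), ∑ x, (g (x + Pi.single k 1) - g x) ^ 2 =
        ∑ a, ∑ y, (g (e (a, y) + Pi.single k 1) - g (e (a, y))) ^ 2 := by
      intro k
      rw [← e.sum_comp, Fintype.sum_prod_type]
    rw [Fin.sum_univ_succ]
    simp only [hS]
    have h1' := Finset.sum_le_sum (s := univ) fun y _ => h1 y
    have h2' := Finset.sum_le_sum (s := univ) fun y _ => h2 y
    rw [← Finset.mul_sum, Finset.sum_comm] at h1'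
    rw [← Finset.mul_sum, Finset.sum_comm] at h2'
    have c1 : (Fintype.card (Fin D → ZMod M) : ℝ) = (M : ℝ) ^ D := by simp [ZMod.card]
    have c2 : (Fintype.card (ZMod M) : ℝ) = (M : ℝ) := by simp [ZMod.card]
    rw [c1, c2]
    refine (add_le_add (mul_le_mul_of_nonneg_left h1' (by positivity))
      (mul_le_mul_of_nonneg_left h2' (by positivity))).trans (le_of_eq ?_)
    ring

end RT

namespace RT
open Finset

/-- squared distance on the torus -/
noncomputable def d2 {M : ℕ} {K : Type*} [Fintype K] (x y : K → ZMod M) : ℝ :=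
  ∑ k, (cyc (x k - y k) : ℝ) ^ 2

lemma d2_step {M D : ℕ} [NeZero M] (x a : Fin D → ZMod M) (k : Fin D) (ε : ZMod M)
    (hε : cyc ε ≤ 1) :
    d2 (x + Pi.single k ε) a ≤ d2 x a + 2 * cyc (x k - a k) + 1 := by
  unfold d2
  rw [← Finset.add_sum_erase _ _ (mem_univ k), ← Finset.add_sum_erase (a := k) univ
    (fun k => (cyc (x k - a k) : ℝ) ^ 2) (mem_univ k)]
  have h1 : ∑ j ∈ univ.erase k, (cyc ((x + Pi.single k ε : Fin D → ZMod M) j - a j) : ℝ) ^ 2 =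
      ∑ j ∈ univ.erase k, (cyc (x j - a j) : ℝ) ^ 2 := by
    refine Finset.sum_congr rfl fun j hj => ?_
    have : j ≠ k := (Finset.mem_erase.1 hj).1
    simp [this]
  rw [h1]
  have h2 : (cyc ((x + Pi.single k ε : Fin D → ZMod M) k - a k) : ℝ) ≤ cyc (x k - a k) + 1 := by
    have : (x + Pi.single k ε : Fin D → ZMod M) k - a k = (x k - a k) + ε := by simp; ring
    rw [this]
    have := cyc_add_le (x k - a k) ε
    exact_mod_cast this.trans (by omega)
  have h3 : (cyc ((x + Pi.single k ε : Fin D → ZMod M) k - a k) : ℝ) ^ 2 ≤ ((cyc (x k - a k) : ℝ) + 1) ^ 2 := by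
    gcongr
  linarith

lemma conc {β : ℝ} (hβ : 0 < β) {D M : ℕ} [NeZero M] (hDM : D ≤ M ^ 2)
    (A B : Finset (Fin D → ZMod M)) (hA : β * (M : ℝ) ^ D ≤ A.card)
    (hB : β * (M : ℝ) ^ D ≤ B.card) :
    ∃ a ∈ A, ∃ b ∈ B, d2 b a ≤ (1 + 10 / β) ^ 2 * (M : ℝ) ^ 2 := by
  by_contra! hcon
  have hM : (0 : ℝ) < M := by exact_mod_cast Nat.pos_of_ne_zero (NeZero.ne M)
  have hMD : (0 : ℝ) < (M : ℝ) ^ D := by positivity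
  have hne : A.Nonempty := by
    rw [← Finset.card_pos]
    have : (0 : ℝ) < A.card := lt_of_lt_of_le (by positivity) hA
    exact_mod_cast this
  set q : (Fin D → ZMod M) → ℝ := fun x => A.inf' hne (fun a => d2 x a) with hq
  set g : (Fin D → ZMod M) → ℝ := fun x => Real.sqrt (max (q x) ((M : ℝ) ^ 2)) with hg
  have hgM : ∀ x, (M : ℝ) ≤ g x := fun x => Real.le_sqrt_of_sq_le (le_max_right _ _)
  have hg0 : ∀ x, 0 < g x := fun x => hM.trans_le (hgM x)
  have hg2 : ∀ x, g x ^ 2 = max (q x) ((M : ℝ) ^ 2) := fun x =>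
    Real.sq_sqrt ((sq_nonneg (M : ℝ)).trans (le_max_right _ _))
  -- gradient bound
  have grad : ∀ x (ε : ZMod M), cyc ε ≤ 1 →
      ∑ k, (max (g (x + Pi.single k ε) - g x) 0) ^ 2 ≤ 5 / 2 := by
    intro x ε hε
    obtain ⟨a, haA, ha⟩ := Finset.exists_mem_eq_inf' hne (fun a => d2 x a)
    have hqx : q x = d2 x a := ha
    have h1 : ∀ k, (max (g (x + Pi.single k ε) - g x) 0) ^ 2 ≤
        (8 * (cyc (x k - a k) : ℝ) ^ 2 + 2) / (4 * g x ^ 2) := by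
      intro k
      set c : ℝ := (cyc (x k - a k) : ℝ) with hc
      have hc0 : 0 ≤ c := Nat.cast_nonneg _
      rcases le_total (g (x + Pi.single k ε)) (g x) with h | h
      · rw [max_eq_right (by linarith)]
        have := hg0 x
        rw [zero_pow two_ne_zero]
        positivity
      · rw [max_eq_left (by linarith)]
        have h2 : g (x + Pi.single k ε) ^ 2 ≤ g x ^ 2 + 2 * c + 1 := by
          rw [hg2, hg2]
          apply max_le
          · have : q (x + Pi.single k ε) ≤ d2 (x + Pi.single k ε) a :=
              Finset.inf'_le _ haA
            have h3 := d2_step x a k ε hε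
            have := le_max_left (q x) ((M : ℝ) ^ 2)
            linarith
          · have := le_max_right (q x) ((M : ℝ) ^ 2)
            linarith
        have h0 := hg0 x
        set u := g (x + Pi.single k ε) - g x with hu
        have hu0 : 0 ≤ u := by rw [hu]; linarith
        have h4 : 2 * g x * u ≤ 2 * c + 1 := by
          have : g (x + Pi.single k ε) = g x + u := by rw [hu]; ring
          rw [this] at h2
          nlinarith
        rw [le_div_iff₀ (by positivity)]
        have h5 : (2 * g x * u) ^ 2 ≤ (2 * c + 1) ^ 2 := by gcongr
        nlinarith [sq_nonneg (2 * c - 1)]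
    refine (Finset.sum_le_sum fun k _ => h1 k).trans ?_
    rw [← Finset.sum_div, Finset.sum_add_distrib, ← Finset.mul_sum]
    change (8 * d2 x a + _) / _ ≤ _
    rw [← hqx, div_le_iff₀ (by have := hg0 x; positivity), hg2]
    have hD : (D : ℝ) ≤ (M : ℝ) ^ 2 := by exact_mod_cast hDM
    have e1 := le_max_left (q x) ((M : ℝ) ^ 2)
    have e2 := le_max_right (q x) ((M : ℝ) ^ 2)
    simp only [sum_const, card_univ, Fintype.card_fin, nsmul_eq_mul]
    linarith
  have hE : ∑ k, ∑ x, (g (x + Pi.single k 1) - g x) ^ 2 ≤ 5 * (M : ℝ) ^ D := by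
    have h1 : ∀ k : Fin D, ∑ x, (g (x + Pi.single k 1) - g x) ^ 2 ≤
        ∑ x, (max (g (x + Pi.single k 1) - g x) 0) ^ 2 +
        ∑ x, (max (g (x + Pi.single k (-1)) - g x) 0) ^ 2 := by
      intro k
      have hsh := Equiv.sum_comp (Equiv.addRight (Pi.single k (1 : ZMod M) : Fin D → ZMod M))
        (fun x : Fin D → ZMod M => (max (g (x + Pi.single k (-1)) - g x) 0) ^ 2)
      rw [← hsh, ← Finset.sum_add_distrib]
      refine Finset.sum_le_sum fun x _ => ?_
      have : x + Pi.single k (1 : ZMod M) + Pi.single k (-1) = x := by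
        rw [add_assoc, ← Pi.single_add]; simp
      simp only [Equiv.coe_addRight, this]
      rcases le_total (g (x + Pi.single k 1)) (g x) with h | h
      · rw [max_eq_right (by linarith), max_eq_left (by linarith)]
        nlinarith
      · rw [max_eq_left (by linarith)]
        nlinarith [sq_nonneg (max (g x - g (x + Pi.single k 1)) 0)]
    refine (Finset.sum_le_sum fun k _ => h1 k).trans ?_
    rw [Finset.sum_add_distrib]
    refine (add_le_add (le_of_eq Finset.sum_comm) (le_of_eq Finset.sum_comm)).trans ?_
    have a1 := Finset.sum_le_sum (s := univ) fun x _ => grad x 1 cyc_one_le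
    have a2 := Finset.sum_le_sum (s := univ) fun x _ => grad x (-1)
      (by rw [cyc_neg]; exact cyc_one_le)
    refine (add_le_add a1 a2).trans ?_
    simp only [sum_const, card_univ, Fintype.card_fun, Fintype.card_fin, ZMod.card,
      nsmul_eq_mul]
    push_cast
    linarith
  have up := dv_torus D g
  have low : A.card * (B.card * ((10 / β) * M) ^ 2) ≤ 2 * dv g := by
    rw [two_dv]
    calc (A.card : ℝ) * (B.card * ((10 / β) * M) ^ 2)
        = ∑ a ∈ A, ∑ b ∈ B, ((10 / β) * (M : ℝ)) ^ 2 := by simp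
      _ ≤ ∑ a ∈ A, ∑ b ∈ B, (g a - g b) ^ 2 := by
          refine Finset.sum_le_sum fun a ha => Finset.sum_le_sum fun b hb => ?_
          have ga : g a = M := by
            rw [hg]
            have : q a ≤ 0 := by
              refine (Finset.inf'_le _ ha).trans (le_of_eq ?_)
              simp [d2, cyc_zero]
            simp only
            rw [max_eq_right (this.trans (by positivity)), Real.sqrt_sq hM.le]
          have gb : (1 + 10 / β) * M ≤ g b := by
            apply Real.le_sqrt_of_sq_le
            refine le_trans ?_ (le_max_left _ _)
            rw [mul_pow]
            exact Finset.le_inf' _ _ fun a ha => (hcon a ha b hb).le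
          have : (10 / β) * M ≤ g b - g a := by rw [ga]; linarith
          rw [← neg_sub, neg_sq]
          gcongr
      _ ≤ ∑ a ∈ A, ∑ b, (g a - g b) ^ 2 :=
          Finset.sum_le_sum fun a _ => Finset.sum_le_univ_sum_of_nonneg fun _ => sq_nonneg _
      _ ≤ _ := Finset.sum_le_univ_sum_of_nonneg fun _ => Finset.sum_nonneg fun _ _ => sq_nonneg _
  have low2 : (β * (M : ℝ) ^ D) * ((β * (M : ℝ) ^ D) * ((10 / β) * M) ^ 2) ≤
      A.card * (B.card * ((10 / β) * M) ^ 2) := by gcongr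
  have e : (β * (M : ℝ) ^ D) * ((β * (M : ℝ) ^ D) * ((10 / β) * M) ^ 2) =
      100 * ((M : ℝ) ^ 2 * (M : ℝ) ^ D * (M : ℝ) ^ D) := by
    field_simp; ring
  have up2 : (M : ℝ) ^ 2 * (M : ℝ) ^ D * ∑ k, ∑ x, (g (x + Pi.single k 1) - g x) ^ 2 ≤
      (M : ℝ) ^ 2 * (M : ℝ) ^ D * (5 * (M : ℝ) ^ D) := by gcongr
  have : 0 < (M : ℝ) ^ 2 * (M : ℝ) ^ D * (M : ℝ) ^ D := by positivity
  linarith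

/-- transported to arbitrary index types -/
lemma conc' {β : ℝ} (hβ : 0 < β) {K : Type*} [Fintype K] [DecidableEq K] {M : ℕ} [NeZero M]
    (hDM : Fintype.card K ≤ M ^ 2)
    (A B : Finset (K → ZMod M)) (hA : β * (M : ℝ) ^ Fintype.card K ≤ A.card)
    (hB : β * (M : ℝ) ^ Fintype.card K ≤ B.card) :
    ∃ a ∈ A, ∃ b ∈ B, d2 b a ≤ (1 + 10 / β) ^ 2 * (M : ℝ) ^ 2 := by
  let e := Fintype.equivFin K
  let E : (K → ZMod M) ≃ (Fin (Fintype.card K) → ZMod M) := Equiv.arrowCongr e (Equiv.refl _)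
  obtain ⟨a', ha', b', hb', h⟩ := conc hβ hDM (A.map E.toEmbedding) (B.map E.toEmbedding)
    (by simpa using hA) (by simpa using hB)
  obtain ⟨a, ha, rfl⟩ := Finset.mem_map.1 ha'
  obtain ⟨b, hb, rfl⟩ := Finset.mem_map.1 hb'
  refine ⟨a, ha, b, hb, le_trans (le_of_eq ?_) h⟩
  unfold d2
  rw [← e.symm.sum_comp]
  rfl

end RT

namespace RT
open Finset

/-- the character -/
noncomputable def ee {M : ℕ} [NeZero M] (a : ZMod M) : ℂ := ZMod.stdAddChar a

lemma ee_add {M : ℕ} [NeZero M] (a b : ZMod M) : ee (a + b) = ee a * ee b :=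
  AddChar.map_add_eq_mul _ _ _

lemma ee_int {M : ℕ} [NeZero M] (z : ℤ) :
    ee (z : ZMod M) = Complex.exp (2 * Real.pi * Complex.I * z / M) := ZMod.stdAddChar_coe _

lemma norm_ee {M : ℕ} [NeZero M] (a : ZMod M) : ‖ee a‖ = 1 := by
  obtain ⟨z, rfl⟩ := ZMod.intCast_surjective a
  rw [ee_int]
  have : (2 * Real.pi * Complex.I * z / M : ℂ) = ((2 * Real.pi * z / M : ℝ) : ℂ) * Complex.I := by
    push_cast; ring
  rw [this, Complex.norm_exp_ofReal_mul_I]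

lemma ee_half {M : ℕ} [NeZero M] (h : 2 ∣ M) : ee ((M / 2 : ℕ) : ZMod M) = -1 := by
  obtain ⟨m, rfl⟩ := h
  have hm : (m : ℂ) ≠ 0 := by
    have := NeZero.ne (2 * m)
    simp at this
    exact_mod_cast this
  have := ee_int (M := 2 * m) (m : ℤ)
  rw [Nat.mul_div_cancel_left _ (by norm_num)]
  push_cast at this
  rw [this, show (2 * Real.pi * Complex.I * m / (2 * m) : ℂ) = Real.pi * Complex.I by
    field_simp, Complex.exp_pi_mul_I]

lemma ee_quarter {M : ℕ} [NeZero M] (h : 4 ∣ M) : ee ((M / 4 : ℕ) : ZMod M) = Complex.I := by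
  obtain ⟨m, rfl⟩ := h
  have hm : (m : ℂ) ≠ 0 := by
    have := NeZero.ne (4 * m)
    simp at this
    exact_mod_cast this
  have := ee_int (M := 4 * m) (m : ℤ)
  rw [Nat.mul_div_cancel_left _ (by norm_num)]
  push_cast at this
  rw [this, show (2 * Real.pi * Complex.I * m / (4 * m) : ℂ) = Real.pi / 2 * Complex.I by
    field_simp; norm_num, Complex.exp_pi_div_two_mul_I]

lemma norm_ee_sub_one {M : ℕ} [NeZero M] (a : ZMod M) :
    ‖ee a - 1‖ ≤ 2 * Real.pi * cyc a / M := by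
  have h := ee_int (M := M) a.valMinAbs
  rw [ZMod.coe_valMinAbs] at h
  rw [h]
  have : (2 * Real.pi * Complex.I * a.valMinAbs / M : ℂ) =
      Complex.I * ((2 * Real.pi * a.valMinAbs / M : ℝ) : ℂ) := by
    push_cast; ring
  rw [this]
  refine (Real.norm_exp_I_mul_ofReal_sub_one_le).trans (le_of_eq ?_)
  rw [Real.norm_eq_abs, abs_div, abs_mul, abs_of_pos (by positivity : 0 < 2 * Real.pi),
    Nat.abs_cast]
  congr 2
  unfold cyc
  rw [Nat.cast_natAbs, Int.cast_abs]

/-- cosine -/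
noncomputable def co {M : ℕ} [NeZero M] (a : ZMod M) : ℝ := (ee a).re

lemma abs_co_le {M : ℕ} [NeZero M] (a : ZMod M) : |co a| ≤ 1 := by
  rw [← norm_ee a]; exact Complex.abs_re_le_norm _

lemma co_half {M : ℕ} [NeZero M] (h : 2 ∣ M) (a : ZMod M) :
    co (a + ((M / 2 : ℕ) : ZMod M)) = - co a := by
  unfold co; rw [ee_add, ee_half h]; simp

lemma co_quarter {M : ℕ} [NeZero M] (h : 4 ∣ M) (a : ZMod M) :
    co a ^ 2 + co (a + ((M / 4 : ℕ) : ZMod M)) ^ 2 = 1 := by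
  unfold co; rw [ee_add, ee_quarter h]
  have := norm_ee a
  have h2 := Complex.normSq_eq_norm_sq (ee a)
  rw [this, Complex.normSq_apply] at h2
  simp
  nlinarith

lemma sum_co_sq {M : ℕ} [NeZero M] (h : 4 ∣ M) : ∑ a : ZMod M, co a ^ 2 = M / 2 := by
  have h1 : ∑ a : ZMod M, (co a ^ 2 + co (a + ((M / 4 : ℕ) : ZMod M)) ^ 2) = M := by
    simp [co_quarter h, ZMod.card]
  rw [Finset.sum_add_distrib] at h1
  have h2 := Equiv.sum_comp (Equiv.addRight ((M / 4 : ℕ) : ZMod M)) (fun a => co a ^ 2)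
  simp only [Equiv.coe_addRight] at h2
  rw [h2] at h1
  linarith

lemma norm_char_le {M : ℕ} [NeZero M] (h : 4 ∣ M) (t : ℝ) (ht : |t| ≤ 1) :
    ‖∑ a : ZMod M, Complex.exp (Complex.I * ((t * co a : ℝ) : ℂ))‖
      ≤ (1 - t ^ 2 / Real.pi ^ 2) * M := by
  have h2 : 2 ∣ M := (by norm_num : 2 ∣ 4).trans h
  have hreal : ∑ a : ZMod M, Complex.exp (Complex.I * ((t * co a : ℝ) : ℂ)) =
      ((∑ a : ZMod M, Real.cos (t * co a) : ℝ) : ℂ) := by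
    have hs := Equiv.sum_comp (Equiv.addRight ((M / 2 : ℕ) : ZMod M))
      (fun a => Complex.exp (Complex.I * ((t * co a : ℝ) : ℂ)))
    simp only [Equiv.coe_addRight, co_half h2] at hs
    have : (2 : ℂ) * ∑ a : ZMod M, Complex.exp (Complex.I * ((t * co a : ℝ) : ℂ)) =
        2 * ((∑ a : ZMod M, Real.cos (t * co a) : ℝ) : ℂ) := by
      nth_rewrite 1 [two_mul]
      nth_rewrite 1 [← hs]
      rw [← Finset.sum_add_distrib]
      push_cast
      rw [Finset.mul_sum]
      refine Finset.sum_congr rfl fun a _ => ?_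
      rw [Complex.two_cos, add_comm]
      congr 1 <;> congr 1 <;> ring
    exact mul_left_cancel₀ two_ne_zero this
  rw [hreal, Complex.norm_real, Real.norm_eq_abs]
  have hle : ∀ a : ZMod M, |t * co a| ≤ 1 := fun a => by
    rw [abs_mul]; exact mul_le_one₀ ht (abs_nonneg _) (abs_co_le a)
  have hpos : 0 ≤ ∑ a : ZMod M, Real.cos (t * co a) := Finset.sum_nonneg fun a _ =>
    (Real.cos_pos_of_le_one (hle a)).le
  rw [abs_of_nonneg hpos]
  calc _ ≤ ∑ a : ZMod M, (1 - 2 / Real.pi ^ 2 * (t * co a) ^ 2) :=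
        Finset.sum_le_sum fun a _ => Real.cos_le_one_sub_mul_cos_sq ((hle a).trans (by
          linarith [Real.pi_gt_three]))
    _ = M - 2 / Real.pi ^ 2 * t ^ 2 * ∑ a : ZMod M, co a ^ 2 := by
        rw [Finset.sum_sub_distrib, Finset.mul_sum]
        simp [ZMod.card]
        refine Finset.sum_congr rfl fun a _ => by ring
    _ = _ := by rw [sum_co_sq h]; ring

/-- the sum of cosines -/
noncomputable def SS {M : ℕ} [NeZero M] {d : ℕ} (θ : Fin d → ZMod M) : ℝ := ∑ k, co (θ k)

lemma norm_char_pow {M : ℕ} [NeZero M] (h : 4 ∣ M) (d : ℕ) (t : ℝ) (ht : |t| ≤ 1) :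
    ‖∑ θ : Fin d → ZMod M, Complex.exp (Complex.I * ((t * SS θ : ℝ) : ℂ))‖
      ≤ (1 - t ^ 2 / Real.pi ^ 2) ^ d * (M : ℝ) ^ d := by
  have : ∑ θ : Fin d → ZMod M, Complex.exp (Complex.I * ((t * SS θ : ℝ) : ℂ)) =
      (∑ a : ZMod M, Complex.exp (Complex.I * ((t * co a : ℝ) : ℂ))) ^ d := by
    rw [Fintype.sum_pow]
    refine Finset.sum_congr rfl fun θ _ => ?_
    rw [← Complex.exp_sum, SS]
    congr 1
    push_cast
    rw [Finset.mul_sum, Finset.mul_sum]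
  rw [this, norm_pow, ← mul_pow]
  exact pow_le_pow_left₀ (norm_nonneg _) (norm_char_le h t ht) d

end RT

namespace RT
open Finset

lemma small_ball_aux {M : ℕ} [NeZero M] (h : 4 ∣ M) (d n : ℕ) (hn : 0 < n) (τ u : ℝ) (hτ : 0 ≤ τ)
    (hu : 0 < u) (hun : n * u ≤ 1) (hunτ : n * u * τ ≤ 1) :
    ((univ.filter fun θ : Fin d → ZMod M => |SS θ| ≤ τ).card : ℝ) ≤
      (4 / n + 4 * (1 - u ^ 2 / Real.pi ^ 2) ^ d) * (M : ℝ) ^ d := by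
  set c := (1 - u ^ 2 / Real.pi ^ 2) ^ d with hc
  have hn' : (0 : ℝ) < n := by exact_mod_cast hn
  have hn1 : (1 : ℝ) ≤ n := by exact_mod_cast hn
  have hu1 : u ≤ 1 := by nlinarith
  have hpi := Real.pi_gt_three
  have hc0 : 0 ≤ c := by
    apply pow_nonneg
    rw [sub_nonneg, div_le_one (by positivity)]
    gcongr
    linarith
  let F : (Fin d → ZMod M) → ℂ := fun θ =>
    ∑ m ∈ range n, Complex.exp (Complex.I * ((m * u * SS θ : ℝ) : ℂ))
  have hF : ∀ θ, ((‖F θ‖ ^ 2 : ℝ) : ℂ) = ∑ m ∈ range n, ∑ m' ∈ range n,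
      Complex.exp (Complex.I * ((((m : ℝ) - m') * u * SS θ : ℝ) : ℂ)) := by
    intro θ
    have : ((‖F θ‖ ^ 2 : ℝ) : ℂ) = F θ * (starRingEnd ℂ) (F θ) := by
      rw [Complex.mul_conj, Complex.normSq_eq_norm_sq]
    rw [this]
    simp only [F, map_sum, Finset.sum_mul_sum]
    refine Finset.sum_congr rfl fun m _ => Finset.sum_congr rfl fun m' _ => ?_
    rw [← Complex.exp_conj, ← Complex.exp_add]
    congr 1
    rw [map_mul, Complex.conj_I, Complex.conj_ofReal]
    push_cast
    ring
  have hsum : ∑ θ, ‖F θ‖ ^ 2 ≤ (n + n ^ 2 * c) * (M : ℝ) ^ d := by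
    have e1 : ∑ θ, ‖F θ‖ ^ 2 = ‖((∑ θ, ‖F θ‖ ^ 2 : ℝ) : ℂ)‖ := by
      rw [Complex.norm_real, Real.norm_eq_abs, abs_of_nonneg]
      exact Finset.sum_nonneg fun _ _ => sq_nonneg _
    have e2 : ((∑ θ, ‖F θ‖ ^ 2 : ℝ) : ℂ) = ∑ m ∈ range n, ∑ m' ∈ range n, ∑ θ : Fin d → ZMod M,
        Complex.exp (Complex.I * ((((m : ℝ) - m') * u * SS θ : ℝ) : ℂ)) := by
      rw [Complex.ofReal_sum]
      simp only [hF]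
      rw [Finset.sum_comm]
      refine Finset.sum_congr rfl fun m _ => ?_
      rw [Finset.sum_comm]
    have e3 : ∀ m ∈ range n, ∀ m' ∈ range n, ‖∑ θ : Fin d → ZMod M,
        Complex.exp (Complex.I * ((((m : ℝ) - m') * u * SS θ : ℝ) : ℂ))‖ ≤
        ((if m = m' then 1 else 0) + c) * (M : ℝ) ^ d := by
      intro m hm m' hm'
      by_cases hmm : m = m'
      · subst hmm
        simp [ZMod.card]
        have : 0 ≤ c * (M : ℝ) ^ d := by positivity
        linarith
      · rw [if_neg hmm, zero_add]
        have hm1 : (m : ℝ) ≤ n := by exact_mod_cast (Finset.mem_range.1 hm).le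
        have hm2 : (m' : ℝ) ≤ n := by exact_mod_cast (Finset.mem_range.1 hm').le
        have hm3 : (0 : ℝ) ≤ m := Nat.cast_nonneg _
        have hm4 : (0 : ℝ) ≤ m' := Nat.cast_nonneg _
        have hle : |(m : ℝ) - m'| ≤ n := by rw [abs_le]; constructor <;> linarith
        have hge : 1 ≤ |(m : ℝ) - m'| := by
          have : (m : ℤ) - m' ≠ 0 := by
            intro h; apply hmm; omega
          have := Int.one_le_abs this
          exact_mod_cast this
        have ht : |((m : ℝ) - m') * u| ≤ 1 := by
          rw [abs_mul, abs_of_pos hu]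
          nlinarith
        refine (norm_char_pow h d _ ht).trans ?_
        rw [hc]
        have h5 : u ^ 2 ≤ (((m : ℝ) - m') * u) ^ 2 := by
          rw [mul_pow, ← sq_abs ((m : ℝ) - m')]
          have : 1 ≤ |(m : ℝ) - m'| ^ 2 := by nlinarith
          nlinarith [sq_nonneg u]
        have h6 : (((m : ℝ) - m') * u) ^ 2 ≤ 1 := by
          rw [← sq_abs]; nlinarith [abs_nonneg (((m : ℝ) - m') * u)]
        gcongr
        rw [sub_nonneg, div_le_one (by positivity)]
        nlinarith
    rw [e1, e2]
    refine (norm_sum_le _ _).trans ?_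
    refine (Finset.sum_le_sum fun m hm => (norm_sum_le _ _).trans
      (Finset.sum_le_sum fun m' hm' => e3 m hm m' hm')).trans (le_of_eq ?_)
    simp only [← Finset.sum_mul, Finset.sum_add_distrib, Finset.sum_ite_eq, Finset.sum_const,
      Finset.card_range, nsmul_eq_mul]
    congr 1
    rw [Finset.sum_congr rfl (g := fun _ => (1 : ℝ)) (fun x hx => by rw [if_pos hx])]
    simp only [sum_const, card_range, nsmul_eq_mul]
    ring
  have hlow : ∀ θ : Fin d → ZMod M, |SS θ| ≤ τ → (n : ℝ) ^ 2 / 4 ≤ ‖F θ‖ ^ 2 := by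
    intro θ hθ
    have h1 : (n : ℝ) / 2 ≤ (F θ).re := by
      simp only [F, Complex.re_sum]
      have : ∀ m ∈ range n, (1 / 2 : ℝ) ≤
          (Complex.exp (Complex.I * ((m * u * SS θ : ℝ) : ℂ))).re := by
        intro m hm
        rw [mul_comm, Complex.exp_ofReal_mul_I_re]
        have hm1 : (m : ℝ) ≤ n := by exact_mod_cast (Finset.mem_range.1 hm).le
        have : |m * u * SS θ| ≤ 1 := by
          rw [abs_mul, abs_mul, abs_of_pos hu, Nat.abs_cast]
          calc (m : ℝ) * u * |SS θ| ≤ n * u * τ := by gcongr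
            _ ≤ 1 := hunτ
        have h2 := Real.one_sub_sq_div_two_le_cos (x := m * u * SS θ)
        have h3 : (m * u * SS θ) ^ 2 ≤ 1 := by
          rw [← sq_abs]; nlinarith [abs_nonneg (m * u * SS θ)]
        linarith
      have := Finset.sum_le_sum this
      simp only [sum_const, card_range, nsmul_eq_mul] at this
      linarith
    have h2 := (h1.trans (le_abs_self _)).trans (Complex.abs_re_le_norm _)
    have : ((n : ℝ) / 2) ^ 2 ≤ ‖F θ‖ ^ 2 := by gcongr
    linarith
  have hcount : ((univ.filter fun θ : Fin d → ZMod M => |SS θ| ≤ τ).card : ℝ) * ((n : ℝ) ^ 2 / 4) ≤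
      ∑ θ, ‖F θ‖ ^ 2 := by
    rw [← nsmul_eq_mul, ← Finset.sum_const]
    refine (Finset.sum_le_sum fun θ hθ => hlow θ (Finset.mem_filter.1 hθ).2).trans ?_
    exact Finset.sum_le_univ_sum_of_nonneg fun _ => sq_nonneg _
  have := hcount.trans hsum
  have e : (4 / n + 4 * c) * (M : ℝ) ^ d = ((n + n ^ 2 * c) * (M : ℝ) ^ d) / ((n : ℝ) ^ 2 / 4) := by
    field_simp
  rw [e, le_div_iff₀ (by positivity)]
  exact this

lemma small_ball (τ η : ℝ) (hτ : 0 ≤ τ) (hη : 0 < η) : ∃ d0 : ℕ, ∀ d ≥ d0, ∀ (M : ℕ) [NeZero M],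
    4 ∣ M → ((univ.filter fun θ : Fin d → ZMod M => |SS θ| ≤ τ).card : ℝ) ≤ η * (M : ℝ) ^ d := by
  obtain ⟨n, hn⟩ := exists_nat_gt (8 / η)
  have hn0 : (0 : ℝ) < n := lt_trans (by positivity) hn
  have hn1 : 0 < n := by exact_mod_cast hn0
  set u : ℝ := 1 / (n * (τ + 1)) with hu
  have hu0 : 0 < u := by positivity
  have hnu : n * u * (τ + 1) = 1 := by rw [hu]; field_simp
  have hnu0 : 0 < n * u := by positivity
  have hpi := Real.pi_gt_three
  have h1 : n * u ≤ 1 := by nlinarith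
  have hu1 : u ≤ 1 := by
    have : (1 : ℝ) ≤ n := by exact_mod_cast hn1
    nlinarith
  have hq : u ^ 2 / Real.pi ^ 2 ≤ 1 := by
    rw [div_le_one (by positivity)]
    nlinarith
  have hq0 : 0 < u ^ 2 / Real.pi ^ 2 := by positivity
  obtain ⟨d0, hd0⟩ := exists_pow_lt_of_lt_one (by positivity : 0 < η / 8)
    (by linarith : 1 - u ^ 2 / Real.pi ^ 2 < 1)
  refine ⟨d0, fun d hd M _ h4 => ?_⟩
  refine (small_ball_aux h4 d n hn1 τ u hτ hu0 h1 (by nlinarith)).trans ?_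
  gcongr
  have a1 : 4 / (n : ℝ) ≤ η / 2 := by
    rw [div_lt_iff₀ hη] at hn
    rw [div_le_iff₀ hn0]
    linarith
  have a2 : (1 - u ^ 2 / Real.pi ^ 2) ^ d ≤ (1 - u ^ 2 / Real.pi ^ 2) ^ d0 :=
    pow_le_pow_of_le_one (by linarith) (by linarith) hd
  linarith

lemma half_space (τ η : ℝ) (hτ : 0 ≤ τ) (hη : 0 < η) : ∃ d0 : ℕ, ∀ d ≥ d0, ∀ (M : ℕ) [NeZero M],
    4 ∣ M → (1 / 2 - η) * (M : ℝ) ^ d ≤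
      ((univ.filter fun θ : Fin d → ZMod M => τ < SS θ).card : ℝ) := by
  obtain ⟨d0, hd0⟩ := small_ball τ (2 * η) hτ (by positivity)
  refine ⟨d0, fun d hd M _ h4 => ?_⟩
  have hs := hd0 d hd M h4
  have h2 : 2 ∣ M := (by norm_num : 2 ∣ 4).trans h4
  set P := univ.filter fun θ : Fin d → ZMod M => τ < SS θ
  set Q := univ.filter fun θ : Fin d → ZMod M => |SS θ| ≤ τ
  set P' := univ.filter fun θ : Fin d → ZMod M => SS θ < -τ
  have hPP : P'.card ≤ P.card := by
    refine Finset.card_le_card_of_injOn (fun θ => θ + fun _ => ((M / 2 : ℕ) : ZMod M)) ?_ ?_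
    · intro θ hθ
      have hθ' : SS θ < -τ := by simpa [P'] using hθ
      have : SS (θ + fun _ => ((M / 2 : ℕ) : ZMod M)) = - SS θ := by
        simp [SS, co_half h2]
      simp only [P, Finset.coe_filter, Finset.mem_univ, true_and, Set.mem_ofPred_eq, this]
      linarith
    · intro a _ b _ h
      simpa using h
  have hU : (univ : Finset (Fin d → ZMod M)) ⊆ (P ∪ Q) ∪ P' := by
    intro θ _
    simp only [P, Q, P', Finset.mem_union, Finset.mem_filter, Finset.mem_univ, true_and, abs_le]
    by_cases h1 : τ < SS θ
    · exact Or.inl (Or.inl h1)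
    · by_cases h3 : SS θ < -τ
      · exact Or.inr h3
      · exact Or.inl (Or.inr ⟨by linarith, by linarith⟩)
  have hc := (Finset.card_le_card hU).trans ((Finset.card_union_le _ _).trans
    (Nat.add_le_add_right (Finset.card_union_le _ _) _))
  simp only [Finset.card_univ, Fintype.card_fun, Fintype.card_fin, ZMod.card] at hc
  have hc' : (M : ℝ) ^ d ≤ P.card + Q.card + P'.card := by exact_mod_cast hc
  have hPP' : (P'.card : ℝ) ≤ P.card := by exact_mod_cast hPP
  linarith

end RT

namespace RT
open Finset

/-- vertex space -/
abbrev Om (ℓ d M : ℕ) := (Fin ℓ → Fin d → ZMod M) × (Fin 3 → Fin d → ZMod M)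

/-- nearly antipodal blocks -/
def anti {d M : ℕ} (L : ℝ) (u v : Fin d → ZMod M) : Prop :=
  ∑ k, (cyc (u k - v k - ((M / 2 : ℕ) : ZMod M)) : ℝ) ^ 2 ≤ L

/-- separated blocks -/
def sep {d M : ℕ} (f Q : ℕ) (u v : Fin d → ZMod M) : Prop :=
  (univ.filter fun k => cyc (u k - v k) < M / (f + 1) + 1).card ≤ Q

lemma half_add_half {M : ℕ} (h : 2 ∣ M) :
    ((M / 2 : ℕ) : ZMod M) + ((M / 2 : ℕ) : ZMod M) = 0 := by
  rw [← Nat.cast_add, ← two_mul, Nat.mul_div_cancel' h, ZMod.natCast_self]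

lemma anti_symm {d M : ℕ} (h2 : 2 ∣ M) {L : ℝ} {u v : Fin d → ZMod M} (h : anti L u v) :
    anti L v u := by
  unfold anti at *
  refine le_trans (le_of_eq ?_) h
  refine Finset.sum_congr rfl fun k _ => ?_
  rw [← cyc_neg]
  congr 3
  have := half_add_half h2
  linear_combination this

lemma sep_symm {d M : ℕ} {f Q : ℕ} {u v : Fin d → ZMod M} (h : sep f Q u v) :
    sep f Q v u := by
  unfold sep at *
  simpa only [cyc_sub_comm] using h

lemma sep_card {d M : ℕ} [NeZero M] {f Q : ℕ} (hf : 0 < f) (hd : (f + 1) ^ 2 * Q < d) {X : Type*}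
    [DecidableEq X]
    (φ : X → Fin d → ZMod M) (T : Finset X) (hT : ∀ x ∈ T, ∀ y ∈ T, x ≠ y → sep f Q (φ x) (φ y)) :
    T.card ≤ f := by
  by_contra! hlt
  obtain ⟨T', hT', hc⟩ := Finset.exists_subset_card_eq (show f + 1 ≤ T.card from hlt)
  set w := M / (f + 1) + 1 with hw
  have hpair : ∀ k : Fin d, ∃ p ∈ T'.offDiag, cyc (φ p.1 k - φ p.2 k) < w := by
    intro k
    by_contra! hno
    have hinj : Set.InjOn (fun p : X × ℕ => φ p.1 k + (p.2 : ZMod M))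
        ((T' ×ˢ range w : Finset (X × ℕ)) : Set (X × ℕ)) := by
      rintro ⟨x, a⟩ hx ⟨y, b⟩ hy hxy
      simp only [Finset.coe_product, Set.mem_prod, Finset.mem_coe, Finset.mem_range] at hx hy
      simp only at hxy
      have h1 : φ x k - φ y k = (((b : ℤ) - a : ℤ) : ZMod M) := by
        push_cast
        linear_combination hxy
      have hxe : x = y := by
        by_contra hne
        have h2 := hno (x, y) (Finset.mem_offDiag.2 ⟨hx.1, hy.1, hne⟩)
        simp only at h2
        rw [h1] at h2
        have h3 := h2.trans (cyc_intCast_le _)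
        omega
      subst hxe
      have h4 : ((a : ℕ) : ZMod M) = (b : ZMod M) := by linear_combination hxy
      have hab : a = b := by
        rw [ZMod.natCast_eq_natCast_iff'] at h4
        have hlt : M / (f + 1) < M := Nat.div_lt_self (Nat.pos_of_ne_zero (NeZero.ne M)) (by omega)
        rwa [Nat.mod_eq_of_lt (by omega), Nat.mod_eq_of_lt (by omega)] at h4
      rw [hab]
    have hle := Finset.card_le_card_of_injOn (t := (univ : Finset (ZMod M))) _
      (fun _ _ => by simp) hinj
    rw [Finset.card_product, hc, Finset.card_range, Finset.card_univ, ZMod.card] at hle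
    have := Nat.lt_mul_div_succ M (show 0 < f + 1 by omega)
    rw [hw] at hle
    omega
  have hcov : (univ : Finset (Fin d)) ⊆ T'.offDiag.biUnion
      (fun p => univ.filter fun k => cyc (φ p.1 k - φ p.2 k) < w) := by
    intro k _
    obtain ⟨p, hp, h⟩ := hpair k
    exact Finset.mem_biUnion.2 ⟨p, hp, by simpa using h⟩
  have h1 := (Finset.card_le_card hcov).trans (Finset.card_biUnion_le_card_mul _ _ Q (by
    intro p hp
    rw [Finset.mem_offDiag] at hp
    exact hT _ (hT' hp.1) _ (hT' hp.2.1) hp.2.2))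
  rw [Finset.offDiag_card, hc, Finset.card_univ, Fintype.card_fin] at h1
  have h2 : ((f + 1) * (f + 1) - (f + 1)) * Q ≤ (f + 1) ^ 2 * Q :=
    Nat.mul_le_mul_right _ (by rw [sq]; omega)
  omega

lemma anti_of {d M : ℕ} (L : ℝ) (u v u' v' : Fin d → ZMod M) (h1 : d2 u u' ≤ L) (h2 : d2 v v' ≤ L)
    (h : ∀ k, u' k - v' k - ((M / 2 : ℕ) : ZMod M) = 0) : anti (4 * L) u v := by
  have : ∀ k, (cyc (u k - v k - ((M / 2 : ℕ) : ZMod M)) : ℝ) ^ 2 ≤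
      2 * (cyc (u k - u' k) : ℝ) ^ 2 + 2 * (cyc (v k - v' k) : ℝ) ^ 2 := by
    intro k
    have e : u k - v k - ((M / 2 : ℕ) : ZMod M) = (u k - u' k) + (-(v k - v' k)) := by
      linear_combination h k
    have h3 : (cyc (u k - v k - ((M / 2 : ℕ) : ZMod M)) : ℝ) ≤ cyc (u k - u' k) + cyc (v k - v' k) := by
      rw [e, ← cyc_neg (v k - v' k)]
      exact_mod_cast cyc_add_le _ _
    have h4 : (cyc (u k - v k - ((M / 2 : ℕ) : ZMod M)) : ℝ) ^ 2 ≤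
      ((cyc (u k - u' k) : ℝ) + cyc (v k - v' k)) ^ 2 := by gcongr
    nlinarith [sq_nonneg ((cyc (u k - u' k) : ℝ) - cyc (v k - v' k))]
  have h5 := Finset.sum_le_sum (s := univ) fun k _ => this k
  rw [Finset.sum_add_distrib, ← Finset.mul_sum, ← Finset.mul_sum] at h5
  unfold d2 at h1 h2
  unfold anti
  linarith

lemma sep_of {d M : ℕ} [NeZero M] (Λ : ℝ) (f r Q : ℕ) (hf : 0 < f) (hfr : f ≤ r) (hfM : f ∣ M)
    (hQ : 4 * Λ * r ^ 2 * (r + 1) ^ 2 ≤ Q)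
    (u v u' v' : Fin d → ZMod M) (h1 : d2 u u' ≤ Λ * (M : ℝ) ^ 2) (h2 : d2 v v' ≤ Λ * (M : ℝ) ^ 2)
    (h : ∀ k, M / f ≤ cyc (u' k - v' k)) : sep f Q u v := by
  have hM : (0 : ℝ) < M := by exact_mod_cast Nat.pos_of_ne_zero (NeZero.ne M)
  have hf' : (0 : ℝ) < f := by exact_mod_cast hf
  have hΛ : 0 ≤ Λ := by
    have : 0 ≤ d2 u u' := Finset.sum_nonneg fun _ _ => sq_nonneg _
    have := this.trans h1
    exact nonneg_of_mul_nonneg_left this (by positivity)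
  set B := univ.filter fun k => cyc (u k - v k) < M / (f + 1) + 1 with hB
  set w : ℝ := M / (f * (f + 1)) with hw
  have hk : ∀ k ∈ B, w ^ 2 / 2 ≤ (cyc (u k - u' k) : ℝ) ^ 2 + (cyc (v k - v' k) : ℝ) ^ 2 := by
    intro k hk
    have hk' : cyc (u k - v k) ≤ M / (f + 1) := by
      have := (Finset.mem_filter.1 hk).2
      omega
    have e1 : cyc (u' k - v' k) ≤ cyc (u k - u' k) + cyc (v k - v' k) + cyc (u k - v k) := by
      have e : u' k - v' k = (-(u k - u' k) + (v k - v' k)) + (u k - v k) := by ring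
      rw [e]
      have a1 := cyc_add_le (-(u k - u' k) + (v k - v' k)) (u k - v k)
      have a2 := cyc_add_le (-(u k - u' k)) (v k - v' k)
      rw [cyc_neg] at a2
      omega
    have e2 : M / f ≤ cyc (u k - u' k) + cyc (v k - v' k) + M / (f + 1) :=
      (h k).trans (e1.trans (by omega))
    have e3 : (M : ℝ) / f ≤ cyc (u k - u' k) + cyc (v k - v' k) + (M : ℝ) / (f + 1) := by
      have a1 : ((M / f : ℕ) : ℝ) = (M : ℝ) / f := Nat.cast_div hfM hf'.ne'
      have a2 : ((M / (f + 1) : ℕ) : ℝ) ≤ (M : ℝ) / (f + 1) := by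
        have := Nat.cast_div_le (α := ℝ) (m := M) (n := f + 1)
        push_cast at this
        exact this
      have a3 : ((M / f : ℕ) : ℝ) ≤ cyc (u k - u' k) + cyc (v k - v' k) + ((M / (f + 1) : ℕ) : ℝ) := by
        exact_mod_cast e2
      rw [← a1]
      linarith
    have e4 : (M : ℝ) / f - M / (f + 1) = w := by
      rw [hw]; field_simp; ring
    have e5 : w ≤ cyc (u k - u' k) + cyc (v k - v' k) := by linarith
    have hw0 : 0 ≤ w := by positivity
    have e6 : w ^ 2 ≤ ((cyc (u k - u' k) : ℝ) + cyc (v k - v' k)) ^ 2 := by gcongr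
    nlinarith [sq_nonneg ((cyc (u k - u' k) : ℝ) - cyc (v k - v' k))]
  have hsum : B.card * (w ^ 2 / 2) ≤ 2 * Λ * (M : ℝ) ^ 2 := by
    rw [← nsmul_eq_mul, ← Finset.sum_const]
    refine (Finset.sum_le_sum hk).trans ?_
    refine (Finset.sum_le_univ_sum_of_nonneg fun _ => by positivity).trans ?_
    rw [Finset.sum_add_distrib]
    unfold d2 at h1 h2
    linarith
  have e : (B.card : ℝ) ≤ 4 * Λ * f ^ 2 * (f + 1) ^ 2 := by
    have e1 : (B.card : ℝ) * (w ^ 2 / 2) = B.card / (2 * f ^ 2 * (f + 1) ^ 2) * (M : ℝ) ^ 2 := by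
      rw [hw]; field_simp
    rw [e1] at hsum
    have := le_of_mul_le_mul_right hsum (by positivity)
    rw [div_le_iff₀ (by positivity)] at this
    linarith
  have hfr' : (f : ℝ) ≤ r := by exact_mod_cast hfr
  have e' : 4 * Λ * (f : ℝ) ^ 2 * ((f : ℝ) + 1) ^ 2 ≤ 4 * Λ * r ^ 2 * (r + 1) ^ 2 := by gcongr
  have : (B.card : ℝ) ≤ Q := by linarith
  exact_mod_cast this

lemma shift_sep {M : ℕ} [NeZero M] (f : ℕ) (hf : f ∣ M) (hf0 : 0 < f) (a b : ℕ) (ha : a < f)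
    (hb : b < f) (hab : a ≠ b) :
    M / f ≤ cyc (((a * (M / f) : ℕ) : ZMod M) - ((b * (M / f) : ℕ) : ZMod M)) := by
  have e : (((a * (M / f) : ℕ) : ZMod M) - ((b * (M / f) : ℕ) : ZMod M)) =
      ((((a : ℤ) - b) * (M / f : ℕ) : ℤ) : ZMod M) := by
    generalize M / f = q
    push_cast; ring
  rw [e]
  apply le_cyc_of_ne f hf
  rw [← e, sub_ne_zero]
  intro h
  rw [ZMod.natCast_eq_natCast_iff'] at h
  obtain ⟨m, rfl⟩ := hf
  have hm : 0 < m := by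
    rcases Nat.eq_zero_or_pos m with h | h
    · subst h; exact absurd rfl (NeZero.ne (f * 0))
    · exact h
  rw [Nat.mul_div_cancel_left _ hf0, Nat.mod_eq_of_lt (by gcongr), Nat.mod_eq_of_lt (by gcongr)] at h
  exact hab (Nat.eq_of_mul_eq_mul_right hm h)

lemma co_sub {M : ℕ} [NeZero M] (a b : ZMod M) :
    co (a - b) = (ee a * (starRingEnd ℂ) (ee b)).re := by
  have h : ee a = ee (a - b) * ee b := by rw [← ee_add, sub_add_cancel]
  unfold co
  rw [h, mul_assoc, Complex.mul_conj, Complex.normSq_eq_norm_sq, norm_ee]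
  simp

lemma norm_ee_add {M : ℕ} [NeZero M] (h2 : 2 ∣ M) (a b : ZMod M) :
    ‖ee a + ee b‖ ≤ 2 * Real.pi * cyc (a - b - ((M / 2 : ℕ) : ZMod M)) / M := by
  have h : ee a = ee (a - b - ((M / 2 : ℕ) : ZMod M)) * ee b * ee ((M / 2 : ℕ) : ZMod M) := by
    rw [← ee_add, ← ee_add]; congr 1; ring
  rw [h, ee_half h2]
  have : ee (a - b - ((M / 2 : ℕ) : ZMod M)) * ee b * -1 + ee b =
      - ((ee (a - b - ((M / 2 : ℕ) : ZMod M)) - 1) * ee b) := by ring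
  rw [this, norm_neg, norm_mul, norm_ee, mul_one]
  exact norm_ee_sub_one _

lemma anti_cross {d M : ℕ} [NeZero M] (h2 : 2 ∣ M) (Λ τ : ℝ) (hτ : 0 ≤ τ)
    (hΛτ : 4 * Real.pi ^ 2 * (4 * Λ) ≤ τ)
    (x x' y y' : Fin d → ZMod M) (hx : anti (4 * (Λ * (M : ℝ) ^ 2)) x x')
    (hy : anti (4 * (Λ * (M : ℝ) ^ 2)) y y') (h1 : τ < SS (x - y)) (h3 : τ < SS (x - y'))
    (h4 : τ < SS (x' - y)) (h5 : τ < SS (x' - y')) : False := by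
  have hM : (0 : ℝ) < M := by exact_mod_cast Nat.pos_of_ne_zero (NeZero.ne M)
  have hb : ∀ u v : Fin d → ZMod M, anti (4 * (Λ * (M : ℝ) ^ 2)) u v →
      ∑ k, ‖ee (u k) + ee (v k)‖ ^ 2 ≤ τ := by
    intro u v huv
    calc ∑ k, ‖ee (u k) + ee (v k)‖ ^ 2 ≤
          ∑ k, (4 * Real.pi ^ 2 / M ^ 2) * (cyc (u k - v k - ((M / 2 : ℕ) : ZMod M)) : ℝ) ^ 2 := by
          refine Finset.sum_le_sum fun k _ => ?_
          have := pow_le_pow_left₀ (norm_nonneg _) (norm_ee_add h2 (u k) (v k)) 2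
          refine this.trans (le_of_eq ?_)
          ring
      _ ≤ (4 * Real.pi ^ 2 / M ^ 2) * (4 * (Λ * (M : ℝ) ^ 2)) := by
          rw [← Finset.mul_sum]
          gcongr
          exact huv
      _ = 4 * Real.pi ^ 2 * (4 * Λ) := by field_simp
      _ ≤ τ := hΛτ
  have e : SS (x - y) + SS (x - y') + SS (x' - y) + SS (x' - y') =
      ∑ k, ((ee (x k) + ee (x' k)) * (starRingEnd ℂ) (ee (y k) + ee (y' k))).re := by
    simp only [SS, Pi.sub_apply, co_sub, ← Finset.sum_add_distrib]
    refine Finset.sum_congr rfl fun k _ => ?_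
    simp only [← Complex.add_re]
    congr 1
    rw [map_add]
    ring
  have e2 : ∑ k, ((ee (x k) + ee (x' k)) * (starRingEnd ℂ) (ee (y k) + ee (y' k))).re ≤
      ∑ k, (‖ee (x k) + ee (x' k)‖ ^ 2 + ‖ee (y k) + ee (y' k)‖ ^ 2) / 2 := by
    refine Finset.sum_le_sum fun k _ => ?_
    refine (Complex.re_le_norm _).trans ?_
    rw [norm_mul, Complex.norm_conj]
    nlinarith [sq_nonneg (‖ee (x k) + ee (x' k)‖ - ‖ee (y k) + ee (y' k)‖)]
  rw [← Finset.sum_div, Finset.sum_add_distrib] at e2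
  have := hb x x' hx
  have := hb y y' hy
  linarith

end RT

namespace RT
open Finset

/-- the sign pattern -/
def sg (i j : ℕ) : Bool := if i = 0 then j.testBit 0 else xor (j.testBit 0) (j.testBit i)

lemma sg_ne (i j k : ℕ) (h : j / 2 = k / 2) (hjk : j ≠ k) : sg i j ≠ sg i k := by
  have h0 : j.testBit 0 ≠ k.testBit 0 := by
    rw [Nat.testBit_zero, Nat.testBit_zero]
    intro hc
    have : (j % 2 = 1) ↔ (k % 2 = 1) := by simpa using hc
    omega
  unfold sg
  split_ifs with hi
  · exact h0
  · obtain ⟨i', rfl⟩ := Nat.exists_eq_succ_of_ne_zero hi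
    rw [Nat.testBit_succ, Nat.testBit_succ, h]
    intro hc
    exact h0 (by simpa using hc)

lemma sg_eq (ℓ j k : ℕ) (hℓ : 0 < ℓ) (hs : ∀ i < ℓ, sg i j = sg i k) (h : j / 2 ^ ℓ = k / 2 ^ ℓ) :
    j = k := by
  have h0 : j.testBit 0 = k.testBit 0 := by simpa [sg] using hs 0 hℓ
  apply Nat.eq_of_testBit_eq
  intro i
  rcases lt_or_ge i ℓ with hi | hi
  · by_cases hi0 : i = 0
    · subst hi0; exact h0
    · have := hs i hi
      unfold sg at this
      rw [if_neg hi0, if_neg hi0, h0] at this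
      simpa using this
  · obtain ⟨m, rfl⟩ := Nat.exists_eq_add_of_le hi
    have := congrArg (fun z => z.testBit m) h
    simpa [Nat.testBit_div_two_pow, Nat.add_comm] using this

/-- colour labels -/
def cl (ℓ : ℕ) (a : Fin 3) (j : ℕ) : ℕ := ![j, j / 2, j / 2 ^ ℓ] a

/-- number of colours -/
def fs (r ℓ : ℕ) (a : Fin 3) : ℕ := ![r, (r + 1) / 2, (r + 2 ^ ℓ - 1) / 2 ^ ℓ] a

lemma cl_lt (r ℓ : ℕ) (a : Fin 3) (j : ℕ) (hj : j < r) : cl ℓ a j < fs r ℓ a := by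
  have hp : 0 < 2 ^ ℓ := by positivity
  fin_cases a
  · simpa [cl, fs] using hj
  · simp only [cl, fs]; change j / 2 < (r + 1) / 2; omega
  · change j / 2 ^ ℓ < (r + 2 ^ ℓ - 1) / 2 ^ ℓ
    rw [Nat.lt_iff_add_one_le, ← Nat.add_div_right _ hp]
    exact Nat.div_le_div_right (by omega)

lemma fs_pos (r ℓ : ℕ) (hr : 0 < r) (a : Fin 3) : 0 < fs r ℓ a :=
  lt_of_le_of_lt (Nat.zero_le _) (cl_lt r ℓ a 0 hr)

lemma fs_le (r ℓ : ℕ) (hr : 0 < r) (a : Fin 3) : fs r ℓ a ≤ r := by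
  have hp : 0 < 2 ^ ℓ := by positivity
  fin_cases a
  · simp [fs]
  · change (r + 1) / 2 ≤ r; omega
  · change (r + 2 ^ ℓ - 1) / 2 ^ ℓ ≤ r
    rw [← Nat.lt_add_one_iff, Nat.div_lt_iff_lt_mul hp]
    have : r ≤ r * 2 ^ ℓ := Nat.le_mul_of_pos_right _ hp
    rw [Nat.add_mul]
    omega

/-- nearness, blockwise -/
def near {ℓ d M : ℕ} (L : ℝ) (x y : Om ℓ d M) : Prop :=
  (∀ i, d2 (x.1 i) (y.1 i) ≤ L) ∧ (∀ a, d2 (x.2 a) (y.2 a) ≤ L)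

lemma d2_comm {M : ℕ} {K : Type*} [Fintype K] (x y : K → ZMod M) : d2 x y = d2 y x := by
  unfold d2; simp only [cyc_sub_comm]

lemma card_Om (ℓ d M : ℕ) [NeZero M] : Fintype.card (Om ℓ d M) = M ^ ((ℓ + 3) * d) := by
  simp [ZMod.card]
  rw [← pow_mul, ← pow_mul, ← pow_add]
  congr 1; ring

lemma conc_Om {β : ℝ} (hβ : 0 < β) {ℓ d M : ℕ} [NeZero M] (hDM : (ℓ + 3) * d ≤ M ^ 2)
    (A B : Finset (Om ℓ d M)) (hA : β * Fintype.card (Om ℓ d M) ≤ A.card)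
    (hB : β * Fintype.card (Om ℓ d M) ≤ B.card) :
    ∃ a ∈ A, ∃ b ∈ B, near ((1 + 10 / β) ^ 2 * (M : ℝ) ^ 2) a b := by
  let K := (Fin ℓ ⊕ Fin 3) × Fin d
  have hK : Fintype.card K = (ℓ + 3) * d := by simp [K]
  let Φ : Om ℓ d M → (K → ZMod M) := fun x p => Sum.elim (fun i => x.1 i p.2) (fun a => x.2 a p.2) p.1
  have hΦ : Function.Injective Φ := by
    intro x y h
    apply Prod.ext
    · funext i k
      exact congrFun h (Sum.inl i, k)
    · funext i k
      exact congrFun h (Sum.inr i, k)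
  rw [card_Om] at hA hB
  push_cast at hA hB
  obtain ⟨a', ha', b', hb', h⟩ := conc' hβ (K := K) (by rw [hK]; exact hDM)
    (A.map ⟨Φ, hΦ⟩) (B.map ⟨Φ, hΦ⟩) (by rw [hK, card_map]; exact hA) (by rw [hK, card_map]; exact hB)
  obtain ⟨a, ha, rfl⟩ := Finset.mem_map.1 ha'
  obtain ⟨b, hb, rfl⟩ := Finset.mem_map.1 hb'
  refine ⟨a, ha, b, hb, ?_⟩
  rw [d2_comm] at h
  have e : d2 (Φ a) (Φ b) = ∑ i, d2 (a.1 i) (b.1 i) + ∑ c, d2 (a.2 c) (b.2 c) := by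
    unfold d2
    rw [Fintype.sum_prod_type, Fintype.sum_sum_type]
    rfl
  have hn : ∀ (u v : Fin d → ZMod M), 0 ≤ d2 u v := fun u v =>
    Finset.sum_nonneg fun _ _ => sq_nonneg _
  have h' : ∑ i, d2 (a.1 i) (b.1 i) + ∑ c, d2 (a.2 c) (b.2 c) ≤ (1 + 10 / β) ^ 2 * (M : ℝ) ^ 2 := by
    rw [← e]; exact h
  have n1 : 0 ≤ ∑ i, d2 (a.1 i) (b.1 i) := Finset.sum_nonneg fun _ _ => hn _ _
  have n2 : 0 ≤ ∑ i, d2 (a.2 i) (b.2 i) := Finset.sum_nonneg fun _ _ => hn _ _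
  constructor
  · intro i
    have := Finset.single_le_sum (f := fun i => d2 (a.1 i) (b.1 i)) (fun _ _ => hn _ _)
      (Finset.mem_univ i)
    linarith
  · intro i
    have := Finset.single_le_sum (f := fun i => d2 (a.2 i) (b.2 i)) (fun _ _ => hn _ _)
      (Finset.mem_univ i)
    linarith

/-- adjacency inside a part -/
def innr {ℓ d M : ℕ} (r Q : ℕ) (L : ℝ) (x y : Om ℓ d M) : Prop :=
  sep (fs r ℓ 0) Q (x.2 0) (y.2 0) ∧
  ((∀ i, anti L (x.1 i) (y.1 i)) ∨ sep (fs r ℓ 1) Q (x.2 1) (y.2 1)) ∧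
  ((∃ i, anti L (x.1 i) (y.1 i)) ∨ sep (fs r ℓ 2) Q (x.2 2) (y.2 2))

lemma innr_symm {ℓ d M : ℕ} (h2 : 2 ∣ M) {r Q : ℕ} {L : ℝ} {x y : Om ℓ d M} (h : innr r Q L x y) :
    innr r Q L y x := by
  obtain ⟨h0, h1, h3⟩ := h
  refine ⟨sep_symm h0, ?_, ?_⟩
  · rcases h1 with h1 | h1
    · exact Or.inl fun i => anti_symm h2 (h1 i)
    · exact Or.inr (sep_symm h1)
  · rcases h3 with ⟨i, h3⟩ | h3
    · exact Or.inl ⟨i, anti_symm h2 h3⟩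
    · exact Or.inr (sep_symm h3)

lemma find_clique {β : ℝ} (hβ : 0 < β) {ℓ d M r Q : ℕ} [NeZero M] (hℓ : 0 < ℓ)
    (hr : 0 < r) (hβr : β * (r + 1) ≤ 1)
    (hDM : (ℓ + 3) * d ≤ M ^ 2) (h2 : 2 ∣ M) (hfM : ∀ a, fs r ℓ a ∣ M)
    (hQ : 4 * (1 + 10 / β) ^ 2 * r ^ 2 * (r + 1) ^ 2 ≤ Q)
    (S : Finset (Om ℓ d M)) (hS : β * Fintype.card (Om ℓ d M) ≤ S.card) :
    ∃ s : Fin r → Om ℓ d M, (∀ j, s j ∈ S) ∧ ∀ j k, j ≠ k →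
      innr r Q (4 * ((1 + 10 / β) ^ 2 * (M : ℝ) ^ 2)) (s j) (s k) := by
  classical
  set L := (1 + 10 / β) ^ 2 * (M : ℝ) ^ 2 with hL
  set bad : Finset (Om ℓ d M) := univ.filter fun ω => ∀ s ∈ S, ¬ near L s ω with hbad
  have hcard : (0 : ℝ) < Fintype.card (Om ℓ d M) := by
    rw [card_Om]; exact_mod_cast Nat.pos_of_ne_zero (pow_ne_zero _ (NeZero.ne M))
  have hbadc : (bad.card : ℝ) < β * Fintype.card (Om ℓ d M) := by
    by_contra! hcon
    obtain ⟨a, ha, b, hb, h⟩ := conc_Om hβ hDM S bad hS hcon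
    exact (Finset.mem_filter.1 hb).2 a ha h
  let t : Fin r → Om ℓ d M := fun j =>
    (fun i _ => if sg i j then ((M / 2 : ℕ) : ZMod M) else 0,
     fun a _ => ((cl ℓ a j * (M / fs r ℓ a) : ℕ) : ZMod M))
  have hω : ∃ ω, ∀ j, ω + t j ∉ bad := by
    by_contra! hcon
    have hcov : (univ : Finset (Om ℓ d M)) ⊆ (univ : Finset (Fin r)).biUnion
        (fun j => bad.image (fun ω => ω - t j)) := by
      intro ω _
      obtain ⟨j, hj⟩ := hcon ω
      exact Finset.mem_biUnion.2 ⟨j, Finset.mem_univ _, Finset.mem_image.2 ⟨_, hj, by abel⟩⟩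
    have h1 := (Finset.card_le_card hcov).trans (Finset.card_biUnion_le_card_mul _ _ bad.card
      (fun j _ => Finset.card_image_le))
    rw [Finset.card_univ, Finset.card_univ, Fintype.card_fin] at h1
    have h1' : (Fintype.card (Om ℓ d M) : ℝ) ≤ r * bad.card := by exact_mod_cast h1
    have hr' : (0 : ℝ) < r := by exact_mod_cast hr
    have h3 : (r : ℝ) * bad.card < r * (β * Fintype.card (Om ℓ d M)) := by gcongr
    have h4 : (r : ℝ) * β ≤ 1 := by nlinarith
    nlinarith
  obtain ⟨ω, hω⟩ := hω
  have hex : ∀ j, ∃ s ∈ S, near L s (ω + t j) := by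
    intro j
    have := hω j
    simp only [hbad, Finset.mem_filter, Finset.mem_univ, true_and] at this
    push Not at this
    exact this
  choose s hsS hs using hex
  refine ⟨s, hsS, fun j k hjk => ?_⟩
  have hjk' : (j : ℕ) ≠ k := fun h => hjk (Fin.ext h)
  have hanti : ∀ i : Fin ℓ, sg i j ≠ sg i k → anti (4 * L) ((s j).1 i) ((s k).1 i) := by
    intro i hi
    refine anti_of L _ _ _ _ ((hs j).1 i) ((hs k).1 i) (fun q => ?_)
    simp only [t, Prod.fst_add, Pi.add_apply]
    have hh := half_add_half h2
    cases h1 : sg i j <;> cases h3 : sg i k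
    · rw [h1, h3] at hi; exact absurd rfl hi
    · simp only [Bool.false_eq_true, if_true, if_false]; linear_combination -hh
    · simp only [Bool.false_eq_true, if_true, if_false]; ring
    · rw [h1, h3] at hi; exact absurd rfl hi
  have hsep : ∀ a : Fin 3, cl ℓ a j ≠ cl ℓ a k → sep (fs r ℓ a) Q ((s j).2 a) ((s k).2 a) := by
    intro a ha
    refine sep_of ((1 + 10 / β) ^ 2) (fs r ℓ a) r Q (fs_pos r ℓ hr a) (fs_le r ℓ hr a) (hfM a) hQ
      _ _ _ _ ((hs j).2 a) ((hs k).2 a) (fun q => ?_)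
    have := shift_sep (fs r ℓ a) (hfM a) (fs_pos r ℓ hr a) _ _ (cl_lt r ℓ a j j.2)
      (cl_lt r ℓ a k k.2) ha
    simp only [t, Prod.snd_add, Pi.add_apply]
    rwa [add_sub_add_left_eq_sub]
  refine ⟨hsep 0 (by simpa [cl] using hjk'), ?_, ?_⟩
  · by_cases h : (j : ℕ) / 2 = k / 2
    · exact Or.inl fun i => hanti i (sg_ne i j k h hjk')
    · exact Or.inr (hsep 1 (by simpa [cl] using h))
  · by_cases h : (j : ℕ) / 2 ^ ℓ = k / 2 ^ ℓ
    · left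
      by_contra! hno
      apply hjk'
      refine sg_eq ℓ j k hℓ (fun i hi => ?_) h
      by_contra hne
      exact hno ⟨i, hi⟩ (hanti ⟨i, hi⟩ hne)
    · exact Or.inr (hsep 2 (by simpa [cl] using h))

end RT

namespace RT
open Finset

/-- cross adjacency -/
def crs {ℓ d M : ℕ} [NeZero M] (τ : ℝ) (x y : Om ℓ d M) : Prop := ∀ i, τ < SS (x.1 i - y.1 i)

/-- adjacency of the construction -/
def adj {ℓ d M : ℕ} [NeZero M] (r Q : ℕ) (L τ : ℝ) : Om ℓ d M ⊕ Om ℓ d M → Om ℓ d M ⊕ Om ℓ d M → Prop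
  | Sum.inl x, Sum.inl y => x ≠ y ∧ innr r Q L x y
  | Sum.inr x, Sum.inr y => x ≠ y ∧ innr r Q L x y
  | Sum.inl x, Sum.inr y => crs τ x y
  | Sum.inr y, Sum.inl x => crs τ x y

/-- the construction -/
def BE {ℓ d M : ℕ} [NeZero M] (h2 : 2 ∣ M) (r Q : ℕ) (L τ : ℝ) : SimpleGraph (Om ℓ d M ⊕ Om ℓ d M) where
  Adj := adj r Q L τ
  symm := ⟨by
    rintro (x | x) (y | y) h
    · exact ⟨h.1.symm, innr_symm h2 h.2⟩
    · exact h
    · exact h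
    · exact ⟨h.1.symm, innr_symm h2 h.2⟩⟩
  loopless := ⟨by
    rintro (x | x) h
    · exact h.1 rfl
    · exact h.1 rfl⟩

lemma part_bounds {ℓ d M r Q : ℕ} [NeZero M] {L : ℝ} (hr : 0 < r) (hd : (r + 1) ^ 2 * Q < d)
    (A : Finset (Om ℓ d M)) (hA : ∀ x ∈ A, ∀ y ∈ A, x ≠ y → innr r Q L x y) :
    A.card ≤ r ∧
    ((∃ i, ∀ x ∈ A, ∀ y ∈ A, x ≠ y → ¬ anti L (x.1 i) (y.1 i)) → A.card ≤ (r + 1) / 2) ∧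
    ((∀ i, ∀ x ∈ A, ∀ y ∈ A, x ≠ y → ¬ anti L (x.1 i) (y.1 i)) →
      A.card ≤ (r + 2 ^ ℓ - 1) / 2 ^ ℓ) := by
  classical
  have hd' : ∀ a, (fs r ℓ a + 1) ^ 2 * Q < d := fun a => lt_of_le_of_lt
    (Nat.mul_le_mul_right _ (Nat.pow_le_pow_left (Nat.add_le_add_right (fs_le r ℓ hr a) 1) 2)) hd
  refine ⟨?_, ?_, ?_⟩
  · exact sep_card (fs_pos r ℓ hr 0) (hd' 0) (fun x => x.2 0) A (fun x hx y hy h => (hA x hx y hy h).1)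
  · rintro ⟨i, hi⟩
    refine sep_card (fs_pos r ℓ hr 1) (hd' 1) (fun x => x.2 1) A (fun x hx y hy h => ?_)
    rcases (hA x hx y hy h).2.1 with h1 | h1
    · exact absurd (h1 i) (hi x hx y hy h)
    · exact h1
  · intro hi
    refine sep_card (fs_pos r ℓ hr 2) (hd' 2) (fun x => x.2 2) A (fun x hx y hy h => ?_)
    rcases (hA x hx y hy h).2.2 with ⟨i, h1⟩ | h1
    · exact absurd h1 (hi i x hx y hy h)
    · exact h1

lemma BE_cliqueFree {ℓ d M r Q s : ℕ} [NeZero M] (h2 : 2 ∣ M) (hr : 0 < r) (hs : 2 ≤ s)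
    (hl : r ≤ 2 ^ ℓ * (s - 1))
    (hd : (r + 1) ^ 2 * Q < d) (Λ τ : ℝ) (hτ : 0 ≤ τ) (hΛτ : 4 * Real.pi ^ 2 * (4 * Λ) ≤ τ) :
    (BE (ℓ := ℓ) (d := d) h2 r Q (4 * (Λ * (M : ℝ) ^ 2)) τ).CliqueFree (r + s) := by
  classical
  intro T hT
  have hcl := hT.isClique
  set L := 4 * (Λ * (M : ℝ) ^ 2) with hL
  have hA : ∀ x ∈ T.toLeft, ∀ y ∈ T.toLeft, x ≠ y → innr r Q L x y := by
    intro x hx y hy hxy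
    have := hcl (Finset.mem_coe.2 (Finset.mem_toLeft.1 hx)) (Finset.mem_coe.2 (Finset.mem_toLeft.1 hy))
      (fun h => hxy (Sum.inl_injective h))
    exact this.2
  have hB : ∀ x ∈ T.toRight, ∀ y ∈ T.toRight, x ≠ y → innr r Q L x y := by
    intro x hx y hy hxy
    have := hcl (Finset.mem_coe.2 (Finset.mem_toRight.1 hx)) (Finset.mem_coe.2 (Finset.mem_toRight.1 hy))
      (fun h => hxy (Sum.inr_injective h))
    exact this.2
  have hAB : ∀ x ∈ T.toLeft, ∀ y ∈ T.toRight, crs τ x y := by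
    intro x hx y hy
    exact hcl (Finset.mem_coe.2 (Finset.mem_toLeft.1 hx)) (Finset.mem_coe.2 (Finset.mem_toRight.1 hy))
      (fun h => by cases h)
  have hcard : T.toLeft.card + T.toRight.card = r + s := by
    rw [Finset.card_toLeft_add_card_toRight, hT.card_eq]
  obtain ⟨a1, a2, a3⟩ := part_bounds hr hd _ hA
  obtain ⟨b1, b2, b3⟩ := part_bounds hr hd _ hB
  have hp : 0 < 2 ^ ℓ := by positivity
  have hs1 : (r + 2 ^ ℓ - 1) / 2 ^ ℓ ≤ s - 1 := by
    rw [← Nat.lt_add_one_iff, Nat.div_lt_iff_lt_mul hp, Nat.add_mul, Nat.mul_comm]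
    omega
  by_cases cA : ∀ i, ∀ x ∈ T.toLeft, ∀ y ∈ T.toLeft, x ≠ y → ¬ anti L (x.1 i) (y.1 i)
  · have := a3 cA; omega
  by_cases cB : ∀ i, ∀ x ∈ T.toRight, ∀ y ∈ T.toRight, x ≠ y → ¬ anti L (x.1 i) (y.1 i)
  · have := b3 cB; omega
  push Not at cA cB
  obtain ⟨i, x, hx, x', hx', -, hxx⟩ := cA
  obtain ⟨j, y, hy, y', hy', -, hyy⟩ := cB
  have hA2 := a2 ⟨j, fun u hu v hv _ h => anti_cross h2 Λ τ hτ hΛτ _ _ _ _ h hyy (hAB u hu y hy j)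
    (hAB u hu y' hy' j) (hAB v hv y hy j) (hAB v hv y' hy' j)⟩
  have hB2 := b2 ⟨i, fun u hu v hv _ h => anti_cross h2 Λ τ hτ hΛτ _ _ _ _ hxx h (hAB x hx u hu i)
    (hAB x hx v hv i) (hAB x' hx' u hu i) (hAB x' hx' v hv i)⟩
  omega

lemma innr_irrefl {ℓ d M r Q : ℕ} {L : ℝ} (hQ : Q < d) (x : Om ℓ d M) : ¬ innr r Q L x x := by
  intro h
  have := h.1
  unfold sep at this
  simp [cyc_zero] at this
  omega

lemma BE_big {β : ℝ} (hβ : 0 < β) {ℓ d M r Q : ℕ} [NeZero M] (hℓ : 0 < ℓ)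
    (hr : 0 < r) (hβr : β * (r + 1) ≤ 1)
    (hDM : (ℓ + 3) * d ≤ M ^ 2) (h2 : 2 ∣ M) (hfM : ∀ a, fs r ℓ a ∣ M)
    (hQ : 4 * (1 + 10 / β) ^ 2 * r ^ 2 * (r + 1) ^ 2 ≤ Q) (hQd : Q < d) (τ : ℝ)
    (S : Finset (Om ℓ d M ⊕ Om ℓ d M))
    (hS : β * Fintype.card (Om ℓ d M ⊕ Om ℓ d M) ≤ S.card) :
    ∃ T ⊆ S, (BE h2 r Q (4 * ((1 + 10 / β) ^ 2 * (M : ℝ) ^ 2)) τ).IsNClique r T := by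
  classical
  have hinj : ∀ s : Fin r → Om ℓ d M, (∀ j k, j ≠ k →
      innr r Q (4 * ((1 + 10 / β) ^ 2 * (M : ℝ) ^ 2)) (s j) (s k)) → Function.Injective s := by
    intro s h j k hjk
    by_contra hne
    have := h j k hne
    rw [hjk] at this
    exact innr_irrefl hQd _ this
  have hc := Finset.card_toLeft_add_card_toRight (u := S)
  rw [Fintype.card_sum] at hS
  have hc' : (S.toLeft.card : ℝ) + S.toRight.card = S.card := by exact_mod_cast hc
  push_cast at hS
  by_cases hl : β * Fintype.card (Om ℓ d M) ≤ S.toLeft.card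
  · obtain ⟨s, hsS, h⟩ := find_clique hβ hℓ hr hβr hDM h2 hfM hQ _ hl
    have hi := hinj s h
    refine ⟨univ.image fun j => Sum.inl (s j), ?_, ?_, ?_⟩
    · intro x hx
      obtain ⟨j, -, rfl⟩ := Finset.mem_image.1 hx
      exact Finset.mem_toLeft.1 (hsS j)
    · intro x hx y hy hxy
      obtain ⟨j, -, rfl⟩ := Finset.mem_image.1 (Finset.mem_coe.1 hx)
      obtain ⟨k, -, rfl⟩ := Finset.mem_image.1 (Finset.mem_coe.1 hy)
      have hjk : j ≠ k := fun e => hxy (by rw [e])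
      exact ⟨fun e => hjk (hi e), h j k hjk⟩
    · rw [Finset.card_image_of_injective _ (fun a b e => hi (Sum.inl_injective e)), Finset.card_univ,
        Fintype.card_fin]
  · have hrr : β * Fintype.card (Om ℓ d M) ≤ S.toRight.card := by
      push Not at hl; linarith
    obtain ⟨s, hsS, h⟩ := find_clique hβ hℓ hr hβr hDM h2 hfM hQ _ hrr
    have hi := hinj s h
    refine ⟨univ.image fun j => Sum.inr (s j), ?_, ?_, ?_⟩
    · intro x hx
      obtain ⟨j, -, rfl⟩ := Finset.mem_image.1 hx
      exact Finset.mem_toRight.1 (hsS j)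
    · intro x hx y hy hxy
      obtain ⟨j, -, rfl⟩ := Finset.mem_image.1 (Finset.mem_coe.1 hx)
      obtain ⟨k, -, rfl⟩ := Finset.mem_image.1 (Finset.mem_coe.1 hy)
      have hjk : j ≠ k := fun e => hxy (by rw [e])
      exact ⟨fun e => hjk (hi e), h j k hjk⟩
    · rw [Finset.card_image_of_injective _ (fun a b e => hi (Sum.inr_injective e)), Finset.card_univ,
        Fintype.card_fin]

lemma BE_edges {ℓ d M r Q : ℕ} [NeZero M] (h2 : 2 ∣ M) (L τ c : ℝ) (hc : 0 ≤ c)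
    (h : c * (M : ℝ) ^ d ≤ ((univ.filter fun θ : Fin d → ZMod M => τ < SS θ).card : ℝ)) :
    c ^ ℓ * (Fintype.card (Om ℓ d M) : ℝ) ^ 2 ≤
      ((BE (ℓ := ℓ) (d := d) h2 r Q L τ).edgeSet.ncard : ℝ) := by
  classical
  set P := univ.filter fun θ : Fin d → ZMod M => τ < SS θ with hP
  let F : Finset (Om ℓ d M) := (Fintype.piFinset fun _ : Fin ℓ => P) ×ˢ univ
  have hF : (F.card : ℝ) = (P.card : ℝ) ^ ℓ * (M : ℝ) ^ (3 * d) := by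
    simp only [F, Finset.card_product, Fintype.card_piFinset_const, Finset.card_univ]
    simp [ZMod.card]
    left
    rw [← pow_mul, mul_comm]
  let g : Om ℓ d M × Om ℓ d M → Sym2 (Om ℓ d M ⊕ Om ℓ d M) := fun p =>
    s(Sum.inl p.1, Sum.inr (p.1 - p.2))
  have hg : Function.Injective g := by
    rintro ⟨x, θ⟩ ⟨x', θ'⟩ h
    simp only [g, Sym2.eq_iff] at h
    rcases h with ⟨h1, h3⟩ | ⟨h1, h3⟩
    · have h1 := Sum.inl_injective h1
      have h3 := Sum.inr_injective h3
      subst h1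
      rw [sub_right_inj] at h3
      rw [h3]
    · cases h1
  have hsub : (((univ ×ˢ F).image g : Finset _) : Set (Sym2 (Om ℓ d M ⊕ Om ℓ d M))) ⊆
      (BE (ℓ := ℓ) (d := d) h2 r Q L τ).edgeSet := by
    intro e he
    obtain ⟨⟨x, θ⟩, hp, rfl⟩ := Finset.mem_image.1 (Finset.mem_coe.1 he)
    have hθ : θ ∈ F := (Finset.mem_product.1 hp).2
    have hθ' := Fintype.mem_piFinset.1 (Finset.mem_product.1 hθ).1
    rw [SimpleGraph.mem_edgeSet]
    change crs τ x (x - θ)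
    intro i
    have := (Finset.mem_filter.1 (hθ' i)).2
    simpa using this
  have hle := Set.ncard_le_ncard hsub (Set.toFinite _)
  rw [Set.ncard_coe_finset, Finset.card_image_of_injective _ hg, Finset.card_product,
    Finset.card_univ] at hle
  have hle' : (Fintype.card (Om ℓ d M) : ℝ) * F.card ≤
      ((BE (ℓ := ℓ) (d := d) h2 r Q L τ).edgeSet.ncard : ℝ) := by exact_mod_cast hle
  refine le_trans ?_ hle'
  have hk : c ^ ℓ * (Fintype.card (Om ℓ d M) : ℝ) ≤ F.card := by
    rw [hF, card_Om]
    push_cast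
    have e : (M : ℝ) ^ ((ℓ + 3) * d) = ((M : ℝ) ^ d) ^ ℓ * (M : ℝ) ^ (3 * d) := by
      rw [← pow_mul, ← pow_add]; congr 1; ring
    rw [e, ← mul_assoc, ← mul_pow]
    gcongr
  rw [pow_two]
  calc _ = (Fintype.card (Om ℓ d M) : ℝ) * (c ^ ℓ * (Fintype.card (Om ℓ d M) : ℝ)) := by ring
    _ ≤ _ := by gcongr

lemma choose_eta (ℓ : ℕ) (α : ℝ) (hα : 0 < α) :
    ∃ η : ℝ, 0 < η ∧ η < 1 / 2 ∧ (1 / 2 : ℝ) ^ ℓ - 4 * α ≤ (1 / 2 - η) ^ ℓ := by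
  have hcont : Filter.Tendsto (fun η : ℝ => (1 / 2 - η) ^ ℓ) (nhdsWithin 0 (Set.Ioi 0))
      (nhds ((1 / 2 : ℝ) ^ ℓ)) := by
    have : Continuous (fun η : ℝ => (1 / 2 - η) ^ ℓ) := by fun_prop
    have h := this.tendsto 0
    simp only [sub_zero] at h
    exact h.mono_left nhdsWithin_le_nhds
  have h1 := hcont.eventually (lt_mem_nhds (show (1 / 2 : ℝ) ^ ℓ - 4 * α < (1 / 2 : ℝ) ^ ℓ by linarith))
  have h2 : ∀ᶠ η : ℝ in nhdsWithin 0 (Set.Ioi 0), η ∈ Set.Ioo (0 : ℝ) (1 / 2) :=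
    Ioo_mem_nhdsGT (by norm_num)
  obtain ⟨η, h3, h4⟩ := (h1.and h2).exists
  exact ⟨η, h4.1, h4.2, h3.le⟩

lemma exists_fin {W : Type} [Fintype W] (H : SimpleGraph W) (k r : ℕ) (β E : ℝ)
    (h1 : H.CliqueFree k) (hE : E ≤ (H.edgeSet.ncard : ℝ))
    (h3 : ∀ S : Finset W, β * Fintype.card W ≤ S.card → ∃ T ⊆ S, H.IsNClique r T) :
    ∃ G : SimpleGraph (Fin (Fintype.card W)), G.CliqueFree k ∧ E ≤ (G.edgeSet.ncard : ℝ) ∧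
      ∀ S : Finset (Fin (Fintype.card W)), β * Fintype.card W ≤ (S.card : ℝ) →
        ¬ (G.induce (S : Set (Fin (Fintype.card W)))).CliqueFree r := by
  classical
  let e := Fintype.equivFin W
  let G : SimpleGraph (Fin (Fintype.card W)) := H.comap e.symm
  let φ : G ≃g H := SimpleGraph.Iso.comap e.symm H
  refine ⟨G, ?_, ?_, ?_⟩
  · exact SimpleGraph.CliqueFree.comap ⟨φ.toCopy⟩ h1
  · have : G.edgeSet.ncard = H.edgeSet.ncard := Nat.card_congr φ.mapEdgeSet
    rw [this]; exact hE
  · intro S hS hfree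
    obtain ⟨T, hTS, hT⟩ := h3 (S.map e.symm.toEmbedding) (by rwa [Finset.card_map])
    have hmem : ∀ w ∈ T, e w ∈ (S : Set (Fin (Fintype.card W))) := by
      intro w hw
      obtain ⟨v, hv, hvw⟩ := Finset.mem_map.1 (hTS hw)
      have : e w = v := by rw [← hvw]; simp
      rw [this]; exact hv
    let f : {w // w ∈ T} → (S : Set (Fin (Fintype.card W))) := fun w => ⟨e w, hmem w w.2⟩
    have hf : Function.Injective f := by
      intro a b hab
      have : e a = e b := congrArg Subtype.val hab
      exact Subtype.ext (e.injective this)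
    apply hfree (T.attach.map ⟨f, hf⟩)
    constructor
    · intro x hx y hy hxy
      obtain ⟨a, -, rfl⟩ := Finset.mem_map.1 (Finset.mem_coe.1 hx)
      obtain ⟨b, -, rfl⟩ := Finset.mem_map.1 (Finset.mem_coe.1 hy)
      have hab : (a : W) ≠ b := fun h => hxy (by rw [Subtype.ext h])
      have := hT.isClique a.2 b.2 hab
      simpa [f, G] using this
    · rw [Finset.card_map, Finset.card_attach, hT.card_eq]

end RT

theorem ramsey_turan_lower_bound
    (r s ℓ : ℕ) (hs : 2 ≤ s) (hsr : s ≤ r)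
    (hℓ : IsLeast {m : ℕ | 0 < m ∧ r ≤ 2 ^ m * (s - 1)} ℓ)
    (α β : ℝ) (hα : 0 < α) (hβ : 0 < β) (n : ℕ) (hn : 1 ≤ n) :
    ∃ (N : ℕ) (G : SimpleGraph (Fin N)),
      n ≤ N ∧
      G.CliqueFree (r + s) ∧
      ((2 : ℝ) ^ (-(ℓ : ℤ) - 2) - α) * N ^ 2 ≤ (G.edgeSet.ncard : ℝ) ∧
      (∀ S : Finset (Fin N), β * N ≤ (S.card : ℝ) →
        ¬ (G.induce (S : Set (Fin N))).CliqueFree r) := by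
  obtain ⟨hℓ0, hl⟩ := hℓ.1
  have hr : 0 < r := by omega
  obtain ⟨β', hβ', hββ, hβr⟩ : ∃ β' : ℝ, 0 < β' ∧ β' ≤ β ∧ β' * (r + 1) ≤ 1 := by
    refine ⟨min β (1 / (r + 1)), lt_min hβ (by positivity), min_le_left _ _, ?_⟩
    calc min β (1 / ((r : ℝ) + 1)) * (r + 1) ≤ 1 / ((r : ℝ) + 1) * (r + 1) := by
          gcongr; exact min_le_right _ _
      _ = 1 := by field_simp
  obtain ⟨η, hη0, hη2, hη⟩ := RT.choose_eta ℓ α hα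
  set Λ : ℝ := (1 + 10 / β') ^ 2 with hΛ
  have hΛ0 : 0 ≤ Λ := sq_nonneg _
  set τ : ℝ := 4 * Real.pi ^ 2 * (4 * Λ) with hτ
  have hτ0 : 0 ≤ τ := by positivity
  obtain ⟨Q, hQ⟩ := exists_nat_ge (4 * Λ * (r : ℝ) ^ 2 * ((r : ℝ) + 1) ^ 2)
  obtain ⟨d0, hd0⟩ := RT.half_space τ η hτ0 hη0
  obtain ⟨d, hdd0, hd⟩ : ∃ d, d0 ≤ d ∧ (r + 1) ^ 2 * Q < d :=
    ⟨max d0 ((r + 1) ^ 2 * Q + 1), le_max_left _ _, lt_of_lt_of_le (Nat.lt_succ_self _)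
      (le_max_right _ _)⟩
  have hQd : Q < d := lt_of_le_of_lt (Nat.le_mul_of_pos_left _ (by positivity)) hd
  have hd1 : 0 < d := by omega
  let p := RT.fs r ℓ 0 * RT.fs r ℓ 1 * RT.fs r ℓ 2
  have hp : 0 < p := Nat.mul_pos (Nat.mul_pos (RT.fs_pos r ℓ hr 0) (RT.fs_pos r ℓ hr 1))
    (RT.fs_pos r ℓ hr 2)
  let q := (ℓ + 3) * d + n
  obtain ⟨M, hM⟩ : ∃ M, M = 4 * (p * q) := ⟨_, rfl⟩
  have hqM : q ≤ M := by
    rw [hM]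
    calc q ≤ p * q := Nat.le_mul_of_pos_left _ hp
      _ ≤ _ := Nat.le_mul_of_pos_left _ (by norm_num)
  have hnM : n ≤ M := le_trans (Nat.le_add_left _ _) hqM
  have hM0 : 0 < M := by omega
  have : NeZero M := ⟨by omega⟩
  have h4 : 4 ∣ M := ⟨_, hM⟩
  have h2 : 2 ∣ M := Dvd.dvd.trans (by norm_num) h4
  have hDM : (ℓ + 3) * d ≤ M ^ 2 := by
    calc (ℓ + 3) * d ≤ q := Nat.le_add_right _ _
      _ ≤ M := hqM
      _ ≤ M ^ 2 := Nat.le_self_pow (by norm_num) M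
  have hfM : ∀ a, RT.fs r ℓ a ∣ M := by
    have hpM : p ∣ M := ⟨4 * q, by rw [hM]; ring⟩
    intro a
    refine Dvd.dvd.trans ?_ hpM
    fin_cases a
    · exact ⟨RT.fs r ℓ 1 * RT.fs r ℓ 2, by simp only [p]; simp; ring⟩
    · exact ⟨RT.fs r ℓ 0 * RT.fs r ℓ 2, by simp only [p]; simp; ring⟩
    · exact ⟨RT.fs r ℓ 0 * RT.fs r ℓ 1, by simp only [p]; simp; ring⟩
  let H := RT.BE (ℓ := ℓ) (d := d) h2 r Q (4 * (Λ * (M : ℝ) ^ 2)) τ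
  have hcf : H.CliqueFree (r + s) := RT.BE_cliqueFree h2 hr hs hl hd Λ τ hτ0 le_rfl
  have hed := RT.BE_edges (ℓ := ℓ) (r := r) (Q := Q) h2 (4 * (Λ * (M : ℝ) ^ 2)) τ (1 / 2 - η)
    (by linarith) (hd0 d hdd0 M h4)
  have hN : Fintype.card (RT.Om ℓ d M ⊕ RT.Om ℓ d M) = 2 * Fintype.card (RT.Om ℓ d M) := by
    rw [Fintype.card_sum]; ring
  obtain ⟨G, g1, g2, g3⟩ := RT.exists_fin H (r + s) r β _ hcf hed (by
    intro S hS
    refine RT.BE_big hβ' hℓ0 hr hβr hDM h2 hfM hQ hQd τ S (le_trans ?_ hS)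
    gcongr)
  refine ⟨_, G, ?_, g1, ?_, g3⟩
  · rw [hN, RT.card_Om]
    calc n ≤ M := hnM
      _ ≤ M ^ ((ℓ + 3) * d) := Nat.le_self_pow (by positivity) M
      _ ≤ _ := Nat.le_mul_of_pos_left _ (by norm_num)
  · refine le_trans ?_ g2
    rw [hN]
    push_cast
    have e : (2 : ℝ) ^ (-(ℓ : ℤ) - 2) = (1 / 2) ^ ℓ / 4 := by
      rw [zpow_sub₀ (by norm_num), zpow_neg, zpow_natCast, one_div, inv_pow]
      norm_num
    rw [e]
    calc ((1 / 2 : ℝ) ^ ℓ / 4 - α) * (2 * (Fintype.card (RT.Om ℓ d M) : ℝ)) ^ 2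
        = ((1 / 2 : ℝ) ^ ℓ - 4 * α) * (Fintype.card (RT.Om ℓ d M) : ℝ) ^ 2 := by ring
      _ ≤ _ := by gcongr
end

section
/- Let r and s be integers with 2 ≤ s ≤ min{5, r}. For every δ > 0 there exist ε > 0 and n₀ such that for every integer n ≥ n₀, every simple graph G on n vertices that contains no clique K_{r+s} and satisfies α_r(G) ≤ εn has at most ((s−1)/(4r) + δ)·n² edges. In other words, RT_r(n, K_{r+s}, o(n)) ≤ ((s−1)/(4r))·n² + o(n²). -/
open Finset

/-- Expansion of a weighted quadratic form when one index is added. -/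
lemma rt_quad_insert {ι : Type*} [DecidableEq ι] (w : ι → ι → ℕ) (hsymm : ∀ i j, w i j = w j i)
    (hdiag : ∀ i, w i i = 0) (x : ι → ℝ) (S : Finset ι) (i : ι) (hi : i ∉ S) :
    ∑ a ∈ insert i S, ∑ b ∈ insert i S, (w a b : ℝ) * x a * x b =
      ∑ a ∈ S, ∑ b ∈ S, (w a b : ℝ) * x a * x b + 2 * x i * ∑ k ∈ S, (w i k : ℝ) * x k := by
  rw [sum_insert hi]
  simp_rw [sum_insert hi, sum_add_distrib, hdiag]
  have h1 : ∑ b ∈ S, (w i b : ℝ) * x i * x b = x i * ∑ k ∈ S, (w i k : ℝ) * x k := by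
    rw [mul_sum]; exact sum_congr rfl fun _ _ => by ring
  have h2 : ∑ b ∈ S, (w b i : ℝ) * x b * x i = x i * ∑ k ∈ S, (w i k : ℝ) * x k := by
    rw [mul_sum]; exact sum_congr rfl fun b _ => by rw [hsymm b i]; ring
  rw [h1, h2]; push_cast; ring

/-- One symmetrization step. -/
lemma rt_quad_step {ι : Type*} [DecidableEq ι] (w : ι → ι → ℕ) (hsymm : ∀ i j, w i j = w j i)
    (hdiag : ∀ i, w i i = 0) (x : ι → ℝ) (S : Finset ι) (i j : ι) (hi : i ∉ S) (hj : j ∉ S)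
    (hij : i ≠ j) (hw : w i j = 0) (hxj : 0 ≤ x j)
    (hL : ∑ k ∈ S, (w j k : ℝ) * x k ≤ ∑ k ∈ S, (w i k : ℝ) * x k) (c : ℝ)
    (ih : ∑ a ∈ insert i S, ∑ b ∈ insert i S, (w a b : ℝ) *
        (Function.update x i (x i + x j)) a * (Function.update x i (x i + x j)) b ≤
      c * (∑ a ∈ insert i S, (Function.update x i (x i + x j)) a) ^ 2) :
    ∑ a ∈ insert i (insert j S), ∑ b ∈ insert i (insert j S), (w a b : ℝ) * x a * x b ≤
      c * (∑ a ∈ insert i (insert j S), x a) ^ 2 := by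
  have hup : ∀ a ∈ S, (Function.update x i (x i + x j)) a = x a := by
    intro a ha
    rw [Function.update_of_ne]
    rintro rfl; exact hi ha
  have hQ : ∑ a ∈ S, ∑ b ∈ S, (w a b : ℝ) *
        (Function.update x i (x i + x j)) a * (Function.update x i (x i + x j)) b =
      ∑ a ∈ S, ∑ b ∈ S, (w a b : ℝ) * x a * x b :=
    sum_congr rfl (fun a ha => sum_congr rfl (fun b hb => by rw [hup a ha, hup b hb]))
  have hLi : ∑ k ∈ S, (w i k : ℝ) * (Function.update x i (x i + x j)) k =
      ∑ k ∈ S, (w i k : ℝ) * x k := sum_congr rfl (fun a ha => by rw [hup a ha])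
  rw [rt_quad_insert w hsymm hdiag _ S i hi, sum_insert hi, sum_congr rfl hup,
    hQ, hLi] at ih
  simp only [Function.update_self] at ih
  have hi' : i ∉ insert j S := by simp [hij, hi]
  rw [rt_quad_insert w hsymm hdiag _ _ i hi', rt_quad_insert w hsymm hdiag _ _ j hj,
    sum_insert hi', sum_insert hj, sum_insert hj, hw]
  have := mul_le_mul_of_nonneg_left hL hxj
  push_cast
  have e : x i + (x j + ∑ a ∈ S, x a) = x i + x j + ∑ a ∈ S, x a := by ring
  rw [e]
  linarith

lemma rt_num (s l : ℕ) (h2 : 2 ≤ l) (hle : l ≤ s) (hs5 : s ≤ 5) (T R : ℝ) (hT : 0 ≤ T)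
    (h : T ≤ l * R) : ((s : ℝ) + 1 - l) * (T - R) ≤ (((s : ℝ) - 1) / 2) * T := by
  have hl5 : l ≤ 5 := hle.trans hs5
  interval_cases l <;> interval_cases s <;> norm_num at * <;> linarith

/-- Weighted Turán type bound (Motzkin–Straus argument). -/
lemma rt_weighted_turan {ι : Type*} [DecidableEq ι] (s : ℕ) (hs : 2 ≤ s) (hs5 : s ≤ 5)
    (w : ι → ι → ℕ) (hsymm : ∀ i j, w i j = w j i) (hdiag : ∀ i, w i i = 0) :
    ∀ (k : ℕ) (P : Finset ι), #P = k →
      (∀ C ⊆ P, (∀ i ∈ C, ∀ j ∈ C, i ≠ j → w i j ≠ 0) →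
        ∀ i ∈ C, ∀ j ∈ C, i ≠ j → w i j + #C ≤ s + 1) →
      ∀ x : ι → ℝ, (∀ i ∈ P, 0 ≤ x i) →
      ∑ a ∈ P, ∑ b ∈ P, (w a b : ℝ) * x a * x b ≤ (((s : ℝ) - 1) / 2) * (∑ a ∈ P, x a) ^ 2 := by
  intro k
  induction k with
  | zero => intro P hP _ x _; rw [card_eq_zero] at hP; subst hP; simp
  | succ k ih =>
    intro P hP hC x hx
    by_cases hcl : ∀ i ∈ P, ∀ j ∈ P, i ≠ j → w i j ≠ 0
    · have hb := hC P Subset.rfl hcl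
      have hs1 : (2 : ℝ) ≤ s := by exact_mod_cast hs
      obtain h1 | h2 : #P ≤ 1 ∨ 2 ≤ #P := by omega
      · have : ∑ a ∈ P, ∑ b ∈ P, (w a b : ℝ) * x a * x b = 0 := by
          refine sum_eq_zero fun a ha => sum_eq_zero fun b hb => ?_
          rw [card_le_one.1 h1 a ha b hb, hdiag]; simp
        rw [this]
        have : 0 ≤ ((s : ℝ) - 1) / 2 := by linarith
        positivity
      · obtain ⟨i, hi, j, hj, hij⟩ := one_lt_card.1 h2
        have h3 := hb i hi j hj hij
        have h4 := hcl i hi j hj hij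
        have hle : #P ≤ s := by omega
        set l := #P with hl
        have hcs : (∑ a ∈ P, x a) ^ 2 ≤ l * ∑ a ∈ P, x a ^ 2 := sq_sum_le_card_mul_sum_sq
        have hQ : ∑ a ∈ P, ∑ b ∈ P, (w a b : ℝ) * x a * x b ≤
            ((s : ℝ) + 1 - l) * ((∑ a ∈ P, x a) ^ 2 - ∑ a ∈ P, x a ^ 2) := by
          have : (∑ a ∈ P, x a) ^ 2 - ∑ a ∈ P, x a ^ 2 =
              ∑ a ∈ P, ∑ b ∈ P, (if a = b then 0 else x a * x b) := by
            rw [sq, sum_mul_sum, ← sum_sub_distrib]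
            refine sum_congr rfl fun a ha => ?_
            have : x a ^ 2 = ∑ b ∈ P, if a = b then x a * x b else 0 := by
              rw [sum_ite_eq]; simp [ha, sq]
            rw [this, ← sum_sub_distrib]
            refine sum_congr rfl fun b _ => ?_
            split_ifs <;> simp
          rw [this, mul_sum]
          refine sum_le_sum fun a ha => ?_
          rw [mul_sum]
          refine sum_le_sum fun b hb' => ?_
          split_ifs with hab
          · subst hab; simp [hdiag]
          · have h5 := hb a ha b hb' hab
            have h6 : (w a b : ℝ) ≤ s + 1 - l := by
              have : ((w a b + l : ℕ) : ℝ) ≤ ((s + 1 : ℕ) : ℝ) := by exact_mod_cast h5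
              push_cast at this; linarith
            have := mul_le_mul_of_nonneg_right h6 (mul_nonneg (hx a ha) (hx b hb'))
            linarith
        refine hQ.trans ?_
        have hT : 0 ≤ (∑ a ∈ P, x a) ^ 2 := sq_nonneg _
        exact rt_num s l h2 hle hs5 _ _ hT hcs
    · push Not at hcl
      obtain ⟨i, hi, j, hj, hij, hw⟩ := hcl
      set S := (P.erase i).erase j with hS
      have hiS : i ∉ S := by simp [hS]
      have hjS : j ∉ S := by simp [hS]
      have hP1 : P = insert i (insert j S) := by
        rw [hS, insert_erase (by simp [hj, hij.symm]), insert_erase hi]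
      have hP2 : P = insert j (insert i S) := by rw [hP1, insert_comm]
      have key : ∀ i j : ι, i ∉ S → j ∉ S → i ≠ j → P = insert i (insert j S) →
          ∑ a ∈ insert i S, ∑ b ∈ insert i S, (w a b : ℝ) *
            (Function.update x i (x i + x j)) a * (Function.update x i (x i + x j)) b ≤
          (((s : ℝ) - 1) / 2) * (∑ a ∈ insert i S, (Function.update x i (x i + x j)) a) ^ 2 := by
        intro i j hi hj hij hPe
        have hsub : insert i S ⊆ P := by
          rw [hPe]; exact insert_subset_insert _ (subset_insert _ _)
        have hxi : 0 ≤ x i := hx i (by rw [hPe]; simp)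
        have hxj : 0 ≤ x j := hx j (by rw [hPe]; simp)
        refine ih _ ?_ (fun C hCs => hC C (hCs.trans hsub)) _ ?_
        · rw [hPe, card_insert_of_notMem (by simp [hij, hi]), card_insert_of_notMem hj] at hP
          rw [card_insert_of_notMem hi]; omega
        · intro a ha
          by_cases hai : a = i
          · subst hai; simp; linarith
          · rw [Function.update_of_ne hai]; exact hx a (hsub ha)
      rcases le_total (∑ k ∈ S, (w j k : ℝ) * x k) (∑ k ∈ S, (w i k : ℝ) * x k) with hL | hL
      · have := rt_quad_step w hsymm hdiag x S i j hiS hjS hij hw (hx j hj) hL _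
          (key i j hiS hjS hij hP1)
        rw [← hP1] at this; exact this
      · have := rt_quad_step w hsymm hdiag x S j i hjS hiS hij.symm (by rw [hsymm]; exact hw)
          (hx i hi) hL _ (key j i hjS hiS hij.symm hP2)
        rw [← hP2] at this; exact this
/-- Lower regularity: large subsets span at least density `d`. -/
def RTLower {V : Type*} (G : SimpleGraph V) [DecidableRel G.Adj] (m d : ℝ) (A B : Finset V) :
    Prop :=
  ∀ X ⊆ A, ∀ Y ⊆ B, m ≤ #X → m ≤ #Y → d * #X * #Y ≤ #(G.interedges X Y)

lemma RTLower.mono {V : Type*} {G : SimpleGraph V} [DecidableRel G.Adj] {m d : ℝ}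
    {A B A' B' : Finset V} (h : RTLower G m d A B) (hA : A' ⊆ A) (hB : B' ⊆ B) :
    RTLower G m d A' B' :=
  fun X hX Y hY => h X (hX.trans hA) Y (hY.trans hB)

lemma rt_card_interedges {V : Type*} (G : SimpleGraph V) [DecidableRel G.Adj] (X Y : Finset V) :
    #(G.interedges X Y) = ∑ v ∈ X, #{u ∈ Y | G.Adj v u} := by
  simp only [SimpleGraph.interedges_def, card_filter, sum_product]

lemma rt_bad {V : Type*} {G : SimpleGraph V} [DecidableRel G.Adj] {m d : ℝ} (hm : 0 < m)
    {A B : Finset V} (h : RTLower G m d A B) (hB : m ≤ #B) :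
    (#{v ∈ A | (#{u ∈ B | G.Adj v u} : ℝ) < d * #B} : ℝ) < m := by
  by_contra hc
  push Not at hc
  set X := {v ∈ A | (#{u ∈ B | G.Adj v u} : ℝ) < d * #B} with hX
  have h1 := h X (filter_subset _ _) B Subset.rfl hc hB
  rw [rt_card_interedges] at h1
  push_cast at h1
  have hne : X.Nonempty := by
    rw [← card_pos]
    have : (0 : ℝ) < #X := lt_of_lt_of_le hm hc
    exact_mod_cast this
  have h2 : ∑ v ∈ X, (#{u ∈ B | G.Adj v u} : ℝ) < ∑ v ∈ X, d * #B :=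
    sum_lt_sum_of_nonempty hne fun v hv => (mem_filter.1 hv).2
  rw [sum_const, nsmul_eq_mul] at h2
  linarith

lemma rt_pair {V : Type*} [DecidableEq V] {G : SimpleGraph V} [DecidableRel G.Adj]
    {r t : ℕ} (ht : 1 ≤ t) (hr : 1 ≤ r) {m d a M : ℝ} (hm : 0 < m) (hd : 0 < d)
    (ha : ∀ S : Finset V, a < #S → ∃ K ⊆ S, G.IsNClique r K)
    {A B : Finset V} (h : RTLower G m (((t : ℝ) - 1) / r + d) A B)
    (hA : M ≤ #A) (hB : M ≤ #B) (hM1 : m ≤ M) (hM2 : a + m ≤ M) (hM3 : a * 2 ^ r < d * M) :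
    ∃ K ⊆ A ∪ B, G.IsNClique (r + t) K := by
  have hbad := rt_bad hm h (hM1.trans hB)
  set X := {v ∈ A | (#{u ∈ B | G.Adj v u} : ℝ) < (((t : ℝ) - 1) / r + d) * #B} with hX
  have hcard : a < #(A \ X) := by
    have : #(A \ X) = #A - #X := card_sdiff_of_subset (filter_subset _ _)
    have h2 : #X ≤ #A := card_le_card (filter_subset _ _)
    rw [this, Nat.cast_sub h2]; linarith
  obtain ⟨K, hKs, hK⟩ := ha _ hcard
  have hKA : K ⊆ A := hKs.trans sdiff_subset
  have hr' : (0 : ℝ) < r := by exact_mod_cast hr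
  have hdeg : ∀ v ∈ K, (((t : ℝ) - 1) / r + d) * #B ≤ #{u ∈ B | G.Adj v u} := by
    intro v hv
    have := hKs hv
    rw [mem_sdiff, hX, mem_filter] at this
    by_contra hc
    exact this.2 ⟨this.1, not_le.1 hc⟩
  have hsum : (t - 1 + r * d) * #B ≤ ∑ u ∈ B, (#{v ∈ K | G.Adj v u} : ℝ) := by
    have e1 : ∑ v ∈ K, #{u ∈ B | G.Adj v u} = ∑ u ∈ B, #{v ∈ K | G.Adj v u} := by
      simp only [card_filter]; rw [sum_comm]
    have e2 : ∑ v ∈ K, (((t : ℝ) - 1) / r + d) * #B ≤ ∑ v ∈ K, (#{u ∈ B | G.Adj v u} : ℝ) :=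
      sum_le_sum hdeg
    rw [sum_const, nsmul_eq_mul, hK.card_eq] at e2
    have e3 : (∑ v ∈ K, (#{u ∈ B | G.Adj v u} : ℝ)) = ∑ u ∈ B, (#{v ∈ K | G.Adj v u} : ℝ) := by
      exact_mod_cast e1
    rw [e3] at e2
    refine le_trans (le_of_eq ?_) e2
    field_simp
  set Y := {u ∈ B | t ≤ #{v ∈ K | G.Adj v u}} with hY
  have hsum2 : ∑ u ∈ B, (#{v ∈ K | G.Adj v u} : ℝ) ≤ ((t : ℝ) - 1) * #B + r * #Y := by
    have : ∀ u ∈ B, (#{v ∈ K | G.Adj v u} : ℝ) ≤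
        ((t : ℝ) - 1) + if t ≤ #{v ∈ K | G.Adj v u} then (r : ℝ) else 0 := by
      intro u _
      have h1 : (1 : ℝ) ≤ t := by exact_mod_cast ht
      split_ifs with hc
      · have : #{v ∈ K | G.Adj v u} ≤ r := hK.card_eq ▸ card_filter_le _ _
        have : (#{v ∈ K | G.Adj v u} : ℝ) ≤ r := by exact_mod_cast this
        linarith
      · have : #{v ∈ K | G.Adj v u} + 1 ≤ t := by omega
        have : (#{v ∈ K | G.Adj v u} : ℝ) + 1 ≤ t := by exact_mod_cast this
        linarith
    refine (sum_le_sum this).trans (le_of_eq ?_)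
    rw [sum_add_distrib, sum_const, nsmul_eq_mul, ← sum_filter, sum_const, nsmul_eq_mul]
    ring
  have hYc : d * M ≤ #Y := by
    have h1 : r * (d * #B) ≤ r * (#Y : ℝ) := by linarith
    have h2 := le_of_mul_le_mul_left h1 hr'
    have := mul_le_mul_of_nonneg_left hB hd.le
    linarith
  -- pigeonhole over subsets of `K`
  have hpig : ∃ Z ∈ K.powerset, a < #{u ∈ Y | {v ∈ K | G.Adj v u} = Z} := by
    by_contra hc
    push Not at hc
    have e : #Y = ∑ Z ∈ K.powerset, #{u ∈ Y | {v ∈ K | G.Adj v u} = Z} :=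
      card_eq_sum_card_fiberwise (fun u _ => mem_coe.2 (mem_powerset.2 (filter_subset _ _)))
    have e2 : (#Y : ℝ) ≤ ∑ Z ∈ K.powerset, a := by
      rw [e]; push_cast; exact sum_le_sum hc
    rw [sum_const, nsmul_eq_mul, card_powerset, hK.card_eq] at e2
    push_cast at e2
    linarith
  obtain ⟨Z, hZ, hZc⟩ := hpig
  obtain ⟨L, hLs, hL⟩ := ha _ hZc
  obtain ⟨l, hl⟩ : L.Nonempty := by rw [← card_pos, hL.card_eq]; omega
  have hLp : ∀ u ∈ L, u ∈ B ∧ t ≤ #{v ∈ K | G.Adj v u} ∧ {v ∈ K | G.Adj v u} = Z := by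
    intro u hu
    have := hLs hu
    simp only [hY, mem_filter] at this
    exact ⟨this.1.1, this.1.2, this.2⟩
  have htZ : t ≤ #Z := by
    have := hLp l hl
    rw [this.2.2] at this; exact this.2.1
  obtain ⟨Z', hZ', hZ'c⟩ := exists_subset_card_eq htZ
  have hadj : ∀ v ∈ Z', ∀ u ∈ L, G.Adj v u := by
    intro v hv u hu
    have h1 := hZ' hv
    rw [← (hLp u hu).2.2, mem_filter] at h1
    exact h1.2
  have hZK : Z' ⊆ K := hZ'.trans (mem_powerset.1 hZ)
  refine ⟨Z' ∪ L, union_subset_union (hZK.trans hKA) fun u hu => (hLp u hu).1, ?_, ?_⟩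
  · intro x hx y hy hxy
    simp only [coe_union, Set.mem_union, mem_coe] at hx hy
    rcases hx with hx | hx <;> rcases hy with hy | hy
    · exact hK.isClique (hZK hx) (hZK hy) hxy
    · exact hadj x hx y hy
    · exact (hadj y hy x hx).symm
    · exact hL.isClique hx hy hxy
  · rw [card_union_of_disjoint, hZ'c, hL.card_eq, add_comm]
    rw [disjoint_left]
    intro x hx hx'
    exact G.irrefl (hadj x hx x hx')

lemma rt_embed {V ι : Type*} [DecidableEq V] [DecidableEq ι] {G : SimpleGraph V}
    [DecidableRel G.Adj]
    {r t : ℕ} (ht : 1 ≤ t) (hr : 1 ≤ r) {m d a M : ℝ} (hm : 0 < m) (hd : 0 < d) (hd1 : d ≤ 1)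
    (ha : ∀ S : Finset V, a < #S → ∃ K ⊆ S, G.IsNClique r K)
    (hM2 : a + m ≤ M) (hM3 : a * 2 ^ r < d * M) (i₀ i₁ : ι) (h01 : i₀ ≠ i₁) (T : Finset ι) :
    i₀ ∉ T → i₁ ∉ T → ((#T : ℝ) + 2) * m ≤ M → ∀ A : ι → Finset V,
    RTLower G m (((t : ℝ) - 1) / r + d) (A i₀) (A i₁) →
    (∀ i ∈ insert i₀ (insert i₁ T), ∀ j ∈ insert i₀ (insert i₁ T), i ≠ j →
      RTLower G m d (A i) (A j)) →
    (∀ i ∈ insert i₀ (insert i₁ T), M ≤ d ^ #T * #(A i)) →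
    ∃ K ⊆ (insert i₀ (insert i₁ T)).biUnion A, G.IsNClique (#T + (r + t)) K := by
  induction T using Finset.induction_on with
  | empty =>
    intro _ _ hM A h1 h2 h3
    have hA := h3 i₀ (by simp)
    have hB := h3 i₁ (by simp)
    simp only [card_empty, pow_zero, one_mul] at hA hB
    simp only [card_empty, Nat.cast_zero, zero_add] at hM
    obtain ⟨K, hK, hK'⟩ := rt_pair ht hr hm hd ha h1 hA hB (by linarith) hM2 hM3
    refine ⟨K, ?_, by simpa using hK'⟩
    simpa [biUnion_insert] using hK
  | insert j T hj ih =>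
    intro h0 h1 hM A hL hLR hsz
    simp only [mem_insert, not_or] at h0 h1
    rw [card_insert_of_notMem hj] at hM hsz
    set U := insert i₀ (insert i₁ T) with hU
    have hUsub : U ⊆ insert i₀ (insert i₁ (insert j T)) :=
      insert_subset_insert _ (insert_subset_insert _ (subset_insert _ _))
    have hjU : j ∉ U := by simp [hU, hj, Ne.symm h0.1, Ne.symm h1.1]
    have hjm : j ∈ insert i₀ (insert i₁ (insert j T)) := by simp
    have hMpos : 0 < M := lt_of_lt_of_le (by positivity) hM
    have hszM : ∀ i ∈ insert i₀ (insert i₁ (insert j T)), M ≤ #(A i) := by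
      intro i hi
      refine (hsz i hi).trans (mul_le_of_le_one_left (by positivity) (pow_le_one₀ hd.le hd1))
    push_cast at hM
    have hmM : m ≤ M := by
      have : (0 : ℝ) ≤ #T := by positivity
      nlinarith
    have hbad : ∀ i ∈ U, (#{v ∈ A j | (#{u ∈ A i | G.Adj v u} : ℝ) < d * #(A i)} : ℝ) ≤ m := by
      intro i hi
      refine (rt_bad hm (hLR j hjm i (hUsub hi) ?_) (hmM.trans (hszM i (hUsub hi)))).le
      rintro rfl; exact hjU hi
    have hUc : #U = #T + 2 := by
      rw [hU, card_insert_of_notMem, card_insert_of_notMem h1.2]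
      simp [h01, h0.2]
    have hex : ∃ v ∈ A j, ∀ i ∈ U, d * #(A i) ≤ (#{u ∈ A i | G.Adj v u} : ℝ) := by
      by_contra hc
      push Not at hc
      have hsub : A j ⊆ U.biUnion
          fun i => {v ∈ A j | (#{u ∈ A i | G.Adj v u} : ℝ) < d * #(A i)} := by
        intro v hv
        obtain ⟨i, hi, hlt⟩ := hc v hv
        exact mem_biUnion.2 ⟨i, hi, mem_filter.2 ⟨hv, hlt⟩⟩
      have h5 := (card_le_card hsub).trans card_biUnion_le
      have h6 : (#(A j) : ℝ) ≤ ∑ i ∈ U, m := by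
        refine le_trans (b := ∑ i ∈ U,
          (#{v ∈ A j | (#{u ∈ A i | G.Adj v u} : ℝ) < d * #(A i)} : ℝ)) ?_ (sum_le_sum hbad)
        exact_mod_cast h5
      rw [sum_const, nsmul_eq_mul, hUc] at h6
      push_cast at h6
      have := hszM j hjm
      linarith
    obtain ⟨v, hv, hvd⟩ := hex
    obtain ⟨K, hKs, hK⟩ := ih h0.2 h1.2 (by linarith) (fun i => {u ∈ A i | G.Adj v u})
      (hL.mono (filter_subset _ _) (filter_subset _ _))
      (fun i hi k hk hik => (hLR i (hUsub hi) k (hUsub hk) hik).mono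
        (filter_subset _ _) (filter_subset _ _))
      (fun i hi => by
        refine (hsz i (hUsub hi)).trans ?_
        rw [pow_succ, mul_assoc]
        exact mul_le_mul_of_nonneg_left (hvd i hi) (by positivity))
    have hKv : ∀ u ∈ K, G.Adj v u := by
      intro u hu
      obtain ⟨i, _, hi⟩ := mem_biUnion.1 (hKs hu)
      exact (mem_filter.1 hi).2
    refine ⟨insert v K, ?_, ?_⟩
    · refine insert_subset (mem_biUnion.2 ⟨j, hjm, hv⟩) ?_
      intro u hu
      obtain ⟨i, hi, hi'⟩ := mem_biUnion.1 (hKs hu)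
      exact mem_biUnion.2 ⟨i, hUsub hi, (mem_filter.1 hi').1⟩
    · rw [card_insert_of_notMem hj]
      have := hK.insert hKv
      convert this using 1
      omega

lemma rt_interedges_eq {V : Type*} (G : SimpleGraph V) [DecidableRel G.Adj] (X Y : Finset V) :
    (#(G.interedges X Y) : ℝ) = (G.edgeDensity X Y : ℝ) * #X * #Y := by
  rw [SimpleGraph.edgeDensity_def]
  push_cast
  rcases X.eq_empty_or_nonempty with h | h
  · subst h; simp
  rcases Y.eq_empty_or_nonempty with h' | h'
  · subst h'; simp [SimpleGraph.interedges_def]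
  have h1 : (#X : ℝ) ≠ 0 := by simp [h.ne_empty]
  have h2 : (#Y : ℝ) ≠ 0 := by simp [h'.ne_empty]
  field_simp

lemma rt_lower_of_uniform {V : Type*} {G : SimpleGraph V} [DecidableRel G.Adj] {ε N d : ℝ}
    (hε : 0 < ε) {U W : Finset V} (h : G.IsUniform ε U W) (hU : (#U : ℝ) ≤ N) (hW : (#W : ℝ) ≤ N)
    (hd : d + ε ≤ G.edgeDensity U W) : RTLower G (ε * N) d U W := by
  intro X hX Y hY hXc hYc
  have h1 := h hX hY (by nlinarith) (by nlinarith)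
  have h2 := (abs_lt.1 h1).1
  rw [rt_interedges_eq]
  have : d ≤ G.edgeDensity X Y := by linarith
  gcongr

lemma rt_exists_clique {V : Type*} [DecidableEq V] (G : SimpleGraph V) (r : ℕ) (a : ℝ)
    (h : ∀ S : Finset V, (G.induce (S : Set V)).CliqueFree r → (#S : ℝ) ≤ a)
    (S : Finset V) (hS : a < #S) : ∃ K ⊆ S, G.IsNClique r K := by
  by_contra hc
  push Not at hc
  refine absurd (h S ?_) (not_le.2 hS)
  intro t ht
  refine hc (t.map (Function.Embedding.subtype _)) ?_ ?_
  · intro x hx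
    simp only [mem_map, Function.Embedding.subtype_apply] at hx
    obtain ⟨y, _, rfl⟩ := hx
    exact y.2
  · exact (ht.map (f := Function.Embedding.subtype _)).mono (SimpleGraph.map_comap_le _ _)

open Classical in
/-- Level of the density of a pair in the reduced weighted graph. -/
noncomputable def rtWeight {V : Type*} (G : SimpleGraph V) [DecidableRel G.Adj]
    (r : ℕ) (ε δ : ℝ) (U W : Finset V) : ℕ :=
  if U ≠ W ∧ G.IsUniform ε U W then ⌈(r : ℝ) * ((G.edgeDensity U W : ℝ) - δ)⌉₊ else 0

lemma rtWeight_symm {V : Type*} (G : SimpleGraph V) [DecidableRel G.Adj]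
    (r : ℕ) (ε δ : ℝ) (U W : Finset V) : rtWeight G r ε δ U W = rtWeight G r ε δ W U := by
  unfold rtWeight
  have h : (U ≠ W ∧ G.IsUniform ε U W) ↔ (W ≠ U ∧ G.IsUniform ε W U) :=
    and_congr ne_comm (SimpleGraph.isUniform_comm G)
  rw [SimpleGraph.edgeDensity_comm]
  by_cases hc : U ≠ W ∧ G.IsUniform ε U W
  · rw [if_pos hc, if_pos (h.1 hc)]
  · rw [if_neg hc, if_neg (fun h' => hc (h.2 h'))]

lemma rtWeight_diag {V : Type*} (G : SimpleGraph V) [DecidableRel G.Adj]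
    (r : ℕ) (ε δ : ℝ) (U : Finset V) : rtWeight G r ε δ U U = 0 := by
  simp [rtWeight]

lemma rtWeight_pos {V : Type*} {G : SimpleGraph V} [DecidableRel G.Adj]
    {r : ℕ} (hr : 1 ≤ r) {ε δ : ℝ} {U W : Finset V} (h : rtWeight G r ε δ U W ≠ 0) :
    G.IsUniform ε U W ∧
      ((rtWeight G r ε δ U W : ℝ) - 1) / r + δ ≤ G.edgeDensity U W := by
  classical
  unfold rtWeight at *
  split_ifs at h ⊢ with hc
  · refine ⟨hc.2, ?_⟩
    have hr' : (0 : ℝ) < r := by exact_mod_cast hr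
    have h1 := Nat.ceil_lt_add_one (a := (r : ℝ) * ((G.edgeDensity U W : ℝ) - δ)) (by
      by_contra hn
      exact h (Nat.ceil_eq_zero.2 (not_le.1 hn).le))
    have : ((⌈(r : ℝ) * ((G.edgeDensity U W : ℝ) - δ)⌉₊ : ℝ) - 1) / r ≤
        (G.edgeDensity U W : ℝ) - δ := by
      rw [div_le_iff₀ hr']; linarith
    linarith
  · exact absurd rfl h

lemma rtWeight_ge {V : Type*} {G : SimpleGraph V} [DecidableRel G.Adj]
    {r : ℕ} (hr : 1 ≤ r) {ε δ : ℝ} {U W : Finset V} (hne : U ≠ W) (hu : G.IsUniform ε U W) :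
    (G.edgeDensity U W : ℝ) ≤ (rtWeight G r ε δ U W : ℝ) / r + δ := by
  classical
  have hr' : (0 : ℝ) < r := by exact_mod_cast hr
  unfold rtWeight
  rw [if_pos ⟨hne, hu⟩]
  have h1 := Nat.le_ceil ((r : ℝ) * ((G.edgeDensity U W : ℝ) - δ))
  have : (G.edgeDensity U W : ℝ) - δ ≤
      (⌈(r : ℝ) * ((G.edgeDensity U W : ℝ) - δ)⌉₊ : ℝ) / r := by
    rw [le_div_iff₀ hr']; linarith
  linarith

/-- Cliques in the reduced weighted graph have small weights. -/
lemma rt_reduced_clique {V : Type*} [DecidableEq V] {G : SimpleGraph V} [DecidableRel G.Adj]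
    {r s : ℕ} (hr : 1 ≤ r) (hs : 2 ≤ s) (hs5 : s ≤ 5) (hG : G.CliqueFree (r + s))
    {ε d a M N : ℝ} (hε : 0 < ε) (hεd : ε ≤ d) (hN : 0 < N) (hd : 0 < d) (hd1 : d ≤ 1)
    (ha : ∀ S : Finset V, a < #S → ∃ K ⊆ S, G.IsNClique r K)
    (hM1 : 6 * (ε * N) ≤ M) (hM2 : a + ε * N ≤ M) (hM3 : a * 2 ^ r < d * M)
    (P : Finset (Finset V)) (hPN : ∀ U ∈ P, (#U : ℝ) ≤ N) (hPM : ∀ U ∈ P, M ≤ d ^ 4 * #U)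
    (C : Finset (Finset V)) (hCP : C ⊆ P)
    (hC : ∀ U ∈ C, ∀ W ∈ C, U ≠ W → rtWeight G r ε (2 * d) U W ≠ 0) :
    ∀ U ∈ C, ∀ W ∈ C, U ≠ W → rtWeight G r ε (2 * d) U W + #C ≤ s + 1 := by
  intro U hU W hW hUW
  by_contra hlt
  push Not at hlt
  have hw := hC U hU W hW hUW
  set t := rtWeight G r ε (2 * d) U W with ht
  have hcard : #((C.erase U).erase W) = #C - 2 := by
    rw [card_erase_of_mem (by simp [hW, hUW.symm]), card_erase_of_mem hU]; omega
  have hC2 : 2 ≤ #C := one_lt_card.2 ⟨U, hU, W, hW, hUW⟩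
  obtain ⟨T, hT, hTc⟩ := exists_subset_card_eq
    (show min (#C - 2) (s - 1) ≤ #((C.erase U).erase W) by rw [hcard]; exact min_le_left _ _)
  have hUT : U ∉ T := fun h => by have := hT h; simp at this
  have hWT : W ∉ T := fun h => by have := hT h; simp at this
  have hTC : insert U (insert W T) ⊆ C := by
    refine insert_subset hU (insert_subset hW (hT.trans ?_))
    exact (erase_subset _ _).trans (erase_subset _ _)
  have hT4 : #T ≤ 4 := by omega
  have hT4' : (#T : ℝ) ≤ 4 := by exact_mod_cast hT4
  have hm : 0 < ε * N := by positivity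
  have hr' : (0 : ℝ) < r := by exact_mod_cast hr
  obtain ⟨K, -, hK⟩ := rt_embed (t := t) (G := G) (by omega) hr hm hd hd1 ha hM2 hM3 U W hUW T
    hUT hWT (by nlinarith) id
    (by
      obtain ⟨h1, h2⟩ := rtWeight_pos hr hw
      exact rt_lower_of_uniform hε h1 (hPN _ (hCP hU)) (hPN _ (hCP hW))
        (by simp only [id]; rw [← ht] at h2; linarith))
    (by
      intro i hi j hj hij
      have hw' := hC i (hTC hi) j (hTC hj) hij
      obtain ⟨h1, h2⟩ := rtWeight_pos hr hw'
      refine rt_lower_of_uniform hε h1 (hPN _ (hCP (hTC hi))) (hPN _ (hCP (hTC hj))) ?_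
      have h3 : (1 : ℝ) ≤ rtWeight G r ε (2 * d) i j := by
        exact_mod_cast Nat.one_le_iff_ne_zero.2 hw'
      have h4 : 0 ≤ ((rtWeight G r ε (2 * d) i j : ℝ) - 1) / r :=
        div_nonneg (by linarith) hr'.le
      simp only [id]
      linarith)
    (by
      intro i hi
      refine (hPM i (hCP (hTC hi))).trans ?_
      exact mul_le_mul_of_nonneg_right (pow_le_pow_of_le_one hd.le hd1 hT4) (by positivity))
  exact (hG.mono (by omega)) K hK

/-- Counting edges along a partition. -/
lemma rt_count {V : Type*} [DecidableEq V] [Fintype V] (G : SimpleGraph V) [DecidableRel G.Adj]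
    {r : ℕ} (hr : 1 ≤ r) {ε δ N c : ℝ} (hδ : 0 ≤ δ)
    (P : Finpartition (univ : Finset V)) (hPN : ∀ U ∈ P.parts, (#U : ℝ) ≤ N)
    (hPu : P.IsUniform G ε) (hε : 0 ≤ ε)
    (hQ : ∑ U ∈ P.parts, ∑ W ∈ P.parts, (rtWeight G r ε δ U W : ℝ) * #U * #W ≤
      c * (∑ U ∈ P.parts, (#U : ℝ)) ^ 2) :
    2 * (G.edgeSet.ncard : ℝ) ≤ (c / r + δ) * (Fintype.card V : ℝ) ^ 2 + N * Fintype.card V +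
      ε * (#P.parts * N) ^ 2 := by
  have hr' : (0 : ℝ) < r := by exact_mod_cast hr
  have hN0 : (P.parts.Nonempty → 0 ≤ N) := fun ⟨U, hU⟩ => le_trans (by positivity) (hPN U hU)
  have hsumP : ∑ U ∈ P.parts, (#U : ℝ) = Fintype.card V := by
    have := P.sum_card_parts
    rw [card_univ] at this
    exact_mod_cast this
  have hE : 2 * (G.edgeSet.ncard : ℝ) =
      ∑ U ∈ P.parts, ∑ W ∈ P.parts, (#(G.interedges U W) : ℝ) := by
    have h1 : G.edgeSet.ncard = #G.edgeFinset := by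
      rw [← SimpleGraph.coe_edgeFinset, Set.ncard_coe_finset]
    have h2 := G.sum_degrees_eq_twice_card_edges
    have h3 : #(G.interedges univ univ) = ∑ v, G.degree v := by
      rw [rt_card_interedges]
      refine sum_congr rfl fun v _ => ?_
      rw [← SimpleGraph.card_neighborFinset_eq_degree, SimpleGraph.neighborFinset_eq_filter]
    have h4 : #(G.interedges univ univ) =
        ∑ ab ∈ P.parts ×ˢ P.parts, #(G.interedges ab.1 ab.2) :=
      Rel.card_interedges_finpartition G.Adj P P
    rw [sum_product] at h4
    have : 2 * G.edgeSet.ncard = ∑ U ∈ P.parts, ∑ W ∈ P.parts, #(G.interedges U W) := by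
      rw [h1, ← h4, h3, h2]
    exact_mod_cast this
  have hterm : ∀ U ∈ P.parts, ∀ W ∈ P.parts, (#(G.interedges U W) : ℝ) ≤
      ((1 / r) * ((rtWeight G r ε δ U W : ℝ) * #U * #W) + δ * (#U * #W)) +
      (if U = W then N * #U else 0) +
      (if (U, W) ∈ P.nonUniforms G ε then N ^ 2 else 0) := by
    intro U hU W hW
    have hN := hN0 ⟨U, hU⟩
    have hle : (#(G.interedges U W) : ℝ) ≤ #U * #W := by
      exact_mod_cast G.card_interedges_le_mul U W
    have hb : 0 ≤ (1 / r) * ((rtWeight G r ε δ U W : ℝ) * #U * #W) + δ * (#U * #W) := by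
      positivity
    have hi2 : (0 : ℝ) ≤ if (U, W) ∈ P.nonUniforms G ε then N ^ 2 else 0 := by
      split_ifs <;> positivity
    have hi1 : (0 : ℝ) ≤ if U = W then N * #U else 0 := by
      split_ifs <;> positivity
    by_cases hUW : U = W
    · rw [if_pos hUW]
      have : (#U : ℝ) * #W ≤ N * #U := by
        rw [← hUW]; exact mul_le_mul_of_nonneg_right (hPN U hU) (by positivity)
      linarith
    by_cases hu : G.IsUniform ε U W
    · have h1 := rtWeight_ge (δ := δ) hr hUW hu
      rw [rt_interedges_eq] at hle ⊢
      have h2 : (G.edgeDensity U W : ℝ) * #U * #W ≤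
          ((rtWeight G r ε δ U W : ℝ) / r + δ) * #U * #W := by gcongr
      have h3 : ((rtWeight G r ε δ U W : ℝ) / r + δ) * #U * #W =
        (1 / r) * ((rtWeight G r ε δ U W : ℝ) * #U * #W) + δ * (#U * #W) := by ring
      linarith
    · have hmem : (U, W) ∈ P.nonUniforms G ε := by
        rw [Finpartition.mk_mem_nonUniforms]; exact ⟨hU, hW, hUW, hu⟩
      rw [if_pos hmem]
      have : (#U : ℝ) * #W ≤ N ^ 2 := by
        rw [sq]; exact mul_le_mul (hPN U hU) (hPN W hW) (Nat.cast_nonneg _) hN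
      linarith
  have hsum := sum_le_sum fun U hU => sum_le_sum fun W hW => hterm U hU W hW
  rw [← hE] at hsum
  simp only [sum_add_distrib] at hsum
  have e6 : ∑ U ∈ P.parts, ∑ W ∈ P.parts,
        (1 / (r : ℝ)) * ((rtWeight G r ε δ U W : ℝ) * #U * #W) =
      (1 / (r : ℝ)) * ∑ U ∈ P.parts, ∑ W ∈ P.parts, (rtWeight G r ε δ U W : ℝ) * #U * #W := by
    rw [mul_sum]; exact sum_congr rfl fun U _ => (mul_sum _ _ _).symm
  have e1 : ∑ U ∈ P.parts, ∑ W ∈ P.parts, (if U = W then N * (#U : ℝ) else 0) =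
      N * Fintype.card V := by
    rw [← hsumP, mul_sum]
    refine sum_congr rfl fun U hU => ?_
    rw [sum_ite_eq, if_pos hU]
  have e2 : ∑ U ∈ P.parts, ∑ W ∈ P.parts, (if (U, W) ∈ P.nonUniforms G ε then N ^ 2 else 0) ≤
      ε * (#P.parts * N) ^ 2 := by
    rw [← sum_product', ← sum_filter, sum_const, nsmul_eq_mul]
    have h1 : #{x ∈ P.parts ×ˢ P.parts | (x.1, x.2) ∈ P.nonUniforms G ε} ≤
        #(P.nonUniforms G ε) := card_le_card fun x hx => (mem_filter.1 hx).2
    have h2 : (#(P.nonUniforms G ε) : ℝ) ≤ (#P.parts * (#P.parts - 1) : ℕ) * ε := hPu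
    have h3 : ((#P.parts * (#P.parts - 1) : ℕ) : ℝ) ≤ #P.parts * #P.parts := by
      exact_mod_cast Nat.mul_le_mul_left _ (Nat.sub_le _ _)
    have h4 : (#{x ∈ P.parts ×ˢ P.parts | (x.1, x.2) ∈ P.nonUniforms G ε} : ℝ) ≤
        #P.parts * #P.parts * ε := by
      refine le_trans (by exact_mod_cast h1) (h2.trans ?_)
      exact mul_le_mul_of_nonneg_right h3 hε
    refine (mul_le_mul_of_nonneg_right h4 (sq_nonneg N)).trans (le_of_eq ?_)
    ring
  have e3 : ∑ U ∈ P.parts, ∑ W ∈ P.parts, δ * ((#U : ℝ) * #W) =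
      δ * (Fintype.card V : ℝ) ^ 2 := by
    rw [sq, ← hsumP, sum_mul_sum, mul_sum]; exact sum_congr rfl fun U _ => (mul_sum _ _ _).symm
  rw [e1, e3, e6] at hsum
  rw [hsumP] at hQ
  have e4 := mul_le_mul_of_nonneg_left hQ (by positivity : 0 ≤ 1 / (r : ℝ))
  have e5 : (1 / (r : ℝ)) * (c * (Fintype.card V : ℝ) ^ 2) + δ * (Fintype.card V : ℝ) ^ 2 =
    (c / r + δ) * (Fintype.card V : ℝ) ^ 2 := by ring
  linarith

/-- **Theorem (Erdős–Hajnal–Simonovits–Sós–Szemerédi upper bound).**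
For `2 ≤ s ≤ min{5, r}`: for every `δ > 0` there are `ε > 0` and `n₀` such
that for all `n ≥ n₀`, every `K_{r+s}`-free graph `G` on `n` vertices with
`α_r(G) ≤ ε·n` has at most `((s-1)/(4r) + δ)·n²` edges, i.e.
`RT_r(n, K_{r+s}, o(n)) ≤ ((s-1)/(4r))·n² + o(n²)`. -/
theorem ramsey_turan_upper_bound
    (r s : ℕ) (hs : 2 ≤ s) (hs5 : s ≤ 5) (hsr : s ≤ r)
    (δ : ℝ) (hδ : 0 < δ) :
    ∃ ε : ℝ, 0 < ε ∧ ∃ n₀ : ℕ, ∀ n : ℕ, n₀ ≤ n →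
      ∀ G : SimpleGraph (Fin n),
        G.CliqueFree (r + s) →
        (∀ S : Finset (Fin n), (G.induce (S : Set (Fin n))).CliqueFree r →
          (S.card : ℝ) ≤ ε * n) →
        (G.edgeSet.ncard : ℝ) ≤ (((s : ℝ) - 1) / (4 * r) + δ) * n ^ 2 := by
  classical
  have hr : 1 ≤ r := by omega
  have hr' : (0 : ℝ) < r := by exact_mod_cast hr
  obtain ⟨d, hd0, hdδ, hd1⟩ : ∃ d : ℝ, 0 < d ∧ 2 * d ≤ δ ∧ d ≤ 1 / 2 :=
    ⟨min (δ / 2) (1 / 2), by positivity, by linarith [min_le_left (δ / 2) (1 / 2)],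
      min_le_right _ _⟩
  set ε : ℝ := d ^ 4 / 24 with hεdef
  have hε : 0 < ε := by positivity
  have hd4 : d ^ 4 ≤ d := pow_le_of_le_one hd0.le (by linarith) (by norm_num)
  have hεd : ε ≤ d / 24 := by rw [hεdef]; linarith
  obtain ⟨l, hl⟩ := exists_nat_gt (4 / δ)
  have hl0 : (0 : ℝ) < l := lt_trans (by positivity) hl
  set B := SzemerediRegularity.bound ε l with hB
  have hB0 : 0 < B := SzemerediRegularity.bound_pos _ _
  have hB0' : (0 : ℝ) < B := by exact_mod_cast hB0
  refine ⟨d ^ 5 / (4 * B * 2 ^ r), by positivity, max l (2 * B), ?_⟩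
  intro n hn G hG hα
  have hln : l ≤ n := (le_max_left _ _).trans hn
  have hBn : 2 * B ≤ n := (le_max_right _ _).trans hn
  obtain ⟨P, hPe, hPl, hPB, hPu⟩ := szemeredi_regularity G hε (l := l) (by simpa using hln)
  set k := #P.parts with hk
  have hlk : (l : ℝ) ≤ k := by exact_mod_cast hPl
  have hk0 : (0 : ℝ) < k := hl0.trans_le hlk
  have hk0' : 0 < k := by exact_mod_cast hk0
  have hkB : (k : ℝ) ≤ B := by exact_mod_cast hPB
  have hkn' : 2 * k ≤ n := le_trans (by omega) hBn
  have hkn : 2 * (k : ℝ) ≤ n := by exact_mod_cast hkn'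
  have hn0 : (0 : ℝ) < n := by linarith
  have hsz : ∀ U ∈ P.parts, (#U : ℝ) ≤ 2 * n / k ∧ (n : ℝ) / (2 * k) ≤ #U := by
    intro U hU
    have h1 := hPe.average_le_card_part hU
    have h2 := hPe.card_part_le_average_add_one hU
    rw [card_univ, Fintype.card_fin, ← hk] at h1 h2
    have h3 : ((n / k : ℕ) : ℝ) ≤ n / k := Nat.cast_div_le
    have h4 : (n : ℝ) / k < (n / k : ℕ) + 1 := by
      rw [div_lt_iff₀ hk0]
      exact_mod_cast Nat.lt_mul_of_div_lt (Nat.lt_succ_self _) hk0'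
    have h5 : (2 : ℝ) ≤ n / k := by rw [le_div_iff₀ hk0]; exact hkn
    have h1' : ((n / k : ℕ) : ℝ) ≤ #U := by exact_mod_cast h1
    have h2' : (#U : ℝ) ≤ (n / k : ℕ) + 1 := by exact_mod_cast h2
    have e1 : 2 * (n : ℝ) / k = 2 * (n / k) := by ring
    have e2 : (n : ℝ) / (2 * k) = (n / k) / 2 := by field_simp
    rw [e1, e2]
    constructor <;> linarith
  have hnk : 0 < (n : ℝ) / k := by positivity
  set M : ℝ := d ^ 4 * (n / (2 * k)) with hM
  have hMpos : 0 < M := by positivity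
  have hMN : 6 * (ε * (2 * n / k)) = M := by rw [hM, hεdef]; field_simp; norm_num
  have hM3 : d ^ 5 / (4 * B * 2 ^ r) * n * 2 ^ r < d * M := by
    have e1 : d ^ 5 / (4 * B * 2 ^ r) * n * 2 ^ r = d ^ 5 * n * (1 / (4 * B)) := by field_simp
    have e2 : d * M = d ^ 5 * n * (1 / (2 * k)) := by rw [hM]; field_simp
    rw [e1, e2]
    refine mul_lt_mul_of_pos_left ?_ (by positivity)
    exact one_div_lt_one_div_of_lt (by positivity) (by linarith)
  have hM2 : d ^ 5 / (4 * B * 2 ^ r) * n + ε * (2 * n / k) ≤ M := by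
    have h1 : (2 : ℝ) ≤ 2 ^ r := le_self_pow₀ (by norm_num) (by omega)
    have h2 : 0 ≤ d ^ 5 / (4 * B * 2 ^ r) * n := by positivity
    have h3 := mul_le_mul_of_nonneg_left h1 h2
    have h4 := mul_le_mul_of_nonneg_right hd1 hMpos.le
    linarith
  have hred := rt_reduced_clique hr hs hs5 hG hε (by linarith) (N := 2 * n / k) (M := M)
    (by positivity) hd0 (by linarith) (rt_exists_clique G r _ hα) hMN.le hM2 hM3 P.parts
    (fun U hU => (hsz U hU).1)
    (fun U hU => mul_le_mul_of_nonneg_left (hsz U hU).2 (by positivity))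
  have hQ := rt_weighted_turan s hs hs5 (rtWeight G r ε (2 * d)) (rtWeight_symm G r ε _)
    (rtWeight_diag G r ε _) _ P.parts rfl hred (fun U => (#U : ℝ)) (fun U _ => by positivity)
  have hfin := rt_count G hr (by linarith) P (fun U hU => (hsz U hU).1) hPu hε.le hQ
  rw [Fintype.card_fin, ← hk] at hfin
  have f1 : 2 * (n : ℝ) / k * n ≤ δ / 2 * n ^ 2 := by
    have : 2 / (k : ℝ) ≤ δ / 2 := by
      rw [div_lt_iff₀ hδ] at hl
      rw [div_le_iff₀ hk0]
      nlinarith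
    have h := mul_le_mul_of_nonneg_right this (sq_nonneg (n : ℝ))
    refine le_trans (le_of_eq ?_) h
    ring
  have f2 : ε * ((k : ℝ) * (2 * n / k)) ^ 2 = 4 * ε * n ^ 2 := by
    field_simp; norm_num
  have f3 : ((s : ℝ) - 1) / 2 / r = 2 * (((s : ℝ) - 1) / (4 * r)) := by field_simp; norm_num
  rw [f2, f3] at hfin
  have f4 : (2 * d + 4 * ε) * (n : ℝ) ^ 2 ≤ (3 / 2 * δ) * n ^ 2 :=
    mul_le_mul_of_nonneg_right (by linarith) (sq_nonneg _)
  nlinarith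
end

section
/- For every δ > 0 there exist ε > 0 and n₀ such that for every integer n ≥ n₀, every simple graph G on n vertices that contains no clique K_{16} and satisfies α_{10}(G) ≤ εn has at most (1/8 + δ)·n² edges. (Thus θ_{10}(K_{16}) ≤ 1/8; combined with the matching construction this gives θ_{10}(K_{16}) = 1/8.) -/
namespace RT
open Finset
open scoped Classical

/-- Lower regularity of a pair of vertex sets, inherited by subsets. -/
def LowReg {V : Type*} [Fintype V] (G : SimpleGraph V) (ρ d : ℝ) (U W : Finset V) : Prop :=
  ∀ X ⊆ U, ∀ Y ⊆ W, ρ ≤ (#X : ℝ) → ρ ≤ (#Y : ℝ) →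
    d * (#X : ℝ) * (#Y : ℝ) ≤ (#(G.interedges X Y) : ℝ)

/-- Every set of size at least `ρ` contains a `K₁₀`. -/
def Rich {V : Type*} (G : SimpleGraph V) (ρ : ℝ) : Prop :=
  ∀ S : Finset V, ρ ≤ (#S : ℝ) → ∃ Q ⊆ S, G.IsNClique 10 Q

section
variable {V : Type*} [Fintype V] {G : SimpleGraph V} {ρ : ℝ}

lemma LowReg.mono {d : ℝ} {U W U' W' : Finset V} (h : LowReg G ρ d U W) (hU : U' ⊆ U)
    (hW : W' ⊆ W) : LowReg G ρ d U' W' :=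
  fun X hX Y hY => h X (hX.trans hU) Y (hY.trans hW)

lemma lowReg_of_uniform {ε d : ℝ} {U W : Finset V} (hu : G.IsUniform ε U W)
    (hd : d + ε ≤ (G.edgeDensity U W : ℝ)) (h1 : #U * ε ≤ ρ) (h2 : #W * ε ≤ ρ) :
    LowReg G ρ d U W := by
  intro X hX Y hY hXρ hYρ
  have h := hu hX hY (h1.trans hXρ) (h2.trans hYρ)
  have h3 : d ≤ (G.edgeDensity X Y : ℝ) := by
    have := (abs_lt.1 h).1
    linarith
  rw [SimpleGraph.edgeDensity_def] at h3
  push_cast at h3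
  rcases Nat.eq_zero_or_pos (#X) with h0 | h0
  · simp [h0]
  rcases Nat.eq_zero_or_pos (#Y) with h0' | h0'
  · simp [h0']
  have : (0:ℝ) < #X * #Y := by positivity
  rw [le_div_iff₀ this] at h3
  linarith

lemma bad_lt (hρ : 0 < ρ) {d : ℝ} {U W : Finset V} (h : LowReg G ρ d U W) (hW : ρ ≤ (#W : ℝ)) :
    (#{v ∈ U | (#{w ∈ W | G.Adj v w} : ℝ) < d * #W} : ℝ) ≤ ρ := by
  by_contra! hc
  set X := {v ∈ U | (#{w ∈ W | G.Adj v w} : ℝ) < d * #W} with hX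
  have h1 := h X (filter_subset _ _) W subset_rfl hc.le hW
  have hXne : X.Nonempty := by
    rw [← card_pos]
    have : (0:ℝ) < #X := hρ.trans hc
    exact_mod_cast this
  have h2 : (#(G.interedges X W) : ℝ) = ∑ v ∈ X, (#{w ∈ W | G.Adj v w} : ℝ) := by
    rw [SimpleGraph.interedges_def, Finset.card_filter, Finset.sum_product]
    push_cast
    refine sum_congr rfl fun v _ => ?_
    rw [Finset.card_filter]
    push_cast
    rfl
  have h3 : ∑ v ∈ X, (#{w ∈ W | G.Adj v w} : ℝ) < ∑ v ∈ X, d * (#W : ℝ) :=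
    sum_lt_sum_of_nonempty hXne fun v hv => (mem_filter.1 hv).2
  rw [sum_const, nsmul_eq_mul] at h3
  rw [h2] at h1
  linarith

lemma good_vertices {ι : Type*} (hρ : 0 < ρ) {U : Finset V} (J : Finset ι) (W : ι → Finset V)
    (d : ι → ℝ) (h : ∀ j ∈ J, LowReg G ρ (d j) U (W j)) (hW : ∀ j ∈ J, ρ ≤ (#(W j) : ℝ))
    (hU : (#J + 1) * ρ ≤ (#U : ℝ)) :
    ∃ U' ⊆ U, ρ ≤ (#U' : ℝ) ∧
      ∀ v ∈ U', ∀ j ∈ J, d j * #(W j) ≤ (#{w ∈ W j | G.Adj v w} : ℝ) := by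
  let B : ι → Finset V := fun j => {v ∈ U | (#{w ∈ W j | G.Adj v w} : ℝ) < d j * #(W j)}
  refine ⟨U \ J.biUnion B, sdiff_subset, ?_, ?_⟩
  · have h1 : (#(J.biUnion B) : ℝ) ≤ #J * ρ := by
      calc (#(J.biUnion B) : ℝ) ≤ ∑ j ∈ J, (#(B j) : ℝ) := by exact_mod_cast card_biUnion_le
        _ ≤ ∑ j ∈ J, ρ := sum_le_sum fun j hj => bad_lt hρ (h j hj) (hW j hj)
        _ = #J * ρ := by simp
    have h2 : (#U : ℝ) ≤ #(U \ J.biUnion B) + #(J.biUnion B) := by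
      have := card_le_card_sdiff_add_card (s := U) (t := J.biUnion B)
      exact_mod_cast this
    linarith
  · intro v hv j hj
    by_contra! hc
    rw [mem_sdiff] at hv
    exact hv.2 (mem_biUnion.2 ⟨j, hj, mem_filter.2 ⟨hv.1, hc⟩⟩)

lemma pigeon_aux {α β : Type*} (Q : Finset α) (Y : Finset β) (r : α → β → Prop) (hQ : #Q = 10)
    (hY : Y.Nonempty) (t : ℕ) {κ : ℝ} (hκ : 0 < κ)
    (h : (t + κ) * #Y ≤ ∑ q ∈ Q, (#{y ∈ Y | r q y} : ℝ)) :
    ∃ T ⊆ Q, #T = t + 1 ∧ ∃ Z ⊆ Y, (∀ y ∈ Z, ∀ q ∈ T, r q y) ∧ κ / 20480 * #Y ≤ (#Z : ℝ) := by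
  by_contra! hc
  have hYp : (0:ℝ) < #Y := by exact_mod_cast hY.card_pos
  set Y' := {y ∈ Y | t + 1 ≤ #{q ∈ Q | r q y}} with hY'
  have h1 : ∑ q ∈ Q, (#{y ∈ Y | r q y} : ℝ) = ∑ y ∈ Y, (#{q ∈ Q | r q y} : ℝ) := by
    have := sum_card_bipartiteAbove_eq_sum_card_bipartiteBelow (s := Q) (t := Y) r
    simp only [bipartiteAbove, bipartiteBelow] at this
    exact_mod_cast this
  have h2 : ∑ y ∈ Y, (#{q ∈ Q | r q y} : ℝ) ≤ t * #Y + 10 * #Y' := by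
    calc ∑ y ∈ Y, (#{q ∈ Q | r q y} : ℝ)
        ≤ ∑ y ∈ Y, ((t:ℝ) + if t + 1 ≤ #{q ∈ Q | r q y} then 10 else 0) := by
          refine sum_le_sum fun y _ => ?_
          split_ifs with hh
          · have : #{q ∈ Q | r q y} ≤ 10 := hQ ▸ card_filter_le _ _
            have h' : (#{q ∈ Q | r q y} : ℝ) ≤ 10 := by exact_mod_cast this
            have : (0:ℝ) ≤ t := by positivity
            linarith
          · have : #{q ∈ Q | r q y} ≤ t := by omega
            have h' : (#{q ∈ Q | r q y} : ℝ) ≤ t := by exact_mod_cast this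
            linarith
      _ = t * #Y + 10 * #Y' := by
          rw [sum_add_distrib, sum_const, ← sum_filter, sum_const, nsmul_eq_mul, nsmul_eq_mul]
          ring
  have h3 : Y' ⊆ (Q.powersetCard (t+1)).biUnion fun T => {y ∈ Y | ∀ q ∈ T, r q y} := by
    intro y hy
    rw [hY', mem_filter] at hy
    obtain ⟨T, hT, hTc⟩ := exists_subset_card_eq hy.2
    rw [mem_biUnion]
    exact ⟨T, mem_powersetCard.2 ⟨hT.trans (filter_subset _ _), hTc⟩,
      mem_filter.2 ⟨hy.1, fun q hq => (mem_filter.1 (hT hq)).2⟩⟩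
  have h4 : (#Y' : ℝ) ≤ 1024 * (κ / 20480 * #Y) := by
    calc (#Y' : ℝ) ≤ ∑ T ∈ Q.powersetCard (t+1), (#{y ∈ Y | ∀ q ∈ T, r q y} : ℝ) := by
          exact_mod_cast (card_le_card h3).trans card_biUnion_le
      _ ≤ ∑ T ∈ Q.powersetCard (t+1), (κ / 20480 * #Y) := by
          refine sum_le_sum fun T hT => ?_
          rw [mem_powersetCard] at hT
          exact (hc T hT.1 hT.2 {y ∈ Y | ∀ q ∈ T, r q y} (filter_subset _ _)
            (fun y hy => (mem_filter.1 hy).2)).le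
      _ = #(Q.powersetCard (t+1)) * (κ / 20480 * #Y) := by simp
      _ ≤ 1024 * (κ / 20480 * #Y) := by
          have : #(Q.powersetCard (t+1)) ≤ 1024 := by
            rw [card_powersetCard, hQ]
            exact Nat.choose_le_two_pow 10 (t+1)
          have h' : (#(Q.powersetCard (t+1)) : ℝ) ≤ 1024 := by exact_mod_cast this
          gcongr
  have : 0 < κ * #Y := by positivity
  nlinarith

lemma pigeon {α β : Type*} (Q : Finset α) (Y : Finset β) (N : α → Finset β) (hQ : #Q = 10)
    (hY : Y.Nonempty) (hN : ∀ q ∈ Q, N q ⊆ Y) (t : ℕ) {κ : ℝ} (hκ : 0 < κ)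
    (h : (t + κ) * #Y ≤ ∑ q ∈ Q, (#(N q) : ℝ)) :
    ∃ T ⊆ Q, #T = t + 1 ∧ ∃ Z ⊆ Y, (∀ y ∈ Z, ∀ q ∈ T, y ∈ N q) ∧ κ / 20480 * #Y ≤ (#Z : ℝ) := by
  exact pigeon_aux Q Y (fun q y => y ∈ N q) hQ hY t hκ (by
    refine h.trans (le_of_eq (sum_congr rfl fun q hq => ?_))
    congr 2
    ext y
    simp only [mem_filter]
    exact ⟨fun hy => ⟨hN q hq hy, hy⟩, fun hy => hy.2⟩)

lemma clique_join {a b : ℕ} {S T : Finset V} (hS : G.IsNClique a S) (hT : G.IsNClique b T)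
    (h : ∀ x ∈ S, ∀ y ∈ T, G.Adj x y) : G.IsNClique (a + b) (S ∪ T) := by
  rw [SimpleGraph.isNClique_iff] at *
  refine ⟨?_, ?_⟩
  · intro x hx y hy hxy
    simp only [coe_union, Set.mem_union, mem_coe] at hx hy
    rcases hx with hx | hx <;> rcases hy with hy | hy
    · exact hS.1 hx hy hxy
    · exact h x hx y hy
    · exact (h y hy x hx).symm
    · exact hT.1 hx hy hxy
  · rw [card_union_of_disjoint, hS.2, hT.2]
    rw [disjoint_left]
    intro x hx hx'
    exact (h x hx x hx').ne rfl

lemma clique_sub {a b : ℕ} {S T : Finset V} (hS : G.IsNClique a S) (hT : T ⊆ S) (h : #T = b) :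
    G.IsNClique b T := by
  rw [SimpleGraph.isNClique_iff] at *
  exact ⟨hS.1.subset (by exact_mod_cast hT), h⟩

lemma pair_step (hρ : 0 < ρ) (hR : Rich G ρ) {d κ : ℝ} {U W : Finset V} (t : ℕ) (hκ : 0 < κ)
    (h : LowReg G ρ d U W) (hd : t + κ ≤ 10 * d) (hU : 2 * ρ ≤ (#U : ℝ)) (hW : ρ ≤ (#W : ℝ))
    (hW' : ρ ≤ κ / 20480 * (#W : ℝ)) :
    ∃ K ⊆ U ∪ W, G.IsNClique (t + 11) K := by
  obtain ⟨U', hU', hU'c, hg⟩ := good_vertices hρ (U := U) ({()} : Finset Unit) (fun _ => W)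
    (fun _ => d) (by simpa using h) (by simpa using hW) (by simp; linarith)
  obtain ⟨Q, hQ, hQc⟩ := hR U' hU'c
  have hWp : (0:ℝ) < #W := hρ.trans_le hW
  obtain ⟨T, hT, hTc, Z, hZ, hZT, hTW⟩ := pigeon Q W (fun q => {w ∈ W | G.Adj q w}) hQc.card_eq
    (card_pos.1 (by exact_mod_cast hWp)) (fun q _ => filter_subset _ _) t hκ (by
      calc (t + κ) * (#W : ℝ) ≤ (10 * d) * #W := by gcongr
        _ = ∑ q ∈ Q, d * (#W : ℝ) := by rw [sum_const, hQc.card_eq]; simp; ring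
        _ ≤ _ := sum_le_sum fun q hq => hg q (hQ hq) () (by simp))
  obtain ⟨Q', hQ', hQ'c⟩ := hR _ (hW'.trans hTW)
  refine ⟨T ∪ Q', ?_, ?_⟩
  · exact union_subset_union ((hT.trans hQ).trans hU') (hQ'.trans hZ)
  · have := clique_join (clique_sub hQc hT hTc) hQ'c
      (fun x hx y hy => (mem_filter.1 (hZT y (hQ' hy) x hx)).2)
    exact this

lemma triangle_step (hρ : 0 < ρ) (hR : Rich G ρ) {a b c κ : ℝ} {A B C : Finset V} (hκ : 0 < κ)
    (hκ1 : κ ≤ 1) (hb : 0 < b) (hc : 0 < c)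
    (hAB : LowReg G ρ b A B) (hAC : LowReg G ρ c A C) (hBC : LowReg G ρ a B C)
    (ha : 3 + κ ≤ 10 * a) (hbc : 1 + κ ≤ 10 * (b * c))
    (hA : 3 * ρ ≤ (#A : ℝ)) (hB : 2 * ρ ≤ κ / 20480 * (#B : ℝ))
    (hC : ρ ≤ κ / 20480 * (κ / 20480 * (#C : ℝ))) :
    ∃ K, G.IsNClique 16 K := by
  have hk : κ / 20480 ≤ 1 := by linarith
  have hk0 : 0 < κ / 20480 := by positivity
  have hB1 : ρ ≤ (#B : ℝ) := by
    have : κ / 20480 * (#B : ℝ) ≤ 1 * #B := by gcongr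
    linarith
  have hC0 : κ / 20480 * (κ / 20480 * (#C : ℝ)) ≤ 1 * (κ / 20480 * (#C : ℝ)) := by gcongr
  have hC1 : ρ ≤ (#C : ℝ) := by
    have : κ / 20480 * (#C : ℝ) ≤ 1 * #C := by gcongr
    linarith
  obtain ⟨U', hU', hU'c, hg⟩ := good_vertices hρ (U := A) (univ : Finset Bool)
    (fun x => if x then B else C) (fun x => if x then b else c)
    (by intro j _; cases j <;> simpa) (by intro j _; cases j <;> simpa) (by simp; linarith)
  obtain ⟨Q, hQ, hQc⟩ := hR U' hU'c
  have hBp : (0:ℝ) < #B := hρ.trans_le hB1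
  have hCp : (0:ℝ) < #C := hρ.trans_le hC1
  obtain ⟨T, hT, hTc, Z, hZ, hZT, hTW⟩ := pigeon Q (B ×ˢ C)
    (fun q => {w ∈ B | G.Adj q w} ×ˢ {w ∈ C | G.Adj q w}) hQc.card_eq
    (card_pos.1 (by rw [card_product]; exact_mod_cast mul_pos hBp hCp))
    (fun q _ => product_subset_product (filter_subset _ _) (filter_subset _ _)) 1 hκ (by
      rw [card_product]
      push_cast
      calc (1 + κ) * ((#B : ℝ) * #C) ≤ (10 * (b * c)) * (#B * #C) := by gcongr
        _ = ∑ q ∈ Q, (b * (#B : ℝ)) * (c * #C) := by rw [sum_const, hQc.card_eq]; simp; ring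
        _ ≤ _ := sum_le_sum fun q hq => by
            rw [card_product]
            push_cast
            have h1 := hg q (hQ hq) true (by simp)
            have h2 := hg q (hQ hq) false (by simp)
            simp only [if_true, Bool.false_eq_true, if_false] at h1 h2
            gcongr)
  have hZs : Z ⊆ {y ∈ B | ∀ q ∈ T, G.Adj q y} ×ˢ {z ∈ C | ∀ q ∈ T, G.Adj q z} := by
    intro y hy
    have h1 := mem_product.1 (hZ hy)
    have h2 : ∀ q ∈ T, G.Adj q y.1 ∧ G.Adj q y.2 := fun q hq => by
      have := mem_product.1 (hZT y hy q hq)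
      exact ⟨(mem_filter.1 this.1).2, (mem_filter.1 this.2).2⟩
    exact mem_product.2 ⟨mem_filter.2 ⟨h1.1, fun q hq => (h2 q hq).1⟩,
      mem_filter.2 ⟨h1.2, fun q hq => (h2 q hq).2⟩⟩
  have hZc := card_le_card hZs
  rw [card_product] at hZc hTW
  have hZc' : (#Z : ℝ) ≤ #{y ∈ B | ∀ q ∈ T, G.Adj q y} * #{z ∈ C | ∀ q ∈ T, G.Adj q z} := by
    exact_mod_cast hZc
  replace hTW := hTW.trans hZc'
  push_cast at hTW
  clear hZc hZc'
  set B' := {y ∈ B | ∀ q ∈ T, G.Adj q y}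
  set C' := {y ∈ C | ∀ q ∈ T, G.Adj q y}
  have hB'le : (#B' : ℝ) ≤ #B := by exact_mod_cast card_filter_le _ _
  have hC'le : (#C' : ℝ) ≤ #C := by exact_mod_cast card_filter_le _ _
  have hB' : κ / 20480 * #B ≤ (#B' : ℝ) := by
    by_contra! hcon
    have : (#B' : ℝ) * #C' ≤ #B' * #C := by gcongr
    have : (#B' : ℝ) * #C < κ / 20480 * #B * #C := by gcongr
    linarith
  have hC' : κ / 20480 * #C ≤ (#C' : ℝ) := by
    by_contra! hcon
    have : (#B' : ℝ) * #C' ≤ #B * #C' := by gcongr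
    have : (#B : ℝ) * #C' < #B * (κ / 20480 * #C) := by gcongr
    linarith
  have hC'' : κ / 20480 * (κ / 20480 * #C) ≤ κ / 20480 * (#C' : ℝ) := by gcongr
  obtain ⟨K, hK, hKc⟩ := pair_step hρ hR (U := B') (W := C') 3 hκ
    (hBC.mono (filter_subset _ _) (filter_subset _ _)) (by exact_mod_cast ha) (by linarith)
    (by linarith) (by linarith)
  refine ⟨T ∪ K, clique_join (clique_sub hQc hT hTc) hKc ?_⟩
  intro x hx y hy
  rcases mem_union.1 (hK hy) with h | h
  · exact (mem_filter.1 h).2 x hx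
  · exact (mem_filter.1 h).2 x hx

lemma ext_step {ι : Type*} (hρ : 0 < ρ) (hR : Rich G ρ) {d κ η s : ℝ} (t : ℕ) (hκ : 0 < κ)
    (hη : 0 < η) (hη1 : η ≤ 1) (hκ1 : κ ≤ 1)
    (hd : t + κ ≤ 10 * d) {u w : ι} (hs : 8 * ρ ≤ s) (hs' : ρ ≤ κ / 20480 * s) (J : Finset ι) :
    #J ≤ 5 → u ∉ J → w ∉ J → ∀ W : ι → Finset V,
    (∀ i ∈ insert u (insert w J), ∀ j ∈ insert u (insert w J), i ≠ j →
      LowReg G ρ η (W i) (W j)) →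
    LowReg G ρ d (W u) (W w) →
    (∀ i ∈ insert u (insert w J), s ≤ η ^ #J * (#(W i) : ℝ)) →
    ∃ K, (∀ x ∈ K, ∃ i ∈ insert u (insert w J), x ∈ W i) ∧ G.IsNClique (#J + (t + 11)) K := by
  induction J using Finset.induction_on with
  | empty =>
    intro _ _ _ W hW hd' hsz
    have h1 := hsz u (by simp)
    have h2 := hsz w (by simp)
    simp only [card_empty, pow_zero, one_mul] at h1 h2
    have h3 : κ / 20480 * s ≤ κ / 20480 * (#(W w) : ℝ) := by gcongr
    obtain ⟨K, hK, hKc⟩ := pair_step hρ hR t hκ hd' hd (by linarith) (by linarith) (by linarith)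
    refine ⟨K, ?_, by simpa using hKc⟩
    intro x hx
    rcases mem_union.1 (hK hx) with h | h
    · exact ⟨u, by simp, h⟩
    · exact ⟨w, by simp, h⟩
  | insert j J hj ih =>
    intro hJ hu hw W hW hd' hsz
    rw [card_insert_of_notMem hj] at hJ hsz ⊢
    rw [mem_insert, not_or] at hu hw
    set I := insert u (insert w J) with hI
    have hIsub : ∀ i ∈ I, i ∈ insert u (insert w (insert j J)) := by
      intro i hi
      simp only [hI, mem_insert] at hi ⊢
      tauto
    have hjI : j ∉ I := by
      simp only [hI, mem_insert, not_or]
      exact ⟨fun h => hu.1 h.symm, fun h => hw.1 h.symm, hj⟩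
    have hjm : j ∈ insert u (insert w (insert j J)) := by simp
    have hsz' : ∀ i ∈ insert u (insert w (insert j J)), s ≤ (#(W i) : ℝ) := by
      intro i hi
      refine (hsz i hi).trans ?_
      have : η ^ (#J + 1) ≤ 1 := pow_le_one₀ hη.le hη1
      have h' : (0:ℝ) ≤ #(W i) := by positivity
      nlinarith
    have hIc : (#I : ℝ) ≤ 7 := by
      have : #I ≤ 7 := by
        have h1 := card_insert_le u (insert w J)
        have h2 := card_insert_le w J
        rw [hI]
        omega
      exact_mod_cast this
    obtain ⟨U', hU', hU'c, hg⟩ := good_vertices hρ (U := W j) I W (fun _ => η)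
      (fun i hi => hW j hjm i (hIsub i hi) (fun h => hjI (h ▸ hi)))
      (fun i hi => by have := hsz' i (hIsub i hi); linarith)
      (by have := hsz' j hjm; nlinarith)
    obtain ⟨v, hv⟩ : U'.Nonempty := by
      rw [← card_pos]
      have : (0:ℝ) < #U' := hρ.trans_le hU'c
      exact_mod_cast this
    obtain ⟨K, hK, hKc⟩ := ih (by omega) hu.2 hw.2 (fun i => {x ∈ W i | G.Adj v x})
      (fun i hi k hk hik => (hW i (hIsub i hi) k (hIsub k hk) hik).mono
        (filter_subset _ _) (filter_subset _ _))
      (hd'.mono (filter_subset _ _) (filter_subset _ _))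
      (fun i hi => by
        have h1 := hg v hv i hi
        have h2 := hsz i (hIsub i hi)
        calc s ≤ η ^ (#J + 1) * (#(W i) : ℝ) := h2
          _ = η ^ #J * (η * #(W i)) := by ring
          _ ≤ _ := by gcongr)
    refine ⟨{v} ∪ K, ?_, ?_⟩
    · intro x hx
      rcases mem_union.1 hx with h | h
      · rw [mem_singleton] at h
        exact ⟨j, hjm, h ▸ hU' hv⟩
      · obtain ⟨i, hi, hx⟩ := hK x h
        exact ⟨i, hIsub i hi, (mem_filter.1 hx).1⟩
    · have h1 : G.IsNClique 1 {v} := by simp [SimpleGraph.isNClique_iff]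
      have := clique_join h1 hKc (by
        intro x hx y hy
        rw [mem_singleton] at hx
        obtain ⟨i, hi, hy⟩ := hK y hy
        exact hx ▸ (mem_filter.1 hy).2)
      rwa [show #J + 1 + (t + 11) = 1 + (#J + (t + 11)) by ring]
end
end RT
namespace RT
open Finset
open scoped Classical

section
variable {ι : Type*} [Fintype ι]

/-- The Lagrangian quadratic form. -/
noncomputable def F (D : Matrix ι ι ℝ) (x : ι → ℝ) : ℝ := ∑ i, ∑ j, D i j * x i * x j

lemma F_eq (D : Matrix ι ι ℝ) (x : ι → ℝ) : F D x = dotProduct x (D.mulVec x) := by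
  simp only [F, dotProduct, Matrix.mulVec, mul_sum]
  refine sum_congr rfl fun i _ => sum_congr rfl fun j _ => by ring

lemma F_shift (D : Matrix ι ι ℝ) (hsymm : D.transpose = D) (hd : ∀ i, D i i = 0) {i j : ι}
    (hij : D i j = 0) (x : ι → ℝ) (t : ℝ) :
    F D (x + t • (Pi.single i 1 - Pi.single j 1)) =
      F D x + 2 * t * (D.mulVec x i - D.mulVec x j) := by
  have hji : D j i = 0 := by rw [← hsymm]; exact hij
  have hcomm : dotProduct x (D.mulVec (Pi.single i 1 - Pi.single j 1)) =
      dotProduct (Pi.single i 1 - Pi.single j 1) (D.mulVec x) := by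
    rw [Matrix.dotProduct_mulVec, ← Matrix.mulVec_transpose, hsymm, dotProduct_comm]
  have h0 : dotProduct (Pi.single i 1 - Pi.single j 1)
      (D.mulVec (Pi.single i 1 - Pi.single j 1)) = 0 := by
    simp [Matrix.mulVec_sub, sub_dotProduct, hd, hij, hji]
  have h1 : dotProduct (Pi.single i 1 - Pi.single j 1) (D.mulVec x) =
      D.mulVec x i - D.mulVec x j := by
    simp [sub_dotProduct]
  rw [F_eq, F_eq, Matrix.mulVec_add, Matrix.mulVec_smul, add_dotProduct, dotProduct_add,
    dotProduct_add, smul_dotProduct, smul_dotProduct, dotProduct_smul, dotProduct_smul, hcomm, h0,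
    h1]
  simp only [smul_eq_mul]
  ring

lemma exists_clique_support (D : Matrix ι ι ℝ) (hsymm : D.transpose = D) (hd : ∀ i, D i i = 0)
    (x : ι → ℝ) (hx : ∀ i, 0 ≤ x i) (hx1 : ∑ i, x i = 1) :
    ∃ y : ι → ℝ, (∀ i, 0 ≤ y i) ∧ ∑ i, y i = 1 ∧ F D x ≤ F D y ∧
      ∀ i j, i ≠ j → y i ≠ 0 → y j ≠ 0 → D i j ≠ 0 := by
  generalize hm : #{i | x i ≠ 0} = m
  induction m using Nat.strong_induction_on generalizing x with
  | _ m ih =>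
  by_cases hcl : ∀ i j, i ≠ j → x i ≠ 0 → x j ≠ 0 → D i j ≠ 0
  · exact ⟨x, hx, hx1, le_rfl, hcl⟩
  push Not at hcl
  have key : ∀ i j, i ≠ j → x i ≠ 0 → x j ≠ 0 → D i j = 0 → D.mulVec x j ≤ D.mulVec x i →
      ∃ y : ι → ℝ, (∀ i, 0 ≤ y i) ∧ ∑ i, y i = 1 ∧ F D x ≤ F D y ∧
      ∀ i j, i ≠ j → y i ≠ 0 → y j ≠ 0 → D i j ≠ 0 := by
    intro i j hij hi hj hD hle
    set z : ι → ℝ := x + x j • (Pi.single i 1 - Pi.single j 1) with hz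
    have hzj : z j = 0 := by simp [hz, hij.symm]
    have hzi : z i = x i + x j := by simp [hz, hij]
    have hzk : ∀ k, k ≠ i → k ≠ j → z k = x k := by
      intro k h1 h2; simp [hz, h1, h2]
    have hz0 : ∀ k, 0 ≤ z k := by
      intro k
      by_cases h1 : k = i
      · rw [h1, hzi]; linarith [hx i, hx j]
      by_cases h2 : k = j
      · rw [h2, hzj]
      · rw [hzk k h1 h2]; exact hx k
    have hz1 : ∑ k, z k = 1 := by
      simp [hz, sum_add_distrib, hx1, ← mul_sum]
    have hlt : #{k | z k ≠ 0} < m := by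
      rw [← hm]
      apply card_lt_card
      rw [ssubset_iff_of_subset]
      · exact ⟨j, by simp [hj], by simp [hzj]⟩
      · intro k hk
        simp only [mem_filter, mem_univ, true_and] at hk ⊢
        by_cases h1 : k = i
        · rw [h1]; exact hi
        by_cases h2 : k = j
        · rw [h2]; exact hj
        · rwa [hzk k h1 h2] at hk
    obtain ⟨y, h1, h2, h3, h4⟩ := ih _ hlt z hz0 hz1 rfl
    refine ⟨y, h1, h2, le_trans ?_ h3, h4⟩
    rw [hz, F_shift D hsymm hd hD]
    have := hx j
    nlinarith [mul_nonneg this (sub_nonneg.2 hle)]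
  obtain ⟨i, j, hij, hi, hj, hD⟩ := hcl
  rcases le_total (D.mulVec x j) (D.mulVec x i) with h | h
  · exact key i j hij hi hj hD h
  · exact key j i hij.symm hj hi (by rw [← hsymm]; exact hD) h

lemma tri_ineq {a b c x y z : ℝ} (hx : 0 ≤ x) (hy : 0 ≤ y) (hz : 0 ≤ z) (h1 : x + y + z = 1)
    (ha : a ≤ 4/10) (hb : b ≤ 4/10) (hc : c ≤ 4/10)
    (hbc : b * c ≤ 1/10) : a * (y * z) + b * (x * z) + c * (x * y) ≤ 1/8 := by
  have hs : b + c ≤ 65/100 := by nlinarith [mul_nonneg (sub_nonneg.2 hb) (sub_nonneg.2 hc)]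
  have key : ∀ x y z : ℝ, 0 ≤ x → 0 ≤ y → 0 ≤ z → x + y + z = 1 →
      4/10 * (y * z) + 4/10 * (x * z) + 25/100 * (x * y) ≤ 1/8 := by
    intro x y z hx hy hz h1
    obtain rfl : z = 1 - x - y := by linarith
    nlinarith [sq_nonneg (x - y), sq_nonneg (x + y - 6/10)]
  have hyz : a * (y * z) ≤ 4/10 * (y * z) := by gcongr
  rcases le_total y z with h | h
  · have h2 := key x y z hx hy hz h1
    have : b * (x * z) + c * (x * y) ≤ 4/10 * (x * z) + 25/100 * (x * y) := by
      have e1 : c * (x * y) ≤ (65/100 - b) * (x * y) := by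
        have := mul_nonneg hx hy
        nlinarith
      have e2 : 0 ≤ (4/10 - b) * (x * (z - y)) :=
        mul_nonneg (by linarith) (mul_nonneg hx (by linarith))
      nlinarith
    linarith
  · have h2 := key x z y hx hz hy (by linarith)
    have : b * (x * z) + c * (x * y) ≤ 25/100 * (x * z) + 4/10 * (x * y) := by
      have e1 : b * (x * z) ≤ (65/100 - c) * (x * z) := by
        have := mul_nonneg hx hz
        nlinarith
      have e2 : 0 ≤ (4/10 - c) * (x * (y - z)) :=
        mul_nonneg (by linarith) (mul_nonneg hx (by linarith))
      nlinarith
    nlinarith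

lemma F_support (D : Matrix ι ι ℝ) (y : ι → ℝ) (s : Finset ι) (hs : ∀ i, i ∉ s → y i = 0) :
    F D y = ∑ i ∈ s, ∑ j ∈ s, D i j * y i * y j := by
  unfold F
  symm
  have h : ∀ i, ∑ j ∈ s, D i j * y i * y j = ∑ j, D i j * y i * y j := fun i =>
    sum_subset (subset_univ s) fun j _ hj => by rw [hs j hj, mul_zero]
  simp only [h]
  refine sum_subset (subset_univ s) fun i _ hi => ?_
  simp [hs i hi]

lemma F_le (D : Matrix ι ι ℝ) (hd : ∀ i, D i i = 0) (y : ι → ℝ) (hy : ∀ i, 0 ≤ y i)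
    (hy1 : ∑ i, y i = 1) (s : Finset ι) (hs : ∀ i, i ∉ s → y i = 0) {a : ℝ} (ha0 : 0 ≤ a)
    (ha : ∀ i ∈ s, ∀ j ∈ s, i ≠ j → D i j ≤ a) : (#s : ℝ) * F D y ≤ a * (#s - 1) := by
  have hsum : ∑ i ∈ s, y i = 1 := by
    rw [← hy1]
    exact sum_subset (subset_univ s) fun i _ hi => hs i hi
  have h1 : F D y ≤ a * (1 - ∑ i ∈ s, y i ^ 2) := by
    rw [F_support D y s hs]
    calc ∑ i ∈ s, ∑ j ∈ s, D i j * y i * y j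
        ≤ ∑ i ∈ s, ∑ j ∈ s, (a * y i * y j - if i = j then a * y i * y i else 0) := by
          refine sum_le_sum fun i hi => sum_le_sum fun j hj => ?_
          by_cases hij : i = j
          · subst hij; simp [hd]
          · simp only [hij, if_false, sub_zero]
            have := ha i hi j hj hij
            have := hy i
            have := hy j
            gcongr
      _ = a * (1 - ∑ i ∈ s, y i ^ 2) := by
          have e : ∀ i ∈ s, ∑ j ∈ s, (a * y i * y j - if i = j then a * y i * y i else 0) =
              a * y i - a * y i ^ 2 := by
            intro i hi
            rw [sum_sub_distrib, ← mul_sum, hsum, sum_ite_eq, if_pos hi]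
            ring
          rw [sum_congr rfl e, sum_sub_distrib, ← mul_sum, ← mul_sum, hsum]
          ring
  have h2 := sq_sum_le_card_mul_sum_sq (s := s) (f := y)
  rw [hsum] at h2
  have h3 : (#s : ℝ) * F D y ≤ #s * (a * (1 - ∑ i ∈ s, y i ^ 2)) := by gcongr
  nlinarith

lemma exists_configuration (D : Matrix ι ι ℝ) (hsymm : D.transpose = D) (hd : ∀ i, D i i = 0)
    (hnn : ∀ i j, 0 ≤ D i j)
    (x : ι → ℝ) (hx : ∀ i, 0 ≤ x i) (hx1 : ∑ i, x i = 1) (hF : 1 / 4 < F D x) :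
    (∃ u w : ι, ∃ J : Finset ι, u ≠ w ∧ u ∉ J ∧ w ∉ J ∧ #J ≤ 5 ∧
      (∀ i ∈ insert u (insert w J), ∀ j ∈ insert u (insert w J), i ≠ j → 0 < D i j) ∧
      ((5 - #J : ℕ) : ℝ) < 10 * D u w) ∨
    (∃ i j k : ι, 0 < D i j ∧ 0 < D i k ∧ 3 < 10 * D j k ∧ 1 < 10 * (D i j * D i k)) := by
  obtain ⟨y, hy, hy1, hFy, hcl⟩ := exists_clique_support D hsymm hd x hx hx1
  have hFy' : 1 / 4 < F D y := hF.trans_le hFy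
  set s : Finset ι := {i | y i ≠ 0} with hsdef
  have hs : ∀ i, i ∉ s → y i = 0 := by intro i hi; simpa [hsdef] using hi
  have hpos : ∀ i ∈ s, ∀ j ∈ s, i ≠ j → 0 < D i j := by
    intro i hi j hj hij
    simp only [hsdef, mem_filter, mem_univ, true_and] at hi hj
    exact lt_of_le_of_ne (hnn i j) (Ne.symm (hcl i j hij hi hj))
  by_contra! hcon
  obtain ⟨hA, hB⟩ := hcon
  have hsub : ∀ u ∈ s, ∀ w ∈ s, ∀ J ⊆ s, ∀ i ∈ insert u (insert w J), i ∈ s := by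
    intro u hu w hw J hJ i hi
    simp only [mem_insert] at hi
    rcases hi with rfl | rfl | hi
    · exact hu
    · exact hw
    · exact hJ hi
  have hle : #s < 7 := by
    by_contra! h7
    obtain ⟨S, hS, hSc⟩ := exists_subset_card_eq h7
    obtain ⟨u, hu, w, hw, huw⟩ := one_lt_card.1 (show 1 < #S by omega)
    have hc : #((S.erase u).erase w) = 5 := by
      rw [card_erase_of_mem (mem_erase.2 ⟨huw.symm, hw⟩), card_erase_of_mem hu, hSc]
    have := hA u w ((S.erase u).erase w) huw (by simp) (by simp) (by omega)
      (fun i hi j hj hij => hpos i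
        (hsub u (hS hu) w (hS hw) _ (((erase_subset _ _).trans (erase_subset _ _)).trans hS) i hi) j
        (hsub u (hS hu) w (hS hw) _ (((erase_subset _ _).trans (erase_subset _ _)).trans hS) j hj)
        hij)
    rw [hc] at this
    have := hpos u (hS hu) w (hS hw) huw
    norm_num at *
    linarith
  have hD : ∀ u ∈ s, ∀ w ∈ s, u ≠ w → D u w ≤ (7 - #s) / 10 := by
    intro u hu w hw huw
    have h2 : 2 ≤ #s := one_lt_card.2 ⟨u, hu, w, hw, huw⟩
    have hc : #((s.erase u).erase w) = #s - 2 := by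
      rw [card_erase_of_mem (mem_erase.2 ⟨huw.symm, hw⟩), card_erase_of_mem hu]
      omega
    have := hA u w ((s.erase u).erase w) huw (by simp) (by simp) (by omega)
      (fun i hi j hj hij => hpos i
        (hsub u hu w hw _ ((erase_subset _ _).trans (erase_subset _ _)) i hi) j
        (hsub u hu w hw _ ((erase_subset _ _).trans (erase_subset _ _)) j hj) hij)
    rw [hc, show 5 - (#s - 2) = 7 - #s by omega, Nat.cast_sub (by omega)] at this
    push_cast at this
    linarith
  have hle' : (#s : ℝ) < 7 := by exact_mod_cast hle
  have hmain := F_le D hd y hy hy1 s hs (by linarith) hD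
  have h3 : #s = 3 := by
    generalize #s = m at *
    have h0 : m ≠ 0 := by
      rintro rfl
      norm_num at hmain
    interval_cases m <;> first | rfl | (exfalso; first | exact h0 rfl | (norm_num at hmain; linarith))
  rw [h3] at hD
  norm_num at hD
  clear hmain hle hle'
  obtain ⟨i, j, k, hij, hik, hjk, hsijk⟩ := card_eq_three.1 h3
  have hi : i ∈ s := by rw [hsijk]; simp
  have hj : j ∈ s := by rw [hsijk]; simp
  have hk : k ∈ s := by rw [hsijk]; simp
  have hsy : ∀ a b, D a b = D b a := fun a b => by
    conv_lhs => rw [← hsymm]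
    rfl
  have hsum : y i + y j + y k = 1 := by
    rw [← hy1, ← sum_subset (subset_univ s) fun i _ hi => hs i hi, hsijk]
    rw [sum_insert (by simp [hij, hik]), sum_insert (by simp [hjk]), sum_singleton]
    ring
  have hFe : F D y = 2 * (D j k * (y j * y k) + D i k * (y i * y k) + D i j * (y i * y j)) := by
    rw [F_support D y s hs, hsijk]
    have e : ∀ f : ι → ℝ, ∑ a ∈ ({i, j, k} : Finset ι), f a = f i + f j + f k := by
      intro f
      rw [sum_insert (by simp [hij, hik]), sum_insert (by simp [hjk]), sum_singleton]
      ring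
    rw [e, e, e, e, hd, hd, hd, hsy j i, hsy k i, hsy k j]
    ring
  have t1 : D i j ≤ 4/10 := by linarith [hD i hi j hj hij]
  have t2 : D i k ≤ 4/10 := by linarith [hD i hi k hk hik]
  have t3 : D j k ≤ 4/10 := by linarith [hD j hj k hk hjk]
  have p1 := hpos i hi j hj hij
  have p2 := hpos i hi k hk hik
  have p3 := hpos j hj k hk hjk
  have q1 : D j k ≤ 3/10 ∨ D i k * D i j ≤ 1/10 := by
    by_contra! h
    have := hB i j k p1 p2 (by linarith)
    nlinarith
  have q2 : D i k ≤ 3/10 ∨ D j k * D i j ≤ 1/10 := by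
    by_contra! h
    have := hB j i k (by rwa [hsy]) p3 (by linarith)
    rw [hsy j i] at this
    nlinarith
  have q3 : D i j ≤ 3/10 ∨ D i k * D j k ≤ 1/10 := by
    by_contra! h
    have := hB k i j (by rwa [hsy]) (by rwa [hsy]) (by linarith)
    rw [hsy k i, hsy k j] at this
    nlinarith
  rcases q1 with q1 | q1
  · rcases q2 with q2 | q2
    · rcases q3 with q3 | q3
      · have e1 : D j k * (y j * y k) ≤ 3/10 * (y j * y k) :=
          mul_le_mul_of_nonneg_right q1 (mul_nonneg (hy _) (hy _))
        have e2 : D i k * (y i * y k) ≤ 3/10 * (y i * y k) :=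
          mul_le_mul_of_nonneg_right q2 (mul_nonneg (hy _) (hy _))
        have e3 : D i j * (y i * y j) ≤ 3/10 * (y i * y j) :=
          mul_le_mul_of_nonneg_right q3 (mul_nonneg (hy _) (hy _))
        have e4 : (y i + y j + y k)^2 = 1 := by rw [hsum]; norm_num
        nlinarith [sq_nonneg (y i - y j), sq_nonneg (y i - y k), sq_nonneg (y j - y k)]
      · have := tri_ineq (hy k) (hy i) (hy j) (by linarith) t1 t3 t2 (by rw [mul_comm]; exact q3)
        nlinarith
    · have := tri_ineq (hy j) (hy i) (hy k) (by linarith) t2 t3 t1 q2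
      nlinarith
  · have := tri_ineq (hy i) (hy j) (hy k) hsum t3 t2 t1 q1
    nlinarith
end
end RT

namespace RT
open Finset
open scoped Classical

section
variable {V : Type*} [Fintype V]

/-- The weighted reduced matrix of a partition. -/
noncomputable def Dm (G : SimpleGraph V) (P : Finpartition (univ : Finset V)) (ε η : ℝ) :
    Matrix (Finset V) (Finset V) ℝ := fun U W =>
  if U ∈ P.parts ∧ W ∈ P.parts ∧ U ≠ W ∧ G.IsUniform ε U W ∧ 2 * η ≤ (G.edgeDensity U W : ℝ)
  then (G.edgeDensity U W : ℝ) - 2 * η else 0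

/-- The weights of the parts. -/
noncomputable def wt (P : Finpartition (univ : Finset V)) : Finset V → ℝ := fun U =>
  if U ∈ P.parts then (#U : ℝ) / Fintype.card V else 0

variable {G : SimpleGraph V} {P : Finpartition (univ : Finset V)} {ε η : ℝ}

lemma LowReg.weaken {ρ d d' : ℝ} {U W : Finset V} (h : LowReg G ρ d U W) (hd : d' ≤ d) :
    LowReg G ρ d' U W := by
  intro X hX Y hY h1 h2
  refine le_trans ?_ (h X hX Y hY h1 h2)
  gcongr

lemma Dm_nonneg (U W : Finset V) : 0 ≤ Dm G P ε η U W := by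
  unfold Dm
  split_ifs with h
  · linarith [h.2.2.2.2]
  · exact le_rfl

lemma Dm_symm : (Dm G P ε η).transpose = Dm G P ε η := by
  ext U W
  simp only [Matrix.transpose_apply, Dm]
  have h : (W ∈ P.parts ∧ U ∈ P.parts ∧ W ≠ U ∧ G.IsUniform ε W U ∧
      2 * η ≤ (G.edgeDensity W U : ℝ)) ↔ (U ∈ P.parts ∧ W ∈ P.parts ∧ U ≠ W ∧ G.IsUniform ε U W ∧
      2 * η ≤ (G.edgeDensity U W : ℝ)) := by
    rw [SimpleGraph.isUniform_comm, G.edgeDensity_comm W U]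
    exact ⟨fun h => ⟨h.2.1, h.1, h.2.2.1.symm, h.2.2.2⟩,
      fun h => ⟨h.2.1, h.1, h.2.2.1.symm, h.2.2.2⟩⟩
  by_cases hc : U ∈ P.parts ∧ W ∈ P.parts ∧ U ≠ W ∧ G.IsUniform ε U W ∧
      2 * η ≤ (G.edgeDensity U W : ℝ)
  · rw [if_pos hc, if_pos (h.2 hc), G.edgeDensity_comm W U]
  · rw [if_neg hc, if_neg (fun hh => hc (h.1 hh))]

lemma Dm_diag (U : Finset V) : Dm G P ε η U U = 0 := by
  simp [Dm]

lemma Dm_pos {U W : Finset V} (h : 0 < Dm G P ε η U W) :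
    U ∈ P.parts ∧ W ∈ P.parts ∧ U ≠ W ∧ G.IsUniform ε U W ∧
      (G.edgeDensity U W : ℝ) = Dm G P ε η U W + 2 * η := by
  by_cases hc : U ∈ P.parts ∧ W ∈ P.parts ∧ U ≠ W ∧ G.IsUniform ε U W ∧
      2 * η ≤ (G.edgeDensity U W : ℝ)
  · refine ⟨hc.1, hc.2.1, hc.2.2.1, hc.2.2.2.1, ?_⟩
    rw [Dm, if_pos hc]
    ring
  · rw [Dm, if_neg hc] at h
    exact absurd h (lt_irrefl _)

lemma wt_nonneg (U : Finset V) : 0 ≤ wt P U := by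
  unfold wt
  split_ifs <;> positivity

lemma wt_sum [Nonempty V] : ∑ U, wt P U = 1 := by
  have h : (0:ℝ) < Fintype.card V := by exact_mod_cast Fintype.card_pos
  have h1 : ∑ U ∈ P.parts, (#U : ℝ) = Fintype.card V := by
    have := P.sum_card_parts
    rw [card_univ] at this
    exact_mod_cast this
  have : ∑ U, wt P U = ∑ U ∈ P.parts, (#U : ℝ) / Fintype.card V := by
    simp [wt]
  rw [this, ← sum_div, h1, div_self h.ne']

lemma F_wt [Nonempty V] (D : Matrix (Finset V) (Finset V) ℝ) :
    F D (wt P) * (Fintype.card V : ℝ) ^ 2 =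
      ∑ U ∈ P.parts, ∑ W ∈ P.parts, D U W * #U * #W := by
  have h : (0:ℝ) < Fintype.card V := by exact_mod_cast Fintype.card_pos
  have h1 : F D (wt P) = ∑ U ∈ P.parts, ∑ W ∈ P.parts, D U W * wt P U * wt P W := by
    unfold F
    symm
    rw [← sum_subset (subset_univ P.parts)]
    · refine sum_congr rfl fun U _ => sum_subset (subset_univ P.parts) fun W _ hW => ?_
      simp [wt, hW]
    · intro U _ hU
      simp [wt, hU]
  rw [h1, sum_mul]
  refine sum_congr rfl fun U hU => ?_
  rw [sum_mul]
  refine sum_congr rfl fun W hW => ?_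
  simp only [wt, hU, hW, if_true]
  field_simp

lemma interedges_le {U W : Finset V} (hU : U ∈ P.parts) (hW : W ∈ P.parts) (hη : 0 < η) :
    (#(G.interedges U W) : ℝ) ≤ (if U = W then (#U : ℝ) * #W else 0) +
      (if (U, W) ∈ P.nonUniforms G ε then (#U : ℝ) * #W else 0) +
      (Dm G P ε η U W * #U * #W + 2 * η * (#U * #W)) := by
  have h0 : (#(G.interedges U W) : ℝ) ≤ #U * #W := by
    exact_mod_cast G.card_interedges_le_mul U W
  have hD := Dm_nonneg (G := G) (P := P) (ε := ε) (η := η) U W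
  have hp : (0:ℝ) ≤ #U * #W := by positivity
  have hp1 : 0 ≤ Dm G P ε η U W * #U * #W := by positivity
  have hp2 : 0 ≤ 2 * η * ((#U : ℝ) * #W) := by positivity
  by_cases h1 : U = W
  · have : (0:ℝ) ≤ if (U, W) ∈ P.nonUniforms G ε then (#U : ℝ) * #W else 0 := by
      split_ifs <;> linarith
    rw [if_pos h1]
    linarith
  rw [if_neg h1]
  by_cases h2 : (U, W) ∈ P.nonUniforms G ε
  · rw [if_pos h2]
    linarith
  rw [if_neg h2]
  have hu : G.IsUniform ε U W := by
    by_contra hu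
    exact h2 ((P.mk_mem_nonUniforms G).2 ⟨hU, hW, h1, hu⟩)
  have he : (#(G.interedges U W) : ℝ) = (G.edgeDensity U W : ℝ) * (#U * #W) := by
    have hU0 : (#U : ℝ) ≠ 0 := by exact_mod_cast (P.nonempty_of_mem_parts hU).card_pos.ne'
    have hW0 : (#W : ℝ) ≠ 0 := by exact_mod_cast (P.nonempty_of_mem_parts hW).card_pos.ne'
    rw [SimpleGraph.edgeDensity_def]
    push_cast
    field_simp
  rw [he]
  by_cases h3 : 2 * η ≤ (G.edgeDensity U W : ℝ)
  · rw [Dm, if_pos ⟨hU, hW, h1, hu, h3⟩]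
    apply le_of_eq
    ring
  · push Not at h3
    have := mul_le_mul_of_nonneg_right h3.le hp
    linarith

lemma edge_count [Nonempty V] (hη : 0 < η) (hε : 0 < ε) (hε4 : 4 * ε ≤ η)
    (hP : P.IsEquipartition) (hk : 2 ≤ η * #P.parts) (hu : P.IsUniform G ε) :
    2 * (#G.edgeFinset : ℝ) ≤ (F (Dm G P ε η) (wt P) + 4 * η) * (Fintype.card V : ℝ) ^ 2 := by
  set n : ℝ := (Fintype.card V : ℝ) with hn
  have hnp : 0 < n := by rw [hn]; exact_mod_cast Fintype.card_pos
  have hkn : (#P.parts : ℝ) ≤ n := by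
    have := P.card_parts_le_card
    rw [card_univ] at this
    rw [hn]
    exact_mod_cast this
  have hkp : (0:ℝ) < #P.parts := by
    by_contra h
    nlinarith
  have hs : ∑ U ∈ P.parts, (#U : ℝ) = n := by
    have := P.sum_card_parts
    rw [card_univ] at this
    rw [hn]
    exact_mod_cast this
  have h0 : 2 * (#G.edgeFinset : ℝ) =
      ∑ U ∈ P.parts, ∑ W ∈ P.parts, (#(G.interedges U W) : ℝ) := by
    have h1 : 2 * #G.edgeFinset = #(G.interedges univ univ) := by
      rw [SimpleGraph.two_mul_card_edgeFinset]
      rfl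
    rw [SimpleGraph.interedges, Rel.card_interedges_finpartition G.Adj P P, sum_product] at h1
    exact_mod_cast h1
  have hd : ∑ U ∈ P.parts, ∑ W ∈ P.parts, (if U = W then (#U : ℝ) * #W else 0) ≤ η * n ^ 2 := by
    calc ∑ U ∈ P.parts, ∑ W ∈ P.parts, (if U = W then (#U : ℝ) * #W else 0)
        = ∑ U ∈ P.parts, (#U : ℝ) * #U := by
          refine sum_congr rfl fun U hU => ?_
          rw [sum_ite_eq, if_pos hU]
      _ ≤ ∑ U ∈ P.parts, η * n * (#U : ℝ) := by
          refine sum_le_sum fun U hU => ?_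
          have h1 := hP.card_part_le_average_add_one hU
          rw [card_univ] at h1
          have h2 : (#U : ℝ) ≤ ((Fintype.card V / #P.parts : ℕ) : ℝ) + 1 := by exact_mod_cast h1
          have h3 : ((Fintype.card V / #P.parts : ℕ) : ℝ) ≤ n / #P.parts := Nat.cast_div_le
          have h4 : (1:ℝ) ≤ n / #P.parts := by rwa [one_le_div hkp]
          have h5 : n / #P.parts * 2 ≤ η * n := by
            rw [div_mul_eq_mul_div, div_le_iff₀ hkp]
            nlinarith
          have : (#U : ℝ) ≤ η * n := by linarith
          gcongr
      _ = η * n ^ 2 := by rw [← mul_sum, hs]; ring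
  have hnu : ∑ U ∈ P.parts, ∑ W ∈ P.parts,
      (if (U, W) ∈ P.nonUniforms G ε then (#U : ℝ) * #W else 0) ≤ η * n ^ 2 := by
    have h1 := hP.sum_nonUniforms_lt' univ_nonempty hε hu
    rw [card_univ] at h1
    have h2 : ∑ U ∈ P.parts, ∑ W ∈ P.parts,
      (if (U, W) ∈ P.nonUniforms G ε then (#U : ℝ) * #W else 0) =
        ∑ i ∈ P.nonUniforms G ε, (#i.1 * #i.2 : ℝ) := by
      rw [← sum_product' (f := fun U W => if (U, W) ∈ P.nonUniforms G ε then (#U : ℝ) * #W else 0)]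
      rw [← sum_filter]
      refine sum_congr ?_ fun _ _ => rfl
      ext ⟨U, W⟩
      simp only [mem_filter, mem_product, Finpartition.mk_mem_nonUniforms]
      tauto
    rw [h2]
    refine h1.le.trans ?_
    calc ε * (n + #P.parts) ^ 2 ≤ ε * (n + n) ^ 2 := by gcongr
      _ = 4 * ε * n ^ 2 := by ring
      _ ≤ η * n ^ 2 := by gcongr
  have hpr : ∑ U ∈ P.parts, ∑ W ∈ P.parts, 2 * η * ((#U : ℝ) * #W) = 2 * η * n ^ 2 := by
    simp_rw [← mul_sum]
    rw [← sum_mul, hs]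
    ring
  rw [h0, add_mul, F_wt]
  calc _ ≤ _ := sum_le_sum fun U hU => sum_le_sum fun W hW =>
        interedges_le (G := G) (ε := ε) hU hW hη
    _ ≤ _ := by
      simp only [sum_add_distrib]
      rw [hpr]
      linarith

lemma rich_of {ε ρ : ℝ} (hρ : ε * Fintype.card V < ρ)
    (h : ∀ S : Finset V, (G.induce (S : Set V)).CliqueFree 10 → (#S : ℝ) ≤ ε * Fintype.card V) :
    Rich G ρ := by
  intro S hS
  by_contra hc
  push Not at hc
  have := h S (by
    intro t ht
    refine hc (t.map (Function.Embedding.subtype _)) ?_ ?_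
    · intro x hx
      rw [mem_map] at hx
      obtain ⟨y, -, rfl⟩ := hx
      exact y.2
    · have := ht.map (f := Function.Embedding.subtype _)
      exact this.mono (SimpleGraph.map_comap_le _ _))
  linarith

end
section
variable {V : Type*} [Fintype V]

lemma core [Nonempty V] {G : SimpleGraph V} {P : Finpartition (univ : Finset V)} {r η L ρ : ℝ}
    (hη : 0 < η) (hη1 : η ≤ 1 / 10) (hr : 0 < r) (hr4 : 4 * r ≤ η) (hρL : ρ = r * L)
    (hr0 : ρ ≤ η ^ 7 * L / 2 ^ 30) (hL2 : 2 ≤ L)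
    (hup : ∀ U ∈ P.parts, (#U : ℝ) ≤ L) (hlow : ∀ U ∈ P.parts, L / 2 ≤ (#U : ℝ))
    (hρ : 0 < ρ) (hR : Rich G ρ) (hF : 1 / 4 < F (Dm G P r η) (wt P)) :
    ∃ K, G.IsNClique 16 K := by
  have hp4 : η ^ 7 ≤ η ^ 4 := pow_le_pow_of_le_one hη.le (by linarith) (by norm_num)
  have hp2 : η ^ 7 ≤ η ^ 2 := pow_le_pow_of_le_one hη.le (by linarith) (by norm_num)
  have hp5 : η ^ 7 ≤ η ^ 5 := pow_le_pow_of_le_one hη.le (by linarith) (by norm_num)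
  have hLR : ∀ U W, 0 < Dm G P r η U W → LowReg G (ρ) (Dm G P r η U W + η) U W := by
    intro U W h
    obtain ⟨h1, h2, -, h4, h5⟩ := Dm_pos h
    refine lowReg_of_uniform h4 (by rw [h5]; linarith) ?_ ?_
    · rw [mul_comm, hρL]
      have := hup U h1
      gcongr
    · rw [mul_comm, hρL]
      have := hup W h2
      gcongr
  have hκ : 0 < η ^ 2 := by positivity
  have hκ1 : η ^ 2 ≤ 1 := by nlinarith
  rcases exists_configuration (Dm G P r η) Dm_symm Dm_diag Dm_nonneg (wt P) wt_nonneg wt_sum hF with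
    ⟨u, w, J, huw, huJ, hwJ, hJ, hpos, ht⟩ | ⟨i, j, k, hij, hik, hjk, hbc⟩
  · have huwp : 0 < Dm G P r η u w := hpos u (by simp) w (by simp) huw
    have hparts : ∀ i, (i = u ∨ i = w ∨ i ∈ J) → i ∈ P.parts := by
      intro i hi
      by_cases hiu : i = u
      · rw [hiu]
        exact (Dm_pos huwp).1
      · exact (Dm_pos (hpos i (by simpa using hi) u (by simp) hiu)).1
    obtain ⟨K, -, hK'⟩ := ext_step (ρ := ρ) (κ := η ^ 2) (η := η) (s := η ^ 5 * (L / 2))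
      (d := Dm G P r η u w + η) (u := u) (w := w) hρ hR (5 - #J) hκ hη (by linarith) hκ1
      (by nlinarith) (by
        have := mul_le_mul_of_nonneg_right hp5 (show 0 ≤ L by linarith)
        have : 0 < η ^ 7 * L := by positivity
        linarith) (by
        have : 0 < η ^ 7 * L := by positivity
        have : η ^ 2 / 20480 * (η ^ 5 * (L / 2)) = η ^ 7 * L / 40960 := by ring
        linarith) J hJ huJ hwJ id
      (fun i hi j hj hne => (hLR i j (hpos i hi j hj hne)).weaken
        (by linarith [hpos i hi j hj hne]))
      (hLR u w huwp) (fun i hi => by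
        have h1 := hlow i (hparts i (by simpa using hi))
        have h2 : η ^ 5 ≤ η ^ #J := pow_le_pow_of_le_one hη.le (by linarith) hJ
        have : (0:ℝ) ≤ L / 2 := by linarith
        simp only [id]
        gcongr)
    rw [show #J + (5 - #J + 11) = 16 by omega] at hK'
    exact ⟨K, hK'⟩
  · have hi := (Dm_pos hij).1
    have hj := (Dm_pos hij).2.1
    have hk := (Dm_pos hik).2.1
    have hjkp : 0 < Dm G P r η j k := by linarith
    have hη4 : ρ ≤ η ^ 2 / 20480 * (η ^ 2 / 20480 * (L / 2)) := by
      have := mul_le_mul_of_nonneg_right hp4 (show 0 ≤ L by linarith)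
      have : η ^ 2 / 20480 * (η ^ 2 / 20480 * (L / 2)) = η ^ 4 * L / 838860800 := by ring
      have : 0 < η ^ 7 * L := by positivity
      linarith
    have hη2 : 2 * (ρ) ≤ η ^ 2 / 20480 * (L / 2) := by
      have := mul_le_mul_of_nonneg_right hp2 (show 0 ≤ L by linarith)
      have : 0 < η ^ 7 * L := by positivity
      linarith
    obtain ⟨K, hK'⟩ := triangle_step (κ := η ^ 2) hρ hR hκ hκ1 (by linarith) (by linarith)
      (hLR i j hij) (hLR i k hik) (hLR j k hjkp) (by nlinarith) (by nlinarith) (by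
        have := hlow i hi
        nlinarith) (hη2.trans (by
        have := hlow j hj
        gcongr)) (hη4.trans (by
        have := hlow k hk
        gcongr))
    exact ⟨K, hK'⟩

end
end RT

namespace RT
open Finset
open scoped Classical

section
lemma main (δ : ℝ) (hδ : 0 < δ) :
    ∃ ε : ℝ, 0 < ε ∧ ∃ n₀ : ℕ, ∀ n : ℕ, n₀ ≤ n →
      ∀ (V : Type) [Fintype V], Fintype.card V = n → ∀ G : SimpleGraph V,
        G.CliqueFree 16 →
        (∀ S : Finset V, (G.induce (S : Set V)).CliqueFree 10 →
          (S.card : ℝ) ≤ ε * n) →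
        (G.edgeSet.ncard : ℝ) ≤ (1 / 8 + δ) * n ^ 2 := by
  obtain ⟨η, hη, hη1, hηδ⟩ : ∃ η : ℝ, 0 < η ∧ η ≤ 1 / 10 ∧ 4 * η ≤ δ :=
    ⟨min (δ / 4) (1 / 10), by positivity, min_le_right _ _, by
      linarith [min_le_left (δ / 4) (1 / 10)]⟩
  have hpow : ∀ k : ℕ, η ^ (k + 1) ≤ η ^ k := fun k =>
    pow_le_pow_of_le_one hη.le (by linarith) (Nat.le_succ k)
  obtain ⟨r, hr, hr0⟩ : ∃ r : ℝ, 0 < r ∧ r = η ^ 7 / 2 ^ 40 := ⟨_, by positivity, rfl⟩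
  have hp1 : η ^ 7 ≤ η := by
    simpa using pow_le_pow_of_le_one hη.le (by linarith) (show 1 ≤ 7 by norm_num)
  have hp4 : η ^ 7 ≤ η ^ 4 := pow_le_pow_of_le_one hη.le (by linarith) (by norm_num)
  have hp2 : η ^ 7 ≤ η ^ 2 := pow_le_pow_of_le_one hη.le (by linarith) (by norm_num)
  have hp5 : η ^ 7 ≤ η ^ 5 := pow_le_pow_of_le_one hη.le (by linarith) (by norm_num)
  have hp7 : 0 < η ^ 7 := by positivity
  have hr4 : 4 * r ≤ η := by rw [hr0]; linarith
  obtain ⟨l, hl2⟩ : ∃ l : ℕ, 2 ≤ η * l := by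
    refine ⟨⌈2 / η⌉₊, ?_⟩
    have := Nat.le_ceil (2 / η)
    rw [div_le_iff₀ hη] at this
    linarith
  obtain ⟨M, hM⟩ : ∃ M : ℕ, M = SzemerediRegularity.bound r l := ⟨_, rfl⟩
  have hMp : 0 < M := by
    rw [hM]
    exact SzemerediRegularity.bound_pos _ _
  refine ⟨r / (2 * M), by positivity, l + 1, fun n hn V _ hVn G hK hα => ?_⟩
  have : Nonempty V := Fintype.card_pos_iff.1 (by omega)
  obtain ⟨P, hPe, hPl, hPM, hPu⟩ := szemeredi_regularity G (l := l) hr (by omega)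
  rw [← hM] at hPM
  by_contra hcon
  push Not at hcon
  have hnp : (0:ℝ) < n := by exact_mod_cast (show 0 < n by omega)
  have hkη : 2 ≤ η * #P.parts := by
    have : (l:ℝ) ≤ #P.parts := by exact_mod_cast hPl
    nlinarith
  have hkp : (0:ℝ) < #P.parts := by
    by_contra h
    nlinarith
  have hkp' : 0 < #P.parts := by exact_mod_cast hkp
  have hE := edge_count (G := G) hη hr hr4 hPe hkη hPu
  have hcard : G.edgeSet.ncard = #G.edgeFinset := by
    rw [← SimpleGraph.coe_edgeFinset, Set.ncard_coe_finset]
  rw [hcard] at hcon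
  rw [hVn] at hE
  have hF : 1 / 4 < F (Dm G P r η) (wt P) := by
    by_contra hF
    push Not at hF
    have : (F (Dm G P r η) (wt P) + 4 * η) * (n:ℝ) ^ 2 ≤ (1 / 4 + δ) * n ^ 2 := by
      gcongr
    have : 0 < δ * (n:ℝ) ^ 2 := by positivity
    linarith
  set L : ℝ := ((n / #P.parts : ℕ) : ℝ) + 1 with hL
  have hkn : #P.parts ≤ n := by
    rw [← hVn, ← card_univ]
    exact P.card_parts_le_card
  have hL2 : 2 ≤ L := by
    have : 1 ≤ n / #P.parts := (Nat.one_le_div_iff hkp').2 hkn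
    have : (1:ℝ) ≤ ((n / #P.parts : ℕ) : ℝ) := by exact_mod_cast this
    linarith
  have hnL : (n:ℝ) / #P.parts < L := by
    rw [div_lt_iff₀ hkp, hL]
    have := Nat.lt_mul_div_succ n hkp'
    have h' : (n:ℝ) < #P.parts * (((n / #P.parts : ℕ) : ℝ) + 1) := by exact_mod_cast this
    linarith
  have hup : ∀ U ∈ P.parts, (#U : ℝ) ≤ L := fun U hU => by
    have := hPe.card_part_le_average_add_one hU
    rw [card_univ, hVn] at this
    rw [hL]
    exact_mod_cast this
  have hlow : ∀ U ∈ P.parts, L / 2 ≤ (#U : ℝ) := fun U hU => by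
    have := hPe.average_le_card_part hU
    rw [card_univ, hVn] at this
    have : ((n / #P.parts : ℕ) : ℝ) ≤ #U := by exact_mod_cast this
    linarith
  have hρ : 0 < r * L := by positivity
  have hR : Rich G (r * L) := by
    refine rich_of (ε := r / (2 * M)) ?_ (by rwa [hVn])
    rw [hVn]
    calc r / (2 * M) * n ≤ r / #P.parts * n := by
          have : (#P.parts : ℝ) ≤ M := by exact_mod_cast hPM
          gcongr
          linarith
      _ = r * (n / #P.parts) := by ring
      _ < r * L := by gcongr
  obtain ⟨K, hK'⟩ := core (ρ := r * L) hη hη1 hr hr4 rfl (by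
    rw [hr0, div_mul_eq_mul_div]
    gcongr
    · norm_num
    · norm_num) hL2 hup hlow hρ hR hF
  exact hK K hK'
end
end RT


/-- **Proposition.** `θ₁₀(K₁₆) ≤ 1/8`: for every `δ > 0` there are `ε > 0`
and `n₀` such that for all `n ≥ n₀`, every `K₁₆`-free graph `G` on `n`
vertices with `α₁₀(G) ≤ ε·n` has at most `(1/8 + δ)·n²` edges. -/
theorem theta_ten_K_sixteen (δ : ℝ) (hδ : 0 < δ) :
    ∃ ε : ℝ, 0 < ε ∧ ∃ n₀ : ℕ, ∀ n : ℕ, n₀ ≤ n →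
      ∀ G : SimpleGraph (Fin n),
        G.CliqueFree 16 →
        (∀ S : Finset (Fin n), (G.induce (S : Set (Fin n))).CliqueFree 10 →
          (S.card : ℝ) ≤ ε * n) →
        (G.edgeSet.ncard : ℝ) ≤ (1 / 8 + δ) * n ^ 2 := by

  obtain ⟨ε, hε, n₀, h⟩ := RT.main δ hδ
  exact ⟨ε, hε, n₀, fun n hn G => h n hn (Fin n) (Fintype.card_fin n) G⟩
end
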